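/- The normalized error γ_n^{−1/2}(x_n − μ) converges in distribution, as n → ∞, to the centered Gaussian law N(0, V_x(α)) on ℝ^N, where V_x(α) = Σ_{i=1}^{N−1} [1/(2α(1+λ_i) + 2 − 𝟙_{a=1})]·[(1+λ_i)/(1−λ_i)]·u_i u_i^T. -/

import Mathlib

open MeasureTheory Filter Matrix Finset
open scoped Topology

noncomputable section

/-- The interior of the probability simplex in `ℝ^N`. -/
def intSimplex (N : ℕ) : Set (Fin N → ℝ) :=
  {x | (∀ i, 0 < x i) ∧ ∑ i, x i = 1}

/-- The self-repellent random walk (SRRW) kernel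
`K_{ij}[x] = P_{ij}(x_j/μ_j)^{−α} / ∑_k P_{ik}(x_k/μ_k)^{−α}`. -/
def srrwKernel {N : ℕ} (P : Matrix (Fin N) (Fin N) ℝ) (μ : Fin N → ℝ) (α : ℝ)
    (x : Fin N → ℝ) : Matrix (Fin N) (Fin N) ℝ :=
  Matrix.of fun i j =>
    P i j * (x j / μ j) ^ (-α) / ∑ k, P i k * (x k / μ k) ^ (-α)

/-- A sequence of random vectors `Z_n : Ω → ℝ^N` converges in distribution (under `Pr`) to the
(possibly degenerate) centered Gaussian law `N(0, V)` iff its characteristic functions converge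
pointwise to the Gaussian characteristic function `t ↦ exp(−tᵀVt/2)` (Lévy's continuity
theorem makes this equivalent to weak convergence of the laws). -/
def TendstoGaussian {Ω : Type*} [MeasurableSpace Ω] (Pr : Measure Ω) {N : ℕ}
    (Z : ℕ → Ω → (Fin N → ℝ)) (V : Matrix (Fin N) (Fin N) ℝ) : Prop :=
  ∀ t : Fin N → ℝ,
    Tendsto (fun n => ∫ ω, Complex.exp (Complex.I * ((∑ j, t j * Z n ω j : ℝ) : ℂ)) ∂Pr)
      atTop (𝓝 (Complex.exp (((-(t ⬝ᵥ (V *ᵥ t)) / 2 : ℝ) : ℂ))))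

/-! ### Deterministic recursions -/

/-- Step sizes: positive, vanishing, non-summable. -/
structure StepSeq (g : ℕ → ℝ) : Prop where
  pos : ∀ n, 0 < g n
  lim : Tendsto g atTop (𝓝 0)
  div : Tendsto (fun n => ∑ k ∈ range n, g k) atTop atTop

lemma StepSeq.shift {g : ℕ → ℝ} (hg : StepSeq g) (m : ℕ) :
    Tendsto (fun n => ∑ k ∈ range n, g (m + k)) atTop atTop := by
  have h1 : (fun n => ∑ k ∈ range n, g (m + k)) =
      fun n => (∑ k ∈ range (m + n), g k) - ∑ k ∈ range m, g k := by
    funext n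
    rw [Finset.sum_range_add]; ring
  rw [h1]
  have := (hg.div.comp (tendsto_add_atTop_nat m))
  refine tendsto_atTop_add_const_right _ _ ?_
  refine this.congr fun n => ?_
  simp [add_comm]

lemma recursion_tendsto_zero {g : ℕ → ℝ} (hg : StepSeq g) {b : ℝ} (hb : 0 < b)
    {y e : ℕ → ℝ} (hy : ∀ n, 0 ≤ y n) (he : Tendsto e atTop (𝓝 0))
    (hrec : ∀ᶠ n in atTop, y (n + 1) ≤ (1 - b * g n) * y n + g n * e n) :
    Tendsto y atTop (𝓝 0) := by
  rw [Metric.tendsto_atTop]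
  intro ε hε
  have h1 : ∀ᶠ n in atTop, e n < b * (ε / 2) :=
    he.eventually (gt_mem_nhds (by positivity))
  have h2 : ∀ᶠ n in atTop, b * g n < 1 := by
    have : Tendsto (fun n => b * g n) atTop (𝓝 0) := by simpa using hg.lim.const_mul b
    exact this.eventually (gt_mem_nhds one_pos)
  obtain ⟨m, hm⟩ := eventually_atTop.1 (h1.and (h2.and hrec))
  set d : ℕ → ℝ := fun n => max (y n - ε / 2) 0 with hd
  have hd0 : ∀ n, 0 ≤ d n := fun n => le_max_right _ _
  have hstep : ∀ n, m ≤ n → d (n + 1) ≤ Real.exp (-(b * g n)) * d n := by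
    intro n hn
    obtain ⟨ha, hb', hc⟩ := hm n hn
    have hge : 1 - b * g n ≤ Real.exp (-(b * g n)) := by
      have := Real.add_one_le_exp (-(b * g n)); linarith
    have hgp := hg.pos n
    have h3 : y (n + 1) - ε / 2 ≤ (1 - b * g n) * d n := by
      have : (1 - b * g n) * (y n - ε / 2) ≤ (1 - b * g n) * d n :=
        mul_le_mul_of_nonneg_left (le_max_left _ _) (by linarith)
      have h4 : g n * e n ≤ g n * (b * (ε / 2)) := mul_le_mul_of_nonneg_left ha.le hgp.le
      nlinarith
    have h5 : (1 - b * g n) * d n ≤ Real.exp (-(b * g n)) * d n :=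
      mul_le_mul_of_nonneg_right hge (hd0 n)
    exact max_le (h3.trans h5) (mul_nonneg (Real.exp_pos _).le (hd0 n))
  have hiter : ∀ k, d (m + k) ≤ Real.exp (-(b * ∑ i ∈ range k, g (m + i))) * d m := by
    intro k
    induction k with
    | zero => simp
    | succ k ih =>
      have := hstep (m + k) (by omega)
      rw [Finset.sum_range_succ, mul_add, neg_add, Real.exp_add, ← add_assoc]
      calc _ ≤ _ := this
        _ ≤ Real.exp (-(b * g (m + k))) * (Real.exp (-(b * ∑ i ∈ range k, g (m + i))) * d m) :=
          mul_le_mul_of_nonneg_left ih (Real.exp_pos _).le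
        _ = _ := by ring
  have hlim : Tendsto (fun k => Real.exp (-(b * ∑ i ∈ range k, g (m + i))) * d m) atTop
      (𝓝 (0 * d m)) := by
    refine Tendsto.mul_const _ ?_
    refine Real.tendsto_exp_atBot.comp ?_
    exact tendsto_neg_atTop_atBot.comp ((hg.shift m).const_mul_atTop hb)
  rw [zero_mul] at hlim
  obtain ⟨k0, hk0⟩ := eventually_atTop.1 (hlim.eventually (gt_mem_nhds (half_pos hε)))
  refine ⟨m + k0, fun n hn => ?_⟩
  obtain ⟨k, rfl⟩ := Nat.exists_eq_add_of_le (le_trans (Nat.le_add_right m k0) hn)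
  have h6 := (hiter k).trans_lt (hk0 k (by omega))
  have h7 : y (m + k) - ε / 2 ≤ d (m + k) := le_max_left _ _
  rw [Real.dist_eq, sub_zero, abs_of_nonneg (hy _)]
  linarith

lemma recursion_bounded {g : ℕ → ℝ} (hg : StepSeq g) {b : ℝ} (hb : 0 < b) {B : ℝ}
    {y : ℕ → ℝ}
    (hrec : ∀ᶠ n in atTop, y (n + 1) ≤ (1 - b * g n) * y n + g n * B) :
    ∃ D, 0 < D ∧ ∀ n, y n ≤ D := by
  have h2 : ∀ᶠ n in atTop, b * g n < 1 := by
    have : Tendsto (fun n => b * g n) atTop (𝓝 0) := by simpa using hg.lim.const_mul b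
    exact this.eventually (gt_mem_nhds one_pos)
  obtain ⟨m, hm⟩ := eventually_atTop.1 (h2.and hrec)
  have hiter : ∀ k, y (m + k) ≤ max (y m) (B / b) := by
    intro k
    induction k with
    | zero => simp
    | succ k ih =>
      obtain ⟨h3, h4⟩ := hm (m + k) (by omega)
      set D := max (y m) (B / b)
      have h5 : B ≤ b * D := by
        have : B / b ≤ D := le_max_right _ _
        rw [div_le_iff₀ hb] at this; linarith
      have h6 := hg.pos (m + k)
      have h7 : (1 - b * g (m + k)) * y (m + k) ≤ (1 - b * g (m + k)) * D :=
        mul_le_mul_of_nonneg_left ih (by linarith)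
      have h8 : g (m + k) * B ≤ g (m + k) * (b * D) := mul_le_mul_of_nonneg_left h5 h6.le
      rw [← add_assoc]
      nlinarith
  refine ⟨max (max (y m) (B / b)) (∑ k ∈ range m, |y k|) + 1, ?_, ?_⟩
  · have : 0 ≤ ∑ k ∈ range m, |y k| := Finset.sum_nonneg fun _ _ => abs_nonneg _
    have := le_max_right (max (y m) (B / b)) (∑ k ∈ range m, |y k|)
    linarith
  · intro n
    rcases lt_or_ge n m with h | h
    · have h1 : |y n| ≤ ∑ k ∈ range m, |y k| :=
        Finset.single_le_sum (f := fun k => |y k|) (fun _ _ => abs_nonneg _) (mem_range.2 h)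
      have := le_max_right (max (y m) (B / b)) (∑ k ∈ range m, |y k|)
      have := le_abs_self (y n)
      linarith
    · obtain ⟨k, rfl⟩ := Nat.exists_eq_add_of_le h
      have := le_max_left (max (y m) (B / b)) (∑ k ∈ range m, |y k|)
      linarith [hiter k]

lemma recursion_noise {g : ℕ → ℝ} (hg : StepSeq g) {c : ℝ} (hc : 0 < c)
    {r cn ε e : ℕ → ℝ} (hcn : Tendsto cn atTop (𝓝 c)) (hε : Tendsto ε atTop (𝓝 0))
    {T : ℝ} (hT : Tendsto (fun n => ∑ k ∈ range n, g k * e k) atTop (𝓝 T))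
    (hrec : ∀ n, r (n + 1) = (1 - cn n * g n) * r n + g n * (ε n + e n)) :
    Tendsto r atTop (𝓝 0) := by
  set d : ℕ → ℝ := fun n => (∑ k ∈ range n, g k * e k) - T with hd
  have hd0 : Tendsto d atTop (𝓝 0) := by simpa using hT.sub_const T
  set q : ℕ → ℝ := fun n => r n - d n with hq
  have hqrec : ∀ n, q (n + 1) = (1 - cn n * g n) * q n + g n * (ε n - cn n * d n) := by
    intro n
    simp only [hq, hd, Finset.sum_range_succ, hrec n]
    ring
  have hq0 : Tendsto (fun n => |q n|) atTop (𝓝 0) := by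
    refine recursion_tendsto_zero hg (half_pos hc) (e := fun n => |ε n - cn n * d n|)
      (fun n => abs_nonneg _) ?_ ?_
    · have := (hε.sub (hcn.mul hd0)).abs
      simpa using this
    · have h1 : ∀ᶠ n in atTop, c / 2 < cn n := hcn.eventually (lt_mem_nhds (by linarith))
      have h2 : ∀ᶠ n in atTop, cn n * g n < 1 := by
        have : Tendsto (fun n => cn n * g n) atTop (𝓝 0) := by simpa using hcn.mul hg.lim
        exact this.eventually (gt_mem_nhds one_pos)
      filter_upwards [h1, h2] with n h1 h2
      have h3 := hg.pos n
      rw [hqrec]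
      refine (abs_add_le _ _).trans ?_
      rw [abs_mul, abs_mul, abs_of_pos h3, abs_of_pos (by linarith : 0 < 1 - cn n * g n)]
      have : c / 2 * g n ≤ cn n * g n := mul_le_mul_of_nonneg_right h1.le h3.le
      have := mul_le_mul_of_nonneg_right this (abs_nonneg (q n))
      linarith
  have hq1 : Tendsto q atTop (𝓝 0) := (tendsto_zero_iff_abs_tendsto_zero _).2 hq0
  have : r = fun n => q n + d n := by funext n; simp [hq]
  rw [this]; simpa using hq1.add hd0

/-! ### The step sizes `γ_n = (n+1)^{-a}` -/

/-- All facts about `γ` used in the sequel. -/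
structure GammaSeq (γ : ℕ → ℝ) (τ : ℝ) : Prop where
  pos : ∀ n, 0 < γ n
  le_one : ∀ n, γ n ≤ 1
  anti : ∀ n, γ (n + 1) ≤ γ n
  step : StepSeq (fun n => γ (n + 1))
  diff_le : ∀ n, γ n - γ (n + 1) ≤ γ n * γ (n + 1)
  sq : Summable (fun n => γ n ^ 2)
  tau_le : τ ≤ 1
  ratio : Tendsto (fun n => (γ n / γ (n + 1) - 1) / γ (n + 1)) atTop (𝓝 τ)

lemma gammaSeq_of {a : ℝ} (ha : 1 / 2 < a) (ha1 : a ≤ 1) {γ : ℕ → ℝ}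
    (hγ : ∀ n, γ n = ((n : ℝ) + 1) ^ (-a)) : GammaSeq γ (if a = 1 then (1 : ℝ) else 0) := by
  have hpos : ∀ n, 0 < γ n := fun n => by rw [hγ]; positivity
  have hanti : ∀ n, γ (n + 1) ≤ γ n := fun n => by
    rw [hγ, hγ]
    exact Real.rpow_le_rpow_of_nonpos (by positivity) (by push_cast; linarith) (by linarith)
  have hinv : ∀ n, (γ n)⁻¹ = ((n : ℝ) + 1) ^ a := fun n => by
    rw [hγ, Real.rpow_neg (by positivity), inv_inv]
  have hlim0 : Tendsto γ atTop (𝓝 0) := by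
    have h := (tendsto_rpow_neg_atTop (by linarith : 0 < a)).comp
      (tendsto_atTop_add_const_right _ (1 : ℝ) (tendsto_natCast_atTop_atTop (R := ℝ)))
    exact h.congr fun n => by rw [hγ]; rfl
  have hinvdiff : ∀ n, (γ (n + 1))⁻¹ - (γ n)⁻¹ ≤ 1 := fun n => by
    rw [hinv, hinv]; push_cast
    have := Real.rpow_add_le_add_rpow (p := a) (by positivity : (0 : ℝ) ≤ n + 1) zero_le_one
      (by linarith) ha1
    rw [Real.one_rpow] at this; linarith
  have key : ∀ n, γ n - γ (n + 1) = (γ n * γ (n + 1)) * ((γ (n + 1))⁻¹ - (γ n)⁻¹) := fun n => by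
    have := (hpos n).ne'; have := (hpos (n + 1)).ne'
    field_simp
  have hdiff : ∀ n, γ n - γ (n + 1) ≤ γ n * γ (n + 1) := fun n => by
    rw [key]
    exact mul_le_of_le_one_right (mul_pos (hpos _) (hpos _)).le (hinvdiff n)
  have hnn : ∀ n, 0 ≤ (γ (n + 1))⁻¹ - (γ n)⁻¹ := fun n => by
    have := inv_anti₀ (hpos (n + 1)) (hanti n); linarith
  have hrat1 : Tendsto (fun n => γ n / γ (n + 1)) atTop (𝓝 1) := by
    have h1 : ∀ n, γ n / γ (n + 1) ≤ 1 + γ n := fun n => by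
      rw [div_le_iff₀ (hpos _)]; linarith [hdiff n]
    have h2 : ∀ n, 1 ≤ γ n / γ (n + 1) := fun n => by
      rw [le_div_iff₀ (hpos _)]; linarith [hanti n]
    refine tendsto_of_tendsto_of_tendsto_of_le_of_le tendsto_const_nhds ?_ h2 h1
    simpa using hlim0.const_add 1
  refine ⟨hpos, ?_, hanti, ⟨fun n => hpos _, hlim0.comp (tendsto_add_atTop_nat 1), ?_⟩, hdiff,
    ?_, by split_ifs <;> norm_num, ?_⟩
  · intro n; rw [hγ]
    exact Real.rpow_le_one_of_one_le_of_nonpos (by linarith [(Nat.cast_nonneg n : (0:ℝ) ≤ n)])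
      (by linarith)
  · have hns : ¬ Summable (fun n => γ (n + 1)) := by
      intro h
      have h2 : Summable (fun n : ℕ => ((n + 2 : ℕ) : ℝ) ^ (-a)) := by
        refine h.congr fun n => ?_
        rw [hγ]; push_cast; ring_nf
      have h3 := (summable_nat_add_iff (f := fun n : ℕ => (n : ℝ) ^ (-a)) 2).1 h2
      have := Real.summable_nat_rpow.1 h3
      linarith
    exact (not_summable_iff_tendsto_nat_atTop_of_nonneg fun n => (hpos _).le).1 hns
  · have h2 : Summable (fun n : ℕ => (n : ℝ) ^ (-(2 * a))) :=
      Real.summable_nat_rpow.2 (by linarith)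
    have h3 := (summable_nat_add_iff (f := fun n : ℕ => (n : ℝ) ^ (-(2 * a))) 1).2 h2
    refine h3.congr fun n => ?_
    rw [hγ, ← Real.rpow_natCast, ← Real.rpow_mul (by positivity)]
    push_cast; ring_nf
  · have h1 : (fun n => (γ n / γ (n + 1) - 1) / γ (n + 1)) =
        fun n => (γ n / γ (n + 1)) * ((γ (n + 1))⁻¹ - (γ n)⁻¹) := by
      funext n
      have := (hpos n).ne'; have := (hpos (n + 1)).ne'
      field_simp
    rw [h1]
    have h2 : Tendsto (fun n => (γ (n + 1))⁻¹ - (γ n)⁻¹) atTop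
        (𝓝 (if a = 1 then (1 : ℝ) else 0)) := by
      split_ifs with h
      · refine tendsto_const_nhds.congr fun n => ?_
        rw [hinv, hinv, h]; push_cast; rw [Real.rpow_one, Real.rpow_one]; ring
      · have ha2 : a < 1 := lt_of_le_of_ne ha1 h
        have h3 : Tendsto (fun n : ℕ => ((n : ℝ) + 1) ^ (-(1 - a))) atTop (𝓝 0) :=
          (tendsto_rpow_neg_atTop (by linarith : 0 < 1 - a)).comp
            (tendsto_atTop_add_const_right _ (1 : ℝ) (tendsto_natCast_atTop_atTop (R := ℝ)))
        refine squeeze_zero hnn (fun n => ?_) h3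
        rw [hinv, hinv]; push_cast
        have hp : (0 : ℝ) < n + 1 := by positivity
        have h4 : ((n : ℝ) + 1 + 1) ^ a ≤ ((n : ℝ) + 1) ^ a * (1 + 1 / ((n : ℝ) + 1)) := by
          have : (n : ℝ) + 1 + 1 = ((n : ℝ) + 1) * (1 + 1 / ((n : ℝ) + 1)) := by field_simp
          rw [this, Real.mul_rpow hp.le (by positivity)]
          refine mul_le_mul_of_nonneg_left ?_ (by positivity)
          have h5 : (1 : ℝ) ≤ 1 + 1 / ((n : ℝ) + 1) := by
            have : 0 < 1 / ((n : ℝ) + 1) := by positivity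
            linarith
          calc _ ≤ (1 + 1 / ((n : ℝ) + 1)) ^ (1 : ℝ) :=
                Real.rpow_le_rpow_of_exponent_le h5 ha1
            _ = _ := Real.rpow_one _
        have h6 : ((n : ℝ) + 1) ^ (-(1 - a)) = ((n : ℝ) + 1) ^ a * (1 / ((n : ℝ) + 1)) := by
          rw [show -(1 - a) = a - 1 by ring, Real.rpow_sub_one hp.ne']; ring
        rw [h6]; linarith
    simpa using hrat1.mul h2

namespace GammaSeq
variable {γ : ℕ → ℝ} {τ : ℝ}

lemma lim (h : GammaSeq γ τ) : Tendsto γ atTop (𝓝 0) := (tendsto_add_atTop_iff_nat 1).1 h.step.lim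

lemma ratio_eq (h : GammaSeq γ τ) (n : ℕ) :
    γ n / γ (n + 1) = 1 + (γ n / γ (n + 1) - 1) / γ (n + 1) * γ (n + 1) := by
  have := (h.pos (n + 1)).ne'; field_simp; ring

lemma diff_abs (h : GammaSeq γ τ) (n : ℕ) : |γ n - γ (n + 1)| ≤ γ n ^ 2 := by
  rw [abs_of_nonneg (by linarith [h.anti n])]
  have := mul_le_mul_of_nonneg_left (h.anti n) (h.pos n).le
  linarith [h.diff_le n]

/-- telescoping lemma -/
lemma telescope (h : GammaSeq γ τ) {u : ℕ → ℝ} {B : ℝ} (hu : ∀ n, |u n| ≤ B) :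
    ∃ T, Tendsto (fun n => ∑ k ∈ range n, γ (k + 1) * (u k - u (k + 1))) atTop (𝓝 T) := by
  have hs : Summable (fun k => (γ k - γ (k + 1)) * u k) := by
    refine Summable.of_norm_bounded (g := fun k => γ k ^ 2 * B) (h.sq.mul_right B) fun k => ?_
    rw [Real.norm_eq_abs, abs_mul]
    exact mul_le_mul (h.diff_abs k) (hu k) (abs_nonneg _) (sq_nonneg _)
  have h0 : Tendsto (fun n => γ n * u n) atTop (𝓝 0) := by
    have hB : 0 ≤ B := (abs_nonneg _).trans (hu 0)
    refine squeeze_zero_norm (a := fun n => γ n * B) (fun n => ?_) (by simpa using h.lim.mul_const B)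
    rw [Real.norm_eq_abs, abs_mul, abs_of_pos (h.pos n)]
    exact mul_le_mul_of_nonneg_left (hu n) (h.pos n).le
  have heq : (fun n => ∑ k ∈ range n, γ (k + 1) * (u k - u (k + 1))) =
      fun n => (γ 0 * u 0 - γ n * u n) - ∑ k ∈ range n, (γ k - γ (k + 1)) * u k := by
    funext n
    induction n with
    | zero => simp
    | succ n ih => rw [Finset.sum_range_succ, Finset.sum_range_succ, ih]; ring
  rw [heq]
  exact ⟨_, (tendsto_const_nhds.sub h0).sub hs.hasSum.tendsto_sum_nat⟩

end GammaSeq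

/-! ### A central limit theorem for bounded martingale difference arrays -/

lemma integrable_of_bdd {Ω E : Type*} [NormedAddCommGroup E] {mΩ : MeasurableSpace Ω}
    {Pr : Measure Ω} [IsProbabilityMeasure Pr] {f : Ω → E} (hf : AEStronglyMeasurable f Pr) {C : ℝ}
    (hC : ∀ ω, ‖f ω‖ ≤ C) : Integrable f Pr :=
  Integrable.of_bound hf C (ae_of_all _ hC)

lemma norm_exp_I_taylor (ξ : ℝ) :
    ‖Complex.exp (Complex.I * ξ) - 1 - Complex.I * ξ + (ξ : ℂ) ^ 2 / 2‖ ≤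
      |ξ| ^ 3 * Real.exp |ξ| := by
  have h := Complex.norm_exp_sub_sum_le_norm_mul_exp (Complex.I * ξ) 3
  have h2 : ‖Complex.I * (ξ : ℂ)‖ = |ξ| := by simp
  rw [h2] at h
  convert h using 2
  simp [Finset.sum_range_succ, mul_pow, Nat.factorial]
  ring

lemma norm_exp_neg_taylor (v : ℝ) (hv : 0 ≤ v) :
    ‖Complex.exp (((-v / 2 : ℝ)) : ℂ) - 1 + (v : ℂ) / 2‖ ≤ v ^ 2 * Real.exp v := by
  have h := Complex.norm_exp_sub_sum_le_norm_mul_exp ((-v / 2 : ℝ) : ℂ) 2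
  have h2 : ‖((-v / 2 : ℝ) : ℂ)‖ = v / 2 := by
    rw [Complex.norm_real, Real.norm_eq_abs, neg_div, abs_neg, abs_of_nonneg (by positivity)]
  rw [h2] at h
  have h3 : (v / 2) ^ 2 * Real.exp (v / 2) ≤ v ^ 2 * Real.exp v := by
    have : Real.exp (v / 2) ≤ Real.exp v := Real.exp_le_exp.2 (by linarith)
    have h4 : (v / 2) ^ 2 ≤ v ^ 2 := by nlinarith
    exact mul_le_mul h4 this (Real.exp_pos _).le (sq_nonneg _)
  refine le_trans (le_of_eq ?_) (h.trans h3)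
  congr 1
  simp [Finset.sum_range_succ]
  ring

lemma mds_char_bound {Ω : Type*} {mΩ : MeasurableSpace Ω} (Pr : Measure Ω)
    [IsProbabilityMeasure Pr] (F : Filtration ℕ mΩ) (ξ v : ℕ → Ω → ℝ) (p : ℕ → ℝ) {D : ℝ}
    (n : ℕ)
    (hξm : ∀ k, Measurable[F (k + 1)] (ξ k)) (hvm : ∀ k, Measurable[F k] (v k))
    (hξ : ∀ k ω, |ξ k ω| ≤ p k) (hv0 : ∀ k ω, 0 ≤ v k ω) (hv : ∀ k ω, v k ω ≤ p k ^ 2)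
    (hmean : ∀ k (Y : Ω → ℂ) (C : ℝ), Measurable[F k] Y → (∀ ω, ‖Y ω‖ ≤ C) →
      ∫ ω, Y ω * (ξ k ω : ℂ) ∂Pr = 0)
    (hvar : ∀ k (Y : Ω → ℂ) (C : ℝ), Measurable[F k] Y → (∀ ω, ‖Y ω‖ ≤ C) →
      ∫ ω, Y ω * ((ξ k ω : ℂ) ^ 2 - (v k ω : ℂ)) ∂Pr = 0)
    (hD : ∑ k ∈ range n, p k ^ 2 ≤ D) :
    ‖(∫ ω, Complex.exp (Complex.I * ((∑ k ∈ range n, ξ k ω : ℝ) : ℂ) +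
        ((∑ k ∈ range n, v k ω) / 2 : ℝ)) ∂Pr) - 1‖ ≤
      (Real.exp D * (Real.exp (D + 1) * (D + 2))) * ∑ k ∈ range n, p k ^ 3 := by
  have hp0 : ∀ k, 0 ≤ p k := fun k => by
    obtain ⟨ω⟩ : Nonempty Ω := nonempty_of_isProbabilityMeasure Pr
    exact (abs_nonneg _).trans (hξ k ω)
  have hD0 : 0 ≤ D := (Finset.sum_nonneg fun k _ => sq_nonneg (p k)).trans hD
  have hξm' : ∀ k, Measurable (ξ k) := fun k => (hξm k).mono (F.le _) le_rfl
  have hvm' : ∀ k, Measurable (v k) := fun k => (hvm k).mono (F.le _) le_rfl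
  set Y : ℕ → Ω → ℂ := fun k ω => Complex.exp (Complex.I * ((∑ k ∈ range k, ξ k ω : ℝ) : ℂ) +
        ((∑ k ∈ range k, v k ω) / 2 : ℝ)) with hY
  set Y' : ℕ → Ω → ℂ := fun k ω => Complex.exp (Complex.I * ((∑ k ∈ range k, ξ k ω : ℝ) : ℂ) +
        ((∑ k ∈ range (k + 1), v k ω) / 2 : ℝ)) with hY'
  have hYm : ∀ k, Measurable (Y k) := fun k => by
    refine Complex.measurable_exp.comp (Measurable.add (Measurable.const_mul ?_ _) ?_)
    · exact Complex.measurable_ofReal.comp (Finset.measurable_sum _ fun i _ => hξm' i)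
    · exact Complex.measurable_ofReal.comp ((Finset.measurable_sum _ fun i _ => hvm' i).div_const _)
  have hY'm : ∀ k, Measurable[F k] (Y' k) := fun k => by
    refine Complex.measurable_exp.comp (Measurable.add (Measurable.const_mul ?_ _) ?_)
    · refine Complex.measurable_ofReal.comp (Finset.measurable_sum _ fun i hi => ?_)
      exact (hξm i).mono (F.mono (by simpa using hi)) le_rfl
    · refine Complex.measurable_ofReal.comp (Measurable.div_const ?_ _)
      refine Finset.measurable_sum _ fun i hi => ?_
      exact (hvm i).mono (F.mono (by have := mem_range.1 hi; omega)) le_rfl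
  have hVle : ∀ k, k ≤ n → ∀ ω, ∑ i ∈ range k, v i ω ≤ D := fun k hk ω => by
    calc _ ≤ ∑ i ∈ range k, p i ^ 2 := Finset.sum_le_sum fun i _ => hv i ω
      _ ≤ ∑ i ∈ range n, p i ^ 2 :=
        Finset.sum_le_sum_of_subset_of_nonneg (range_mono hk) fun i _ _ => sq_nonneg _
      _ ≤ D := hD
  have hnorm : ∀ (s w : ℝ), w ≤ D → ‖Complex.exp (Complex.I * (s : ℂ) + ((w / 2 : ℝ) : ℂ))‖ ≤
      Real.exp D := fun s w hw => by
    rw [Complex.norm_exp]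
    refine Real.exp_le_exp.2 ?_
    simp
    linarith
  have hYb : ∀ k, k ≤ n → ∀ ω, ‖Y k ω‖ ≤ Real.exp D := fun k hk ω =>
    hnorm _ _ (hVle k hk ω)
  have hY'b : ∀ k, k < n → ∀ ω, ‖Y' k ω‖ ≤ Real.exp D := fun k hk ω =>
    hnorm _ _ (hVle (k + 1) hk ω)
  have hYint : ∀ k, k ≤ n → Integrable (Y k) Pr := fun k hk =>
    integrable_of_bdd (hYm k).aestronglyMeasurable (hYb k hk)
  have hstep : ∀ k, k < n → ‖(∫ ω, Y (k + 1) ω ∂Pr) - ∫ ω, Y k ω ∂Pr‖ ≤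
      (Real.exp D * (Real.exp (D + 1) * (D + 2))) * p k ^ 3 := by
    intro k hk
    have hpk2 : p k ^ 2 ≤ D := le_trans
      (Finset.single_le_sum (f := fun i => p i ^ 2) (fun _ _ => sq_nonneg _) (mem_range.2 hk)) hD
    have hpk : p k ≤ D + 1 := by nlinarith [hp0 k]
    have e1 : ∀ ω, Y (k + 1) ω = Y' k ω * Complex.exp (Complex.I * (ξ k ω : ℂ)) := fun ω => by
      simp only [hY, hY']
      rw [← Complex.exp_add, Finset.sum_range_succ (fun i => ξ i ω)]
      congr 1; push_cast; ring
    have e2 : ∀ ω, Y k ω = Y' k ω * Complex.exp (((-v k ω / 2 : ℝ)) : ℂ) := fun ω => by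
      simp only [hY, hY']
      rw [← Complex.exp_add, Finset.sum_range_succ (fun i => v i ω)]
      congr 1; push_cast; ring
    set A : Ω → ℂ := fun ω => Y' k ω * (Complex.exp (Complex.I * (ξ k ω : ℂ)) - 1
        - Complex.I * (ξ k ω : ℂ) + (ξ k ω : ℂ) ^ 2 / 2)
        - Y' k ω * (Complex.exp (((-v k ω / 2 : ℝ)) : ℂ) - 1 + (v k ω : ℂ) / 2) with hA
    set B1 : Ω → ℂ := fun ω => (Complex.I * Y' k ω) * (ξ k ω : ℂ) with hB1
    set B2 : Ω → ℂ := fun ω => (Y' k ω / 2) * ((ξ k ω : ℂ) ^ 2 - (v k ω : ℂ)) with hB2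
    have hABY : ∀ ω, Y (k + 1) ω - Y k ω - B1 ω + B2 ω = A ω := fun ω => by
      rw [e1, e2]; simp only [hA, hB1, hB2]; ring
    have hξc : Measurable fun ω => (ξ k ω : ℂ) := Complex.measurable_ofReal.comp (hξm' k)
    have hvc : Measurable fun ω => (v k ω : ℂ) := Complex.measurable_ofReal.comp (hvm' k)
    have hY'k : Measurable (Y' k) := (hY'm k).mono (F.le _) le_rfl
    have hξn : ∀ ω, ‖(ξ k ω : ℂ)‖ ≤ p k := fun ω => by
      rw [Complex.norm_real]; exact hξ k ω
    have hvn : ∀ ω, ‖(v k ω : ℂ)‖ ≤ p k ^ 2 := fun ω => by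
      rw [Complex.norm_real, Real.norm_eq_abs, abs_of_nonneg (hv0 k ω)]; exact hv k ω
    have iB1 : Integrable B1 Pr := by
      refine integrable_of_bdd (C := Real.exp D * p k)
        ((hY'k.const_mul _).mul hξc).aestronglyMeasurable fun ω => ?_
      rw [norm_mul, norm_mul, Complex.norm_I, one_mul]
      exact mul_le_mul (hY'b k hk ω) (hξn ω) (norm_nonneg _) (Real.exp_pos _).le
    have iB2 : Integrable B2 Pr := by
      refine integrable_of_bdd (C := Real.exp D * (p k ^ 2 + p k ^ 2))
        ((hY'k.div_const _).mul ((hξc.pow_const 2).sub hvc)).aestronglyMeasurable fun ω => ?_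
      rw [norm_mul]
      refine mul_le_mul ?_ ?_ (norm_nonneg _) (Real.exp_pos _).le
      · rw [norm_div]; have := hY'b k hk ω
        simp only [Complex.norm_ofNat]; linarith [norm_nonneg (Y' k ω)]
      · refine (norm_sub_le _ _).trans (add_le_add ?_ (hvn ω))
        rw [norm_pow]; exact pow_le_pow_left₀ (norm_nonneg _) (hξn ω) 2
    have z1 : ∫ ω, B1 ω ∂Pr = 0 := hmean k _ (Real.exp D) ((hY'm k).const_mul _) fun ω => by
      rw [norm_mul, Complex.norm_I, one_mul]; exact hY'b k hk ω
    have z2 : ∫ ω, B2 ω ∂Pr = 0 := hvar k _ (Real.exp D) ((hY'm k).div_const _) fun ω => by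
      rw [norm_div]; have := hY'b k hk ω
      simp only [Complex.norm_ofNat]; linarith [norm_nonneg (Y' k ω)]
    have hIntEq : (∫ ω, Y (k + 1) ω ∂Pr) - ∫ ω, Y k ω ∂Pr = ∫ ω, A ω ∂Pr := by
      have i1 := (hYint (k + 1) hk).sub (hYint k hk.le)
      have i2 := i1.sub iB1
      rw [← integral_congr_ae (ae_of_all _ hABY)]
      rw [integral_add (by exact i2) iB2, integral_sub (by exact i1) iB1,
        integral_sub (hYint (k + 1) hk) (hYint k hk.le), z1, z2]
      ring
    rw [hIntEq]
    have hbd : ∀ ω, ‖A ω‖ ≤ (Real.exp D * (Real.exp (D + 1) * (D + 2))) * p k ^ 3 := fun ω => by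
      have t1 := norm_exp_I_taylor (ξ k ω)
      have t2 := norm_exp_neg_taylor (v k ω) (hv0 k ω)
      have b1 : |ξ k ω| ^ 3 * Real.exp |ξ k ω| ≤ p k ^ 3 * Real.exp (D + 1) :=
        mul_le_mul (pow_le_pow_left₀ (abs_nonneg _) (hξ k ω) 3)
          (Real.exp_le_exp.2 ((hξ k ω).trans hpk)) (Real.exp_pos _).le (pow_nonneg (hp0 k) 3)
      have b2 : v k ω ^ 2 * Real.exp (v k ω) ≤ p k ^ 3 * (D + 1) * Real.exp (D + 1) := by
        refine mul_le_mul ?_ (Real.exp_le_exp.2 (by linarith [hv k ω])) (Real.exp_pos _).le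
          (mul_nonneg (pow_nonneg (hp0 k) 3) (by linarith))
        calc v k ω ^ 2 ≤ (p k ^ 2) ^ 2 := pow_le_pow_left₀ (hv0 k ω) (hv k ω) 2
          _ = p k ^ 3 * p k := by ring
          _ ≤ p k ^ 3 * (D + 1) := mul_le_mul_of_nonneg_left hpk (pow_nonneg (hp0 k) 3)
      calc ‖A ω‖ ≤ _ := norm_sub_le _ _
        _ ≤ Real.exp D * (p k ^ 3 * Real.exp (D + 1)) +
            Real.exp D * (p k ^ 3 * (D + 1) * Real.exp (D + 1)) := by
          rw [norm_mul, norm_mul]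
          exact add_le_add (mul_le_mul (hY'b k hk ω) (t1.trans b1) (norm_nonneg _)
            (Real.exp_pos _).le) (mul_le_mul (hY'b k hk ω) (t2.trans b2) (norm_nonneg _)
            (Real.exp_pos _).le)
        _ = _ := by ring
    simpa using norm_integral_le_of_norm_le_const (μ := Pr) (ae_of_all _ hbd)
  have hall : ∀ k, k ≤ n → ‖(∫ ω, Y k ω ∂Pr) - 1‖ ≤
      (Real.exp D * (Real.exp (D + 1) * (D + 2))) * ∑ i ∈ range k, p i ^ 3 := by
    intro k
    induction k with
    | zero => intro _; simp [hY]
    | succ k ih =>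
      intro hk
      rw [Finset.sum_range_succ, mul_add]
      have h1 := ih (by omega)
      have h2 := hstep k (by omega)
      calc _ = ‖((∫ ω, Y k ω ∂Pr) - 1) + ((∫ ω, Y (k + 1) ω ∂Pr) - ∫ ω, Y k ω ∂Pr)‖ := by
            congr 1; ring
        _ ≤ _ := (norm_add_le _ _).trans (add_le_add h1 h2)
  exact hall n le_rfl

theorem mds_clt {Ω : Type*} {mΩ : MeasurableSpace Ω} (Pr : Measure Ω)
    [IsProbabilityMeasure Pr] (F : Filtration ℕ mΩ) (ξ v : ℕ → ℕ → Ω → ℝ) (p : ℕ → ℕ → ℝ)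
    {D V : ℝ}
    (hξm : ∀ n k, Measurable[F (k + 1)] (ξ n k)) (hvm : ∀ n k, Measurable[F k] (v n k))
    (hξ : ∀ n k ω, |ξ n k ω| ≤ p n k) (hv0 : ∀ n k ω, 0 ≤ v n k ω)
    (hv : ∀ n k ω, v n k ω ≤ p n k ^ 2)
    (hmean : ∀ n k (Y : Ω → ℂ) (C : ℝ), Measurable[F k] Y → (∀ ω, ‖Y ω‖ ≤ C) →
      ∫ ω, Y ω * (ξ n k ω : ℂ) ∂Pr = 0)
    (hvar : ∀ n k (Y : Ω → ℂ) (C : ℝ), Measurable[F k] Y → (∀ ω, ‖Y ω‖ ≤ C) →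
      ∫ ω, Y ω * ((ξ n k ω : ℂ) ^ 2 - (v n k ω : ℂ)) ∂Pr = 0)
    (hD : ∀ n, ∑ k ∈ range n, p n k ^ 2 ≤ D)
    (hp3 : Tendsto (fun n => ∑ k ∈ range n, p n k ^ 3) atTop (𝓝 0))
    (hV : ∀ᵐ ω ∂Pr, Tendsto (fun n => ∑ k ∈ range n, v n k ω) atTop (𝓝 V)) :
    Tendsto (fun n => ∫ ω, Complex.exp (Complex.I * ((∑ k ∈ range n, ξ n k ω : ℝ) : ℂ)) ∂Pr)
      atTop (𝓝 (Complex.exp ((-V / 2 : ℝ) : ℂ))) := by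
  have hξm' : ∀ n k, Measurable (ξ n k) := fun n k => (hξm n k).mono (F.le _) le_rfl
  have hvm' : ∀ n k, Measurable (v n k) := fun n k => (hvm n k).mono (F.le _) le_rfl
  set S : ℕ → Ω → ℝ := fun n ω => ∑ k ∈ range n, ξ n k ω with hS
  set W : ℕ → Ω → ℝ := fun n ω => ∑ k ∈ range n, v n k ω with hW
  have hSm : ∀ n, Measurable (S n) := fun n => Finset.measurable_sum _ fun i _ => hξm' n i
  have hWm : ∀ n, Measurable (W n) := fun n => Finset.measurable_sum _ fun i _ => hvm' n i
  have hWD : ∀ n ω, W n ω ≤ D := fun n ω =>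
    (Finset.sum_le_sum fun i _ => hv n i ω).trans (hD n)
  have h1 : Tendsto (fun n => (∫ ω, Complex.exp (Complex.I * (S n ω : ℂ) +
        (W n ω / 2 : ℝ)) ∂Pr) - 1) atTop (𝓝 0) := by
    refine squeeze_zero_norm (fun n => mds_char_bound Pr F (ξ n) (v n) (p n) n (hξm n) (hvm n)
      (hξ n) (hv0 n) (hv n) (hmean n) (hvar n) (hD n)) ?_
    simpa using hp3.const_mul (Real.exp D * (Real.exp (D + 1) * (D + 2)))
  have hbn : ∀ n ω, ‖Complex.exp (Complex.I * (S n ω : ℂ) + (W n ω / 2 : ℝ))‖ ≤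
      Real.exp (D / 2) := fun n ω => by
    rw [Complex.norm_exp]
    refine Real.exp_le_exp.2 ?_
    simp
    linarith [hWD n ω]
  have m1 : ∀ n, Measurable fun ω => Complex.exp (Complex.I * (S n ω : ℂ) + (W n ω / 2 : ℝ)) :=
    fun n => Complex.measurable_exp.comp (Measurable.add (Measurable.const_mul
      (Complex.measurable_ofReal.comp (hSm n)) _)
      (Complex.measurable_ofReal.comp ((hWm n).div_const _)))
  have m2 : ∀ n, Measurable fun ω => Complex.exp (Complex.I * (S n ω : ℂ)) :=
    fun n => Complex.measurable_exp.comp (Measurable.const_mul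
      (Complex.measurable_ofReal.comp (hSm n)) _)
  set c : ℂ := Complex.exp ((-V / 2 : ℝ) : ℂ) with hc
  -- the difference
  have h2 : Tendsto (fun n => ∫ ω, (Complex.exp (Complex.I * (S n ω : ℂ)) -
      Complex.exp (Complex.I * (S n ω : ℂ) + (W n ω / 2 : ℝ)) * c) ∂Pr) atTop
      (𝓝 (∫ _ω, (0 : ℂ) ∂Pr)) := by
    refine tendsto_integral_of_dominated_convergence (fun _ => 1 + Real.exp (D / 2) * ‖c‖)
      (fun n => ((m2 n).sub ((m1 n).mul_const _)).aestronglyMeasurable) (integrable_const _)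
      (fun n => ae_of_all _ fun ω => ?_) ?_
    · refine (norm_sub_le _ _).trans (add_le_add ?_ ?_)
      · rw [mul_comm, Complex.norm_exp_ofReal_mul_I]
      · rw [norm_mul]; exact mul_le_mul_of_nonneg_right (hbn n ω) (norm_nonneg _)
    · filter_upwards [hV] with ω hω
      have h3 : Tendsto (fun n => (1 : ℂ) - Complex.exp (((W n ω / 2 + -V / 2 : ℝ)) : ℂ)) atTop
          (𝓝 0) := by
        have : Tendsto (fun n => (((W n ω / 2 + -V / 2 : ℝ)) : ℂ)) atTop (𝓝 ((0 : ℝ) : ℂ)) := by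
          refine (Complex.continuous_ofReal.tendsto _).comp ?_
          have := (hω.div_const 2).add_const (-V / 2)
          convert this using 2
          ring
        have h4 := ((Complex.continuous_exp.tendsto _).comp this).const_sub 1
        simpa using h4
      refine squeeze_zero_norm (fun n => ?_) (tendsto_zero_iff_norm_tendsto_zero.1 h3)
      have : Complex.exp (Complex.I * (S n ω : ℂ)) -
          Complex.exp (Complex.I * (S n ω : ℂ) + (W n ω / 2 : ℝ)) * c =
          Complex.exp (Complex.I * (S n ω : ℂ)) *
            (1 - Complex.exp (((W n ω / 2 + -V / 2 : ℝ)) : ℂ)) := by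
        rw [hc, mul_sub, mul_one, ← Complex.exp_add, ← Complex.exp_add]
        congr 2; push_cast; ring
      rw [this, norm_mul, mul_comm Complex.I, Complex.norm_exp_ofReal_mul_I, one_mul]
  rw [integral_zero] at h2
  have h5 := (h2.add (h1.mul_const c)).add_const c
  simp only [zero_mul, add_zero, zero_add] at h5
  refine h5.congr fun n => ?_
  rw [integral_sub, integral_mul_const]
  · ring
  · refine integrable_of_bdd (C := 1) (m2 n).aestronglyMeasurable fun ω => ?_
    rw [mul_comm, Complex.norm_exp_ofReal_mul_I]
  · exact (integrable_of_bdd (m1 n).aestronglyMeasurable (hbn n)).mul_const _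

/-! ### Algebra of the SRRW kernel -/

/-- Base chain hypotheses. -/
structure BaseChain {N : ℕ} (P : Matrix (Fin N) (Fin N) ℝ) (μ : Fin N → ℝ) : Prop where
  nonneg : ∀ i j, 0 ≤ P i j
  rowsum : ∀ i, ∑ j, P i j = 1
  irr : ∃ k : ℕ, ∀ i j, 0 < (P ^ k) i j
  mu_pos : ∀ i, 0 < μ i
  mu_sum : ∑ i, μ i = 1
  rev : ∀ i j, μ i * P i j = μ j * P j i

/-- positive orthant -/
def posO (N : ℕ) : Set (Fin N → ℝ) := {x | ∀ i, 0 < x i}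

lemma posO_open (N : ℕ) : IsOpen (posO N) := by
  have : posO N = ⋂ i, {x : Fin N → ℝ | 0 < x i} := by ext; simp [posO]
  rw [this]
  exact isOpen_iInter_of_finite fun i => isOpen_lt continuous_const (continuous_apply i)

section kernel
variable {N : ℕ} (P : Matrix (Fin N) (Fin N) ℝ) (μ : Fin N → ℝ) (α : ℝ)

/-- weights -/
def wt (x : Fin N → ℝ) (j : Fin N) : ℝ := (x j / μ j) ^ (-α)
/-- row normalisation -/
def rowD (x : Fin N → ℝ) (i : Fin N) : ℝ := ∑ k, P i k * wt μ α x k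
/-- unnormalised invariant measure -/
def unH (x : Fin N → ℝ) (i : Fin N) : ℝ := μ i * wt μ α x i * rowD P μ α x i
/-- normalisation -/
def zS (x : Fin N → ℝ) : ℝ := ∑ i, unH P μ α x i
/-- invariant measure of the SRRW kernel -/
def piS (x : Fin N → ℝ) (i : Fin N) : ℝ := unH P μ α x i / zS P μ α x
/-- the matrix `I - K + 1 πᵀ` -/
def poisA (x : Fin N → ℝ) : Matrix (Fin N) (Fin N) ℝ :=
  Matrix.of fun i j => (if i = j then 1 else 0) - srrwKernel P μ α x i j + piS P μ α x j
/-- Poisson solution -/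
def poisG (f : Fin N → ℝ) (x : Fin N → ℝ) (i : Fin N) : ℝ :=
  (poisA P μ α x).det⁻¹ * ((poisA P μ α x).updateCol i f).det
/-- `K[x]` applied to the Poisson solution -/
def poisU (f : Fin N → ℝ) (x : Fin N → ℝ) (i : Fin N) : ℝ :=
  ∑ j, srrwKernel P μ α x i j * poisG P μ α f x j

lemma kernel_apply (x : Fin N → ℝ) (i j : Fin N) :
    srrwKernel P μ α x i j = P i j * wt μ α x j / rowD P μ α x i := rfl

variable {P μ α}

lemma wt_pos (hB : BaseChain P μ) {x : Fin N → ℝ} (hx : x ∈ posO N) (j : Fin N) : 0 < wt μ α x j :=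
  Real.rpow_pos_of_pos (div_pos (hx j) (hB.mu_pos j)) _

lemma rowD_pos (hB : BaseChain P μ) {x : Fin N → ℝ} (hx : x ∈ posO N) (i : Fin N) : 0 < rowD P μ α x i := by
  have h0 : ∀ k ∈ univ, 0 ≤ P i k * wt μ α x k := fun k _ =>
    mul_nonneg (hB.nonneg i k) (wt_pos hB hx k).le
  refine lt_of_le_of_ne (Finset.sum_nonneg h0) fun h => ?_
  have h1 := (Finset.sum_eq_zero_iff_of_nonneg h0).1 h.symm
  have h2 : ∑ k, P i k = 0 := Finset.sum_eq_zero fun k hk => by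
    have := h1 k hk
    rcases mul_eq_zero.1 this with h | h
    · exact h
    · exact absurd h (wt_pos hB hx k).ne'
  rw [hB.rowsum] at h2; exact one_ne_zero h2

lemma unH_pos (hB : BaseChain P μ) {x : Fin N → ℝ} (hx : x ∈ posO N) (i : Fin N) : 0 < unH P μ α x i :=
  mul_pos (mul_pos (hB.mu_pos i) (wt_pos hB hx i)) (rowD_pos hB hx i)

lemma nonemptyFin (hB : BaseChain P μ) : Nonempty (Fin N) := by
  by_contra h
  rw [not_nonempty_iff] at h
  have := hB.mu_sum
  simp at this

lemma zS_pos (hB : BaseChain P μ) {x : Fin N → ℝ} (hx : x ∈ posO N) : 0 < zS P μ α x := by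
  have := nonemptyFin hB
  exact Finset.sum_pos (fun i _ => unH_pos hB hx i) univ_nonempty

lemma piS_pos (hB : BaseChain P μ) {x : Fin N → ℝ} (hx : x ∈ posO N) (i : Fin N) : 0 < piS P μ α x i :=
  div_pos (unH_pos hB hx i) (zS_pos hB hx)

lemma piS_sum (hB : BaseChain P μ) {x : Fin N → ℝ} (hx : x ∈ posO N) : ∑ i, piS P μ α x i = 1 := by
  unfold piS
  rw [← Finset.sum_div]
  exact div_self (zS_pos hB hx).ne'

lemma kernel_nonneg (hB : BaseChain P μ) {x : Fin N → ℝ} (hx : x ∈ posO N) (i j : Fin N) :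
    0 ≤ srrwKernel P μ α x i j :=
  div_nonneg (mul_nonneg (hB.nonneg i j) (wt_pos hB hx j).le) (rowD_pos hB hx i).le

lemma kernel_sum (hB : BaseChain P μ) {x : Fin N → ℝ} (hx : x ∈ posO N) (i : Fin N) :
    ∑ j, srrwKernel P μ α x i j = 1 := by
  simp only [kernel_apply]
  rw [← Finset.sum_div]
  exact div_self (rowD_pos hB hx i).ne'

lemma kernel_rev_eq (hB : BaseChain P μ) {x : Fin N → ℝ} (hx : x ∈ posO N) (i j : Fin N) :
    piS P μ α x i * srrwKernel P μ α x i j =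
      μ i * P i j * (wt μ α x i * wt μ α x j) / zS P μ α x := by
  have h1 := (rowD_pos hB (α := α) hx i).ne'
  have h2 := (zS_pos hB (α := α) hx).ne'
  rw [kernel_apply, piS, unH]
  field_simp

lemma kernel_rev (hB : BaseChain P μ) {x : Fin N → ℝ} (hx : x ∈ posO N) (i j : Fin N) :
    piS P μ α x i * srrwKernel P μ α x i j = piS P μ α x j * srrwKernel P μ α x j i := by
  rw [kernel_rev_eq hB hx, kernel_rev_eq hB hx, hB.rev i j, mul_comm (wt μ α x i)]

lemma piS_inv (hB : BaseChain P μ) {x : Fin N → ℝ} (hx : x ∈ posO N) (j : Fin N) :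
    ∑ i, piS P μ α x i * srrwKernel P μ α x i j = piS P μ α x j := by
  simp_rw [fun i => kernel_rev hB (α := α) hx i j]
  rw [← Finset.mul_sum, kernel_sum hB hx, mul_one]

lemma piS_inv_fun (hB : BaseChain P μ) {x : Fin N → ℝ} (hx : x ∈ posO N) (v : Fin N → ℝ) :
    ∑ i, piS P μ α x i * ∑ j, srrwKernel P μ α x i j * v j = ∑ j, piS P μ α x j * v j := by
  simp_rw [Finset.mul_sum]
  rw [Finset.sum_comm]
  refine Finset.sum_congr rfl fun j _ => ?_
  rw [← piS_inv hB hx j, Finset.sum_mul]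
  exact Finset.sum_congr rfl fun i _ => by ring

lemma harmonic_const (hB : BaseChain P μ) {x : Fin N → ℝ} (hx : x ∈ posO N) {v : Fin N → ℝ}
    (hv : ∀ i, ∑ j, srrwKernel P μ α x i j * v j = v i) (i j : Fin N) : v i = v j := by
  have hD : ∑ i, ∑ j, piS P μ α x i * srrwKernel P μ α x i j * (v i - v j) ^ 2 = 0 := by
    have e1 : ∀ i j, piS P μ α x i * srrwKernel P μ α x i j * (v i - v j) ^ 2 =
        (piS P μ α x i * v i ^ 2) * srrwKernel P μ α x i j
        - 2 * ((piS P μ α x i * v i) * (srrwKernel P μ α x i j * v j))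
        + piS P μ α x i * (srrwKernel P μ α x i j * v j ^ 2) := fun i j => by ring
    simp_rw [e1, Finset.sum_add_distrib, Finset.sum_sub_distrib, ← Finset.mul_sum,
      kernel_sum hB hx, hv, piS_inv_fun hB hx]
    rw [Finset.mul_sum, ← Finset.sum_sub_distrib, ← Finset.sum_add_distrib]
    exact Finset.sum_eq_zero fun i _ => by ring
  have hnn : ∀ i j, 0 ≤ piS P μ α x i * srrwKernel P μ α x i j * (v i - v j) ^ 2 := fun i j =>
    mul_nonneg (mul_nonneg (piS_pos hB hx i).le (kernel_nonneg hB hx i j)) (sq_nonneg _)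
  have h1 : ∀ i j, P i j * (v j - v i) = 0 := fun i j => by
    have h2 := (Finset.sum_eq_zero_iff_of_nonneg
      (fun i _ => Finset.sum_nonneg fun j _ => hnn i j)).1 hD i (mem_univ _)
    have h3 := (Finset.sum_eq_zero_iff_of_nonneg (fun j _ => hnn i j)).1 h2 j (mem_univ _)
    rcases mul_eq_zero.1 h3 with h | h
    · rcases mul_eq_zero.1 h with h | h
      · exact absurd h (piS_pos hB hx i).ne'
      · rw [kernel_apply, div_eq_zero_iff] at h
        rcases h with h | h
        · rcases mul_eq_zero.1 h with h | h
          · rw [h, zero_mul]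
          · exact absurd h (wt_pos hB hx j).ne'
        · exact absurd h (rowD_pos hB hx i).ne'
    · have : v i - v j = 0 := by simpa using h
      rw [show v j - v i = 0 by linarith, mul_zero]
  have h4 : ∀ k i j, (P ^ k) i j * (v j - v i) = 0 := by
    intro k
    induction k with
    | zero =>
      intro i j
      by_cases h : i = j
      · simp [h]
      · simp [h]
    | succ k ih =>
      intro i j
      rw [pow_succ, Matrix.mul_apply, Finset.sum_mul]
      refine Finset.sum_eq_zero fun l _ => ?_
      have a1 := ih i l
      have a2 := h1 l j
      calc _ = (P ^ k) i l * (P l j * (v j - v l)) + P l j * ((P ^ k) i l * (v l - v i)) := by ring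
        _ = 0 := by rw [a1, a2]; ring
  obtain ⟨k, hk⟩ := hB.irr
  rcases mul_eq_zero.1 (h4 k i j) with h | h
  · exact absurd h (hk i j).ne'
  · linarith

lemma poisA_mulVec (_hB : BaseChain P μ) (x v : Fin N → ℝ) (i : Fin N) :
    (poisA P μ α x *ᵥ v) i = v i - ∑ j, srrwKernel P μ α x i j * v j + ∑ j, piS P μ α x j * v j := by
  simp only [Matrix.mulVec, dotProduct, poisA, Matrix.of_apply, sub_mul, add_mul,
    Finset.sum_add_distrib, Finset.sum_sub_distrib]
  simp

lemma poisA_pi (hB : BaseChain P μ) {x : Fin N → ℝ} (hx : x ∈ posO N) (v : Fin N → ℝ) :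
    ∑ i, piS P μ α x i * (poisA P μ α x *ᵥ v) i = ∑ j, piS P μ α x j * v j := by
  simp_rw [poisA_mulVec hB, mul_add, mul_sub, Finset.sum_add_distrib, Finset.sum_sub_distrib,
    piS_inv_fun hB hx, ← Finset.sum_mul, piS_sum hB hx]
  ring

lemma poisA_det (hB : BaseChain P μ) {x : Fin N → ℝ} (hx : x ∈ posO N) : (poisA P μ α x).det ≠ 0 := by
  intro h
  obtain ⟨v, hv0, hv⟩ := Matrix.exists_mulVec_eq_zero_iff.2 h
  have h1 : ∑ j, piS P μ α x j * v j = 0 := by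
    rw [← poisA_pi hB hx, hv]; simp
  have h2 : ∀ i, ∑ j, srrwKernel P μ α x i j * v j = v i := fun i => by
    have := congrFun hv i
    rw [poisA_mulVec hB, h1, Pi.zero_apply] at this
    linarith
  apply hv0
  funext i
  have h3 : ∑ j, piS P μ α x j * v j = v i := by
    simp_rw [fun j => harmonic_const hB hx h2 j i, ← Finset.sum_mul, piS_sum hB hx, one_mul]
  rw [← h3, h1]; rfl

lemma poisson_A (hB : BaseChain P μ) {x : Fin N → ℝ} (hx : x ∈ posO N) (f : Fin N → ℝ) :
    poisA P μ α x *ᵥ poisG P μ α f x = f := by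
  have : poisG P μ α f x = (poisA P μ α x).det⁻¹ • Matrix.cramer (poisA P μ α x) f := by
    funext i
    simp [poisG, Matrix.cramer_apply]
  rw [this, Matrix.mulVec_smul, Matrix.mulVec_cramer, smul_smul, inv_mul_cancel₀ (poisA_det hB hx),
    one_smul]

lemma poisson_eq (hB : BaseChain P μ) {x : Fin N → ℝ} (hx : x ∈ posO N) (f : Fin N → ℝ) (i : Fin N) :
    poisG P μ α f x i - poisU P μ α f x i = f i - ∑ j, piS P μ α x j * f j := by
  have h := poisson_A hB (α := α) hx f
  have h1 := congrFun h i
  rw [poisA_mulVec hB, ← poisA_pi hB hx, h] at h1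
  unfold poisU
  linarith

lemma poisG_unique (hB : BaseChain P μ) {x : Fin N → ℝ} (hx : x ∈ posO N) {f g : Fin N → ℝ}
    (h : poisA P μ α x *ᵥ g = f) : poisG P μ α f x = g := by
  have h2 := poisson_A hB (α := α) hx f
  have hu : IsUnit (poisA P μ α x).det := isUnit_iff_ne_zero.2 (poisA_det hB hx)
  exact Matrix.mulVec_injective_of_isUnit ((Matrix.isUnit_iff_isUnit_det _).2 hu) (h2.trans h.symm)

/-! Smoothness -/

lemma contDiffOn_det (_hB : BaseChain P μ) {E : Type*} [NormedAddCommGroup E] [NormedSpace ℝ E]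
    {M : E → Matrix (Fin N) (Fin N) ℝ} {s : Set E}
    (h : ∀ i j, ContDiffOn ℝ 1 (fun x => M x i j) s) : ContDiffOn ℝ 1 (fun x => (M x).det) s := by
  simp_rw [Matrix.det_apply']
  exact ContDiffOn.sum fun σ _ => contDiffOn_const.mul (contDiffOn_prod fun i _ => h _ _)

lemma wt_contDiff (hB : BaseChain P μ) (j : Fin N) : ContDiffOn ℝ 1 (fun x => wt μ α x j) (posO N) := by
  unfold wt
  refine ContDiffOn.rpow_const_of_ne ?_ fun x hx => (div_pos (hx j) (hB.mu_pos j)).ne'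
  exact ((contDiff_apply ℝ ℝ j).contDiffOn).div_const _

lemma rowD_contDiff (hB : BaseChain P μ) (i : Fin N) : ContDiffOn ℝ 1 (fun x => rowD P μ α x i) (posO N) :=
  ContDiffOn.sum fun k _ => contDiffOn_const.mul (wt_contDiff hB k)

lemma kernel_contDiff (hB : BaseChain P μ) (i j : Fin N) :
    ContDiffOn ℝ 1 (fun x => srrwKernel P μ α x i j) (posO N) :=
  (contDiffOn_const.mul (wt_contDiff hB j)).div (rowD_contDiff hB i)
    fun x hx => (rowD_pos hB hx i).ne'

lemma unH_contDiff (hB : BaseChain P μ) (i : Fin N) : ContDiffOn ℝ 1 (fun x => unH P μ α x i) (posO N) :=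
  (contDiffOn_const.mul (wt_contDiff hB i)).mul (rowD_contDiff hB i)

lemma zS_contDiff (hB : BaseChain P μ) : ContDiffOn ℝ 1 (fun x => zS P μ α x) (posO N) :=
  ContDiffOn.sum fun k _ => unH_contDiff hB k

lemma piS_contDiff (hB : BaseChain P μ) (i : Fin N) : ContDiffOn ℝ 1 (fun x => piS P μ α x i) (posO N) :=
  (unH_contDiff hB i).div (zS_contDiff hB) fun x hx => (zS_pos hB hx).ne'

lemma poisA_contDiff (hB : BaseChain P μ) (i j : Fin N) : ContDiffOn ℝ 1 (fun x => poisA P μ α x i j) (posO N) :=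
  (contDiffOn_const.sub (kernel_contDiff hB i j)).add (piS_contDiff hB j)

lemma poisG_contDiff (hB : BaseChain P μ) (f : Fin N → ℝ) (i : Fin N) :
    ContDiffOn ℝ 1 (fun x => poisG P μ α f x i) (posO N) := by
  refine ContDiffOn.mul (ContDiffOn.inv (contDiffOn_det hB (poisA_contDiff hB))
    fun x hx => poisA_det hB hx) (contDiffOn_det hB fun k l => ?_)
  simp only [Matrix.updateCol_apply]
  split_ifs
  · exact contDiffOn_const
  · exact poisA_contDiff hB k l

lemma poisU_contDiff (hB : BaseChain P μ) (f : Fin N → ℝ) (i : Fin N) :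
    ContDiffOn ℝ 1 (fun x => poisU P μ α f x i) (posO N) :=
  ContDiffOn.sum fun j _ => (kernel_contDiff hB i j).mul (poisG_contDiff hB f j)


lemma lipschitz_of_contDiffOn {f : (Fin N → ℝ) → ℝ} (hf : ContDiffOn ℝ 1 f (posO N))
    {C : Set (Fin N → ℝ)} (hC : IsCompact C) (hCO : C ⊆ posO N) :
    ∃ L, 0 ≤ L ∧ ∀ x ∈ C, ∀ y ∈ C, |f x - f y| ≤ L * dist x y := by
  have h1 : LocallyLipschitzOn C f := by
    intro x hx
    obtain ⟨K, t, ht, hK⟩ := (hf.contDiffAt ((posO_open N).mem_nhds (hCO hx))).exists_lipschitzOnWith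
    exact ⟨K, t, mem_nhdsWithin_of_mem_nhds ht, hK⟩
  obtain ⟨K, hK⟩ := h1.exists_lipschitzOnWith_of_compact hC
  refine ⟨K, K.2, fun x hx y hy => ?_⟩
  have := hK.dist_le_mul x hx y hy
  rwa [Real.dist_eq] at this

lemma bounded_of_contDiffOn {f : (Fin N → ℝ) → ℝ} (hf : ContDiffOn ℝ 1 f (posO N))
    {C : Set (Fin N → ℝ)} (hC : IsCompact C) (hCO : C ⊆ posO N) :
    ∃ L, 0 ≤ L ∧ ∀ x ∈ C, |f x| ≤ L := by
  obtain ⟨L, hL⟩ := hC.exists_bound_of_continuousOn (hf.continuousOn.mono hCO)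
  refine ⟨max L 0, le_max_right _ _, fun x hx => (hL x hx).trans (le_max_left _ _)⟩

/-! Measurability -/

lemma measurable_det {E : Type*} [MeasurableSpace E] {M : E → Matrix (Fin N) (Fin N) ℝ}
    (h : ∀ i j, Measurable (fun x => M x i j)) : Measurable (fun x => (M x).det) := by
  simp_rw [Matrix.det_apply']
  exact Finset.measurable_sum _ fun σ _ => (Finset.measurable_prod _ fun i _ => h _ _).const_mul _

lemma wt_meas (j : Fin N) : Measurable (fun x => wt μ α x j) :=
  ((measurable_pi_apply j).div_const _).pow_const _

lemma rowD_meas (i : Fin N) : Measurable (fun x => rowD P μ α x i) :=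
  Finset.measurable_sum _ fun k _ => (wt_meas k).const_mul _

lemma kernel_meas (i j : Fin N) : Measurable (fun x => srrwKernel P μ α x i j) :=
  ((wt_meas j).const_mul _).div (rowD_meas i)

lemma unH_meas (i : Fin N) : Measurable (fun x => unH P μ α x i) :=
  ((wt_meas i).const_mul _).mul (rowD_meas i)

lemma piS_meas (i : Fin N) : Measurable (fun x => piS P μ α x i) :=
  (unH_meas i).div (Finset.measurable_sum _ fun k _ => unH_meas k)

lemma poisA_meas (i j : Fin N) : Measurable (fun x => poisA P μ α x i j) :=
  ((kernel_meas i j).const_sub _).add (piS_meas j)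

lemma poisG_meas (f : Fin N → ℝ) (i : Fin N) : Measurable (fun x => poisG P μ α f x i) := by
  refine (measurable_det poisA_meas).inv.mul (measurable_det fun k l => ?_)
  simp only [Matrix.updateCol_apply]
  split_ifs
  · exact measurable_const
  · exact poisA_meas k l

lemma poisU_meas (f : Fin N → ℝ) (i : Fin N) : Measurable (fun x => poisU P μ α f x i) :=
  Finset.measurable_sum _ fun j _ => (kernel_meas i j).mul (poisG_meas f j)

end kernel

/-! ### Behaviour at `μ` and the mean field -/
section atmu
variable {N : ℕ} {P : Matrix (Fin N) (Fin N) ℝ} {μ : Fin N → ℝ} {α : ℝ}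

lemma mu_mem_posO (hB : BaseChain P μ) : μ ∈ posO N := hB.mu_pos

lemma wt_mu (hB : BaseChain P μ) (j : Fin N) : wt μ α μ j = 1 := by
  rw [wt, div_self (hB.mu_pos j).ne', Real.one_rpow]

lemma rowD_mu (hB : BaseChain P μ) (i : Fin N) : rowD P μ α μ i = 1 := by
  simp only [rowD, wt_mu hB, mul_one, hB.rowsum]

lemma kernel_mu (hB : BaseChain P μ) (i j : Fin N) : srrwKernel P μ α μ i j = P i j := by
  rw [kernel_apply, wt_mu hB, rowD_mu hB, mul_one, div_one]

lemma unH_mu (hB : BaseChain P μ) (i : Fin N) : unH P μ α μ i = μ i := by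
  rw [unH, wt_mu hB, rowD_mu hB, mul_one, mul_one]

lemma zS_mu (hB : BaseChain P μ) : zS P μ α μ = 1 := by
  simp only [zS, unH_mu hB, hB.mu_sum]

lemma piS_mu (hB : BaseChain P μ) (i : Fin N) : piS P μ α μ i = μ i := by
  rw [piS, unH_mu hB, zS_mu hB, div_one]

lemma rev_sum (hB : BaseChain P μ) (θ v : Fin N → ℝ) :
    ∑ j, v j * (μ j * ∑ k, P j k * (θ k / μ k)) = ∑ k, θ k * ∑ j, P k j * v j := by
  simp_rw [Finset.mul_sum]
  rw [Finset.sum_comm]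
  refine Finset.sum_congr rfl fun k _ => Finset.sum_congr rfl fun j _ => ?_
  have := hB.rev j k
  have h2 := (hB.mu_pos k).ne'
  calc _ = (μ j * P j k) * (v j * θ k / μ k) := by ring
    _ = _ := by rw [this]; field_simp

lemma pi_line_deriv (hB : BaseChain P μ) {θ : Fin N → ℝ} (hθ : ∑ i, θ i = 0) (v : Fin N → ℝ) :
    HasDerivAt (fun t : ℝ => ∑ j, piS P μ α (μ + t • θ) j * v j)
      (-α * ∑ k, θ k * (v k + ∑ j, P k j * v j)) 0 := by
  have hμ0 : ∀ t : ℝ, t = 0 → μ + t • θ = μ := fun t ht => by rw [ht]; simp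
  have hw : ∀ j, HasDerivAt (fun t : ℝ => wt μ α (μ + t • θ) j) (-α * (θ j / μ j)) 0 := fun j => by
    have h1 : HasDerivAt (fun t : ℝ => (μ j + t * θ j) / μ j) (θ j / μ j) 0 := by
      have := (((hasDerivAt_id (0 : ℝ)).mul_const (θ j)).const_add (μ j)).div_const (μ j)
      simpa using this
    have h2 := h1.rpow_const (p := -α) (Or.inl (by
      simp only [zero_mul, add_zero]
      rw [div_self (hB.mu_pos j).ne']; exact one_ne_zero))
    refine HasDerivAt.congr_deriv h2 ?_
    simp only [zero_mul, add_zero]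
    rw [div_self (hB.mu_pos j).ne', Real.one_rpow]; ring
  have hr : ∀ i, HasDerivAt (fun t : ℝ => rowD P μ α (μ + t • θ) i)
      (∑ k, P i k * (-α * (θ k / μ k))) 0 := fun i =>
    HasDerivAt.fun_sum fun k _ => (hw k).const_mul (P i k)
  have hu : ∀ i, HasDerivAt (fun t : ℝ => unH P μ α (μ + t • θ) i)
      (-α * (θ i + μ i * ∑ k, P i k * (θ k / μ k))) 0 := fun i => by
    have h := ((hw i).const_mul (μ i)).mul (hr i)
    refine HasDerivAt.congr_deriv h ?_
    simp only [hμ0 0 rfl, rowD_mu hB, wt_mu hB]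
    have h2 := (hB.mu_pos i).ne'
    have h3 : ∑ k, P i k * (-α * (θ k / μ k)) = -α * ∑ k, P i k * (θ k / μ k) := by
      rw [Finset.mul_sum]; exact Finset.sum_congr rfl fun k _ => by ring
    rw [h3]; field_simp; ring
  have hz : HasDerivAt (fun t : ℝ => zS P μ α (μ + t • θ)) 0 0 := by
    have h := HasDerivAt.fun_sum (u := univ) fun i _ => hu i
    refine HasDerivAt.congr_deriv h ?_
    rw [← Finset.mul_sum, Finset.sum_add_distrib, hθ]
    have := rev_sum hB θ (fun _ => 1)
    simp only [one_mul, mul_one, hB.rowsum, hθ] at this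
    rw [this]; ring
  have hp : ∀ i, HasDerivAt (fun t : ℝ => piS P μ α (μ + t • θ) i)
      (-α * (θ i + μ i * ∑ k, P i k * (θ k / μ k))) 0 := fun i => by
    have h := (hu i).div hz (by rw [hμ0 0 rfl, zS_mu hB]; exact one_ne_zero)
    refine HasDerivAt.congr_deriv h ?_
    simp only [hμ0 0 rfl, zS_mu hB]; ring
  have h := HasDerivAt.fun_sum (u := univ) fun j _ => (hp j).mul_const (v j)
  refine HasDerivAt.congr_deriv h ?_
  have h1 := rev_sum hB θ v
  have h2 : ∀ i, -α * (θ i + μ i * ∑ k, P i k * (θ k / μ k)) * v i =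
      -α * (θ i * v i + v i * (μ i * ∑ k, P i k * (θ k / μ k))) := fun i => by ring
  simp_rw [h2, ← Finset.mul_sum, Finset.sum_add_distrib, h1, mul_add, Finset.sum_add_distrib]
  ring

lemma pi_expansion (hB : BaseChain P μ) {v : Fin N → ℝ} {lam : ℝ}
    (hv : ∀ k, ∑ j, P k j * v j = lam * v k) (hvμ : ∑ k, μ k * v k = 0) {ε : ℝ} (hε : 0 < ε) :
    ∀ᶠ x in 𝓝 μ, ∑ i, x i = 1 →
      |∑ j, piS P μ α x j * v j + α * (1 + lam) * ∑ j, (x j - μ j) * v j| ≤ ε * ‖x - μ‖ := by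
  set φ : (Fin N → ℝ) → ℝ := fun x => ∑ j, piS P μ α x j * v j with hφ
  have hd : ContDiffOn ℝ 1 φ (posO N) := ContDiffOn.sum fun j _ =>
    (piS_contDiff hB j).mul contDiffOn_const
  have hdiff : DifferentiableAt ℝ φ μ :=
    (hd.contDiffAt ((posO_open N).mem_nhds (mu_mem_posO hB))).differentiableAt one_ne_zero
  have hfd := hdiff.hasFDerivAt
  have hval : ∀ θ : Fin N → ℝ, ∑ i, θ i = 0 →
      fderiv ℝ φ μ θ = -(α * (1 + lam) * ∑ j, θ j * v j) := fun θ hθ => by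
    have h1 := pi_line_deriv hB (α := α) hθ v
    have h2 : HasDerivAt (fun t : ℝ => μ + t • θ) θ 0 := by
      have := ((hasDerivAt_id (0 : ℝ)).smul_const θ).const_add μ
      simpa using this
    have h3 : HasFDerivAt φ (fderiv ℝ φ μ) (μ + (0 : ℝ) • θ) := by simpa using hfd
    have h4 := h3.comp_hasDerivAt (0 : ℝ) h2
    rw [h4.unique h1]
    simp_rw [hv, Finset.mul_sum]
    rw [← Finset.sum_neg_distrib]
    exact Finset.sum_congr rfl fun j _ => by ring
  have ho := hfd.isLittleO.def hε
  filter_upwards [ho] with x hx hsum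
  have hs : ∑ i, (x - μ) i = 0 := by
    simp [Finset.sum_sub_distrib, hsum, hB.mu_sum]
  rw [hval _ hs] at hx
  have hφμ : φ μ = 0 := by simp only [hφ, piS_mu hB, hvμ]
  rw [hφμ, Real.norm_eq_abs] at hx
  simpa using hx

lemma rpow_neg_diff (hα : 0 ≤ α) {m0 s t : ℝ} (hm0 : 0 < m0) (hs : m0 ≤ s) (hst : s ≤ t) :
    s ^ (-α) - t ^ (-α) ≤ m0 ^ (-α) * (α / m0) * (t - s) := by
  have hs0 : 0 < s := hm0.trans_le hs
  have ht0 : 0 < t := hs0.trans_le hst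
  have h1 : t ^ (-α) = s ^ (-α) * (t / s) ^ (-α) := by
    rw [← Real.mul_rpow hs0.le (div_pos ht0 hs0).le]; congr 1; field_simp
  have h2 : 1 - α * (t / s - 1) ≤ (t / s) ^ (-α) := by
    have hp : 0 < t / s := div_pos ht0 hs0
    rw [Real.rpow_def_of_pos hp]
    have a1 := Real.add_one_le_exp (Real.log (t / s) * -α)
    have a2 := Real.log_le_sub_one_of_pos hp
    have a3 := mul_le_mul_of_nonneg_left a2 hα
    linarith
  have h3 : s ^ (-α) ≤ m0 ^ (-α) := Real.rpow_le_rpow_of_nonpos hm0 hs (by linarith)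
  have h4 : 0 < s ^ (-α) := Real.rpow_pos_of_pos hs0 _
  have h5 : s ^ (-α) - t ^ (-α) ≤ s ^ (-α) * (α * (t / s - 1)) := by
    rw [h1]
    have := mul_le_mul_of_nonneg_left h2 h4.le
    linarith
  have h6 : α * (t / s - 1) = (α / s) * (t - s) := by field_simp
  rw [h6, ← mul_assoc] at h5
  refine h5.trans (mul_le_mul_of_nonneg_right ?_ (by linarith))
  exact mul_le_mul h3 (div_le_div_of_nonneg_left hα hm0 hs) (div_nonneg hα hs0.le)
    (Real.rpow_pos_of_pos hm0 _).le

lemma mean_field_ineq (hB : BaseChain P μ) (hα : 0 ≤ α) {m0 Y : ℝ} (hm0 : 0 < m0) :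
    ∃ L, 0 ≤ L ∧ ∀ x ∈ posO N, (∀ i, m0 ≤ x i / μ i) → (∀ i, x i / μ i ≤ Y) →
      ∀ a b : Fin N, (∀ i, x i / μ i ≤ x a / μ a) → (∀ i, x b / μ b ≤ x i / μ i) →
      ∃ c, ∀ i, piS P μ α x i / μ i ≤ c + L * (x a / μ a - x i / μ i) ∧
        c - L * (x i / μ i - x b / μ b) ≤ piS P μ α x i / μ i := by
  by_cases hY : 0 < Y
  swap
  · refine ⟨0, le_rfl, fun x hx h1 h2 a => ?_⟩
    have := h1 a; have := h2 a; linarith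
  set R := m0 ^ (-α) / (Y ^ (-α) * Y ^ (-α)) with hR
  set κ := m0 ^ (-α) * (α / m0) with hκ
  have hm0p := Real.rpow_pos_of_pos hm0 (-α)
  have hYp := Real.rpow_pos_of_pos hY (-α)
  have hκ0 : 0 ≤ κ := mul_nonneg hm0p.le (div_nonneg hα hm0.le)
  have hR0 : 0 ≤ R := (div_pos hm0p (mul_pos hYp hYp)).le
  refine ⟨R * κ, mul_nonneg hR0 hκ0, fun x hx h1 h2 a b ha hb => ?_⟩
  set y : Fin N → ℝ := fun i => x i / μ i with hy
  have hy0 : ∀ i, 0 < y i := fun i => hm0.trans_le (h1 i)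
  have hZ := zS_pos hB (α := α) hx
  have hanti : ∀ {s t : ℝ}, 0 < s → s ≤ t → t ^ (-α) ≤ s ^ (-α) := fun hs hst =>
    Real.rpow_le_rpow_of_nonpos hs hst (by linarith)
  have hrowU : ∀ i, ∀ B, (∀ k, y k ^ (-α) ≤ B) → rowD P μ α x i ≤ B := fun i B h => by
    calc rowD P μ α x i ≤ ∑ k, P i k * B :=
          Finset.sum_le_sum fun k _ => mul_le_mul_of_nonneg_left (h k) (hB.nonneg i k)
      _ = B := by rw [← Finset.sum_mul, hB.rowsum, one_mul]
  have hrowL : ∀ i, ∀ B, (∀ k, B ≤ y k ^ (-α)) → B ≤ rowD P μ α x i := fun i B h => by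
    calc B = ∑ k, P i k * B := by rw [← Finset.sum_mul, hB.rowsum, one_mul]
      _ ≤ rowD P μ α x i :=
          Finset.sum_le_sum fun k _ => mul_le_mul_of_nonneg_left (h k) (hB.nonneg i k)
  have hZl : Y ^ (-α) * Y ^ (-α) ≤ zS P μ α x := by
    calc _ = ∑ i, μ i * (Y ^ (-α) * Y ^ (-α)) := by rw [← Finset.sum_mul, hB.mu_sum, one_mul]
      _ ≤ _ := Finset.sum_le_sum fun i _ => by
        rw [unH, mul_assoc]
        refine mul_le_mul_of_nonneg_left ?_ (hB.mu_pos i).le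
        exact mul_le_mul (hanti (hy0 i) (h2 i)) (hrowL i _ fun k => hanti (hy0 k) (h2 k)) hYp.le
          (wt_pos hB hx i).le
  have hRle : ∀ i, y i ^ (-α) / zS P μ α x ≤ R := fun i =>
    div_le_div₀ hm0p.le (hanti hm0 (h1 i)) (mul_pos hYp hYp) hZl
  have hq : ∀ i, piS P μ α x i / μ i = y i ^ (-α) * rowD P μ α x i / zS P μ α x := fun i => by
    have h := (hB.mu_pos i).ne'
    rw [piS, unH, show wt μ α x i = y i ^ (-α) from rfl]; field_simp
  refine ⟨y b ^ (-α) * y a ^ (-α) / zS P μ α x, fun i => ⟨?_, ?_⟩⟩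
  · rw [hq]
    have e1 : y i ^ (-α) * rowD P μ α x i / zS P μ α x ≤
        y i ^ (-α) * y b ^ (-α) / zS P μ α x := by
      refine div_le_div_of_nonneg_right (mul_le_mul_of_nonneg_left ?_
        (Real.rpow_pos_of_pos (hy0 i) _).le) hZ.le
      exact hrowU i _ fun k => hanti (hy0 b) (hb k)
    have e2 := rpow_neg_diff hα hm0 (h1 i) (ha i)
    have e3 : y i ^ (-α) * y b ^ (-α) / zS P μ α x - y b ^ (-α) * y a ^ (-α) / zS P μ α x =
        (y b ^ (-α) / zS P μ α x) * (y i ^ (-α) - y a ^ (-α)) := by ring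
    have hpos : 0 ≤ y b ^ (-α) / zS P μ α x := (div_pos (Real.rpow_pos_of_pos (hy0 b) _) hZ).le
    have e4 := mul_le_mul_of_nonneg_left e2 hpos
    have e5 := mul_le_mul_of_nonneg_right (hRle b)
      (mul_nonneg hκ0 (by linarith [ha i] : 0 ≤ y a - y i))
    have e6 : R * κ * (y a - y i) = R * (κ * (y a - y i)) := by ring
    change _ ≤ _ + R * κ * (y a - y i)
    change (y b ^ (-α) / zS P μ α x) * (y i ^ (-α) - y a ^ (-α)) ≤
      (y b ^ (-α) / zS P μ α x) * (κ * (y a - y i)) at e4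
    linarith
  · rw [hq]
    have e1 : y i ^ (-α) * y a ^ (-α) / zS P μ α x ≤
        y i ^ (-α) * rowD P μ α x i / zS P μ α x := by
      refine div_le_div_of_nonneg_right (mul_le_mul_of_nonneg_left ?_
        (Real.rpow_pos_of_pos (hy0 i) _).le) hZ.le
      exact hrowL i _ fun k => hanti (hy0 k) (ha k)
    have e2 := rpow_neg_diff hα hm0 (h1 b) (hb i)
    have e3 : y b ^ (-α) * y a ^ (-α) / zS P μ α x - y i ^ (-α) * y a ^ (-α) / zS P μ α x =
        (y a ^ (-α) / zS P μ α x) * (y b ^ (-α) - y i ^ (-α)) := by ring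
    have hpos : 0 ≤ y a ^ (-α) / zS P μ α x := (div_pos (Real.rpow_pos_of_pos (hy0 a) _) hZ).le
    have e4 := mul_le_mul_of_nonneg_left e2 hpos
    have e5 := mul_le_mul_of_nonneg_right (hRle a)
      (mul_nonneg hκ0 (by linarith [hb i] : 0 ≤ y i - y b))
    have e6 : R * κ * (y i - y b) = R * (κ * (y i - y b)) := by ring
    change _ - R * κ * (y i - y b) ≤ _
    change (y a ^ (-α) / zS P μ α x) * (y b ^ (-α) - y i ^ (-α)) ≤
      (y a ^ (-α) / zS P μ α x) * (κ * (y i - y b)) at e4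
    linarith

/-- Pathwise convergence `x_n → μ`. -/
lemma path_conv (hB : BaseChain P μ) (hα : 0 ≤ α) {γ : ℕ → ℝ} {τ : ℝ} (hγ : GammaSeq γ τ)
    (x : ℕ → Fin N → ℝ) (X : ℕ → Fin N) (hx : ∀ n, x n ∈ intSimplex N)
    (hrec : ∀ n, x (n + 1) = x n + γ (n + 1) • (Pi.single (X (n + 1)) (1 : ℝ) - x n))
    {m0 : ℝ} (hm0 : 0 < m0) (hxm : ∀ n i, m0 ≤ x n i)
    (hT : ∀ i, ∃ T, Tendsto (fun n => ∑ k ∈ range n, γ (k + 1) *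
      ((Pi.single (X (k + 1)) (1 : ℝ) : Fin N → ℝ) i - piS P μ α (x k) i)) atTop (𝓝 T)) :
    Tendsto x atTop (𝓝 μ) := by
  choose T hT using hT
  have hne := nonemptyFin hB
  have hμ1 : ∀ i, μ i ≤ 1 := fun i => by
    rw [← hB.mu_sum]
    exact Finset.single_le_sum (f := μ) (fun j _ => (hB.mu_pos j).le) (mem_univ i)
  have hx1 : ∀ n i, x n i ≤ 1 := fun n i => by
    rw [← (hx n).2]
    exact Finset.single_le_sum (f := x n) (fun j _ => ((hx n).1 j).le) (mem_univ i)
  obtain ⟨L, hL0, hL⟩ := mean_field_ineq hB hα (Y := ∑ i, 1 / μ i) hm0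
  set d : ℕ → Fin N → ℝ := fun n i => (∑ k ∈ range n, γ (k + 1) *
      ((Pi.single (X (k + 1)) (1 : ℝ) : Fin N → ℝ) i - piS P μ α (x k) i)) - T i with hd
  have hd0 : ∀ i, Tendsto (fun n => d n i) atTop (𝓝 0) := fun i => by
    simpa using (hT i).sub_const (T i)
  set y : ℕ → Fin N → ℝ := fun n i => x n i / μ i with hy
  set z : ℕ → Fin N → ℝ := fun n i => y n i - d n i / μ i with hz
  set δ : ℕ → ℝ := fun n => ∑ i, |d n i / μ i| with hδ
  have hδ0 : Tendsto δ atTop (𝓝 0) := by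
    have : Tendsto δ atTop (𝓝 (∑ i : Fin N, |0 / μ i|)) :=
      tendsto_finsetSum _ fun i _ => ((hd0 i).div_const (μ i)).abs
    simpa using this
  have hzy : ∀ n i, |z n i - y n i| ≤ δ n := fun n i => by
    have : z n i - y n i = -(d n i / μ i) := by simp [hz]
    rw [this, abs_neg]
    exact Finset.single_le_sum (f := fun i => |d n i / μ i|) (fun _ _ => abs_nonneg _) (mem_univ i)
  have hzrec : ∀ n i, z (n + 1) i = z n i + γ (n + 1) * (piS P μ α (x n) i / μ i - y n i) := by
    intro n i
    simp only [hz, hy, hd, Finset.sum_range_succ, hrec n, Pi.add_apply, Pi.smul_apply,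
      Pi.sub_apply, smul_eq_mul]
    ring
  set osc : ℕ → ℝ := fun n => univ.sup' univ_nonempty
    (fun ij : Fin N × Fin N => z n ij.1 - z n ij.2) with hosc
  have hosc_le : ∀ n i j, z n i - z n j ≤ osc n := fun n i j =>
    Finset.le_sup' (fun ij : Fin N × Fin N => z n ij.1 - z n ij.2) (mem_univ (i, j))
  have hosc0 : ∀ n, 0 ≤ osc n := fun n => by
    obtain ⟨i⟩ := hne
    simpa using hosc_le n i i
  have hosc_lim : Tendsto osc atTop (𝓝 0) := by
    refine recursion_tendsto_zero hγ.step one_pos (e := fun n => 2 * (2 * L + 1) * δ n) hosc0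
      (by simpa using hδ0.const_mul (2 * (2 * L + 1))) ?_
    have hev : ∀ᶠ n in atTop, (1 + L) * γ (n + 1) < 1 := by
      have : Tendsto (fun n => (1 + L) * γ (n + 1)) atTop (𝓝 0) := by
        simpa using hγ.step.lim.const_mul (1 + L)
      exact this.eventually (gt_mem_nhds one_pos)
    filter_upwards [hev] with n hn
    have hg := hγ.pos (n + 1)
    obtain ⟨a, ha⟩ := Finite.exists_max (y n)
    obtain ⟨b, hb⟩ := Finite.exists_min (y n)
    obtain ⟨a', ha'⟩ := Finite.exists_max (z n)
    obtain ⟨b', hb'⟩ := Finite.exists_min (z n)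
    obtain ⟨c, hc⟩ := hL (x n) (hx n).1 (fun i => by
        rw [le_div_iff₀ (hB.mu_pos i)]
        have := mul_le_mul_of_nonneg_left (hμ1 i) hm0.le
        linarith [hxm n i])
      (fun i => by
        calc x n i / μ i ≤ 1 / μ i := div_le_div_of_nonneg_right (hx1 n i) (hB.mu_pos i).le
          _ ≤ _ := Finset.single_le_sum (f := fun i => 1 / μ i)
            (fun j _ => (one_div_pos.2 (hB.mu_pos j)).le) (mem_univ i)) a b ha hb
    have hup : ∀ i, z (n + 1) i ≤ (1 - γ (n + 1)) * z n a' + γ (n + 1) * (c + (2 * L + 1) * δ n) := by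
      intro i
      rw [hzrec]
      have k1 := (hc i).1
      have k2 := abs_le.1 (hzy n i)
      have k3 := abs_le.1 (hzy n a)
      change _ ≤ c + L * (y n a - y n i) at k1
      have k4 : L * (y n a - y n i) ≤ L * (z n a' - z n i + 2 * δ n) :=
        mul_le_mul_of_nonneg_left (by linarith [ha' a]) hL0
      have k5 : piS P μ α (x n) i / μ i - y n i ≤
          c + L * (z n a' - z n i + 2 * δ n) - z n i + δ n := by linarith
      have k6 := mul_le_mul_of_nonneg_left k5 hg.le
      have k7 : (1 - (1 + L) * γ (n + 1)) * z n i ≤ (1 - (1 + L) * γ (n + 1)) * z n a' :=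
        mul_le_mul_of_nonneg_left (ha' i) (by linarith)
      linarith
    have hlo : ∀ i, (1 - γ (n + 1)) * z n b' + γ (n + 1) * (c - (2 * L + 1) * δ n) ≤
        z (n + 1) i := by
      intro i
      rw [hzrec]
      have k1 := (hc i).2
      have k2 := abs_le.1 (hzy n i)
      have k3 := abs_le.1 (hzy n b)
      change c - L * (y n i - y n b) ≤ _ at k1
      have k4 : L * (y n i - y n b) ≤ L * (z n i - z n b' + 2 * δ n) :=
        mul_le_mul_of_nonneg_left (by linarith [hb' b]) hL0
      have k5 : c - L * (z n i - z n b' + 2 * δ n) - z n i - δ n ≤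
          piS P μ α (x n) i / μ i - y n i := by linarith
      have k6 := mul_le_mul_of_nonneg_left k5 hg.le
      have k7 : (1 - (1 + L) * γ (n + 1)) * z n b' ≤ (1 - (1 + L) * γ (n + 1)) * z n i :=
        mul_le_mul_of_nonneg_left (hb' i) (by linarith)
      linarith
    refine Finset.sup'_le _ _ fun ij _ => ?_
    have l1 := hup ij.1
    have l2 := hlo ij.2
    have l3 : (1 - γ (n + 1)) * (z n a' - z n b') ≤ (1 - γ (n + 1)) * osc n :=
      mul_le_mul_of_nonneg_left (hosc_le n a' b') (by nlinarith)
    rw [one_mul]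
    linarith
  -- conclude
  have hbound : ∀ n i, |y n i - 1| ≤ osc n + 2 * δ n := fun n i => by
    have hyd : ∀ j, |y n i - y n j| ≤ osc n + 2 * δ n := fun j => by
      have k1 := abs_le.1 (hzy n i)
      have k2 := abs_le.1 (hzy n j)
      have k3 := hosc_le n i j
      have k4 := hosc_le n j i
      rw [abs_le]; constructor <;> linarith
    have : y n i - 1 = ∑ j, μ j * (y n i - y n j) := by
      simp_rw [mul_sub, Finset.sum_sub_distrib, ← Finset.sum_mul, hB.mu_sum]
      have : ∑ j, μ j * y n j = 1 := by
        rw [← (hx n).2]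
        exact Finset.sum_congr rfl fun j _ => by
          simp only [hy]; have := (hB.mu_pos j).ne'; field_simp
      rw [this]; ring
    rw [this]
    calc _ ≤ ∑ j, |μ j * (y n i - y n j)| := Finset.abs_sum_le_sum_abs _ _
      _ ≤ ∑ j, μ j * (osc n + 2 * δ n) := Finset.sum_le_sum fun j _ => by
        rw [abs_mul, abs_of_pos (hB.mu_pos j)]
        exact mul_le_mul_of_nonneg_left (hyd j) (hB.mu_pos j).le
      _ = _ := by rw [← Finset.sum_mul, hB.mu_sum, one_mul]
  rw [tendsto_pi_nhds]
  intro i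
  have h1 : Tendsto (fun n => y n i - 1) atTop (𝓝 0) :=
    squeeze_zero_norm (hbound · i) (by simpa using hosc_lim.add (hδ0.const_mul 2))
  have h2 := (h1.add_const 1).const_mul (μ i)
  simp only [zero_add, mul_one] at h2
  refine h2.congr fun n => ?_
  simp only [hy]; have := (hB.mu_pos i).ne'; field_simp; ring

end atmu

/-! ### The walk: conditional expectations and the martingale increments -/

/-- Compact pieces of the interior of the simplex. -/
def boxC (N : ℕ) (m : ℝ) : Set (Fin N → ℝ) := {x | (∀ i, m ≤ x i) ∧ ∑ i, x i = 1}

lemma boxC_closed (N : ℕ) (m : ℝ) : IsClosed (boxC N m) := by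
  have h1 : IsClosed {x : Fin N → ℝ | ∀ i, m ≤ x i} := by
    rw [Set.ofPred_forall]
    exact isClosed_iInter fun i => isClosed_le continuous_const (continuous_apply i)
  have h2 : IsClosed {x : Fin N → ℝ | ∑ i, x i = 1} :=
    isClosed_eq (continuous_finsetSum _ fun i _ => continuous_apply i) continuous_const
  exact h1.inter h2

lemma boxC_posO {N : ℕ} {m : ℝ} (hm : 0 < m) : boxC N m ⊆ posO N :=
  fun _ hx i => hm.trans_le (hx.1 i)

lemma boxC_compact {N : ℕ} {m : ℝ} (hm : 0 < m) : IsCompact (boxC N m) := by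
  refine IsCompact.of_isClosed_subset (isCompact_Icc (a := fun _ : Fin N => (0 : ℝ))
    (b := fun _ => 1)) (boxC_closed N m) fun x hx => ⟨fun i => (hm.trans_le (hx.1 i)).le, fun i => ?_⟩
  rw [← hx.2]
  exact Finset.single_le_sum (f := x) (fun j _ => (hm.trans_le (hx.1 j)).le) (mem_univ i)

lemma intSimplex_posO {N : ℕ} {x : Fin N → ℝ} (hx : x ∈ intSimplex N) : x ∈ posO N := hx.1

lemma meas_comp2 {N : ℕ} {Ω : Type*} {m : MeasurableSpace Ω} {g : (Fin N → ℝ) → Fin N → ℝ}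
    (hg : ∀ s, Measurable (fun x => g x s)) {y : Ω → Fin N → ℝ} {S : Ω → Fin N}
    (hy : Measurable y) (hS : Measurable S) : Measurable (fun ω => g (y ω) (S ω)) := by
  have : (fun ω => g (y ω) (S ω)) = fun ω => ∑ s, if S ω = s then g (y ω) s else 0 := by
    funext ω; simp
  rw [this]
  exact Finset.measurable_sum _ fun s _ => Measurable.ite (hS (measurableSet_singleton s))
    ((hg s).comp hy) measurable_const

/-- The SRRW process. -/
structure Walk {N : ℕ} (P : Matrix (Fin N) (Fin N) ℝ) (μ : Fin N → ℝ) (α : ℝ) (γ : ℕ → ℝ)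
    {Ω : Type*} [mΩ : MeasurableSpace Ω] (Pr : Measure Ω) (F : Filtration ℕ mΩ)
    (X : ℕ → Ω → Fin N) (x : ℕ → Ω → (Fin N → ℝ)) : Prop where
  Xm : ∀ n, Measurable[F n] (X n)
  xm : ∀ n, Measurable[F n] (x n)
  simp : ∀ n ω, x n ω ∈ intSimplex N
  cond : ∀ (n : ℕ) (j : Fin N),
      (Pr[(fun ω => if X (n + 1) ω = j then (1 : ℝ) else 0)|F n]) =ᵐ[Pr]
        fun ω => srrwKernel P μ α (x n ω) (X n ω) j
  step : ∀ (n : ℕ) (ω : Ω),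
      x (n + 1) ω = x n ω + γ (n + 1) • (Pi.single (X (n + 1) ω) (1 : ℝ) - x n ω)
  stable : ∀ᵐ ω ∂Pr, ∃ C : Set (Fin N → ℝ),
      IsCompact C ∧ C ⊆ intSimplex N ∧ ∀ n, x n ω ∈ C

section walk
variable {N : ℕ} {P : Matrix (Fin N) (Fin N) ℝ} {μ : Fin N → ℝ} {α : ℝ} {γ : ℕ → ℝ} {τ : ℝ}
    {Ω : Type*} [mΩ : MeasurableSpace Ω] {Pr : Measure Ω} [IsProbabilityMeasure Pr]
    {F : Filtration ℕ mΩ} {X : ℕ → Ω → Fin N} {x : ℕ → Ω → (Fin N → ℝ)}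

lemma kernel_le_one (hB : BaseChain P μ) {y : Fin N → ℝ} (hy : y ∈ posO N) (i j : Fin N) :
    srrwKernel P μ α y i j ≤ 1 := by
  rw [← kernel_sum hB hy i (α := α)]
  exact Finset.single_le_sum (f := fun j => srrwKernel P μ α y i j)
    (fun k _ => kernel_nonneg hB hy i k) (mem_univ j)

lemma Walk.test_real (hB : BaseChain P μ) (hW : Walk P μ α γ Pr F X x) (n : ℕ) (j : Fin N)
    {Y : Ω → ℝ} (hY : Measurable[F n] Y) {C : ℝ} (hC : ∀ ω, |Y ω| ≤ C) :
    ∫ ω, Y ω * ((if X (n + 1) ω = j then (1 : ℝ) else 0) -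
      srrwKernel P μ α (x n ω) (X n ω) j) ∂Pr = 0 := by
  have hYm : Measurable Y := hY.mono (F.le n) le_rfl
  set g : Ω → ℝ := fun ω => if X (n + 1) ω = j then (1 : ℝ) else 0 with hg
  have hXm : Measurable (X (n + 1)) := (hW.Xm (n + 1)).mono (F.le _) le_rfl
  have hgm : Measurable g := Measurable.ite (hXm (measurableSet_singleton j))
    measurable_const measurable_const
  have hg1 : ∀ ω, ‖g ω‖ ≤ 1 := fun ω => by simp only [hg]; split_ifs <;> simp
  have hgi : Integrable g Pr := integrable_of_bdd hgm.aestronglyMeasurable hg1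
  have hKm : Measurable (fun ω => srrwKernel P μ α (x n ω) (X n ω) j) :=
    meas_comp2 (g := fun y s => srrwKernel P μ α y s j) (fun s => kernel_meas s j)
      ((hW.xm n).mono (F.le _) le_rfl) ((hW.Xm n).mono (F.le _) le_rfl)
  have hK1 : ∀ ω, |srrwKernel P μ α (x n ω) (X n ω) j| ≤ 1 := fun ω => by
    rw [abs_of_nonneg (kernel_nonneg hB (hW.simp n ω).1 _ _)]
    exact kernel_le_one hB (hW.simp n ω).1 _ _
  have hC0 : ∀ ω, 0 ≤ C := fun ω => (abs_nonneg _).trans (hC ω)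
  have i1 : Integrable (fun ω => Y ω * g ω) Pr := by
    refine integrable_of_bdd (C := C * 1) (hYm.mul hgm).aestronglyMeasurable fun ω => ?_
    rw [norm_mul]; exact mul_le_mul (hC ω) (hg1 ω) (norm_nonneg _) (hC0 ω)
  have i2 : Integrable (fun ω => Y ω * srrwKernel P μ α (x n ω) (X n ω) j) Pr := by
    refine integrable_of_bdd (C := C * 1) (hYm.mul hKm).aestronglyMeasurable fun ω => ?_
    rw [norm_mul]; exact mul_le_mul (hC ω) (hK1 ω) (norm_nonneg _) (hC0 ω)
  have h1 : Pr[(Y * g)|F n] =ᵐ[Pr] Y * Pr[g|F n] :=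
    condExp_stronglyMeasurable_mul_of_bound (F.le n) hY.stronglyMeasurable hgi C (ae_of_all _ hC)
  have h2 : ∫ ω, Y ω * g ω ∂Pr = ∫ ω, Y ω * srrwKernel P μ α (x n ω) (X n ω) j ∂Pr := by
    calc ∫ ω, Y ω * g ω ∂Pr = ∫ ω, (Pr[(Y * g)|F n]) ω ∂Pr := (integral_condExp (F.le n)).symm
      _ = _ := by
        refine integral_congr_ae ?_
        filter_upwards [h1, hW.cond n j] with ω a b
        rw [a, Pi.mul_apply, b]
  simp_rw [mul_sub]
  rw [integral_sub i1 i2, h2, sub_self]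

lemma Walk.test_complex (hB : BaseChain P μ) (hW : Walk P μ α γ Pr F X x) (n : ℕ) (j : Fin N)
    {Y : Ω → ℂ} (hY : Measurable[F n] Y) {C : ℝ} (hC : ∀ ω, ‖Y ω‖ ≤ C) :
    ∫ ω, Y ω * (((if X (n + 1) ω = j then (1 : ℝ) else 0) -
      srrwKernel P μ α (x n ω) (X n ω) j : ℝ) : ℂ) ∂Pr = 0 := by
  have hYm : Measurable Y := hY.mono (F.le n) le_rfl
  set g : Ω → ℝ := fun ω => (if X (n + 1) ω = j then (1 : ℝ) else 0) -
    srrwKernel P μ α (x n ω) (X n ω) j with hg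
  have hXm : Measurable (X (n + 1)) := (hW.Xm (n + 1)).mono (F.le _) le_rfl
  have hKm : Measurable (fun ω => srrwKernel P μ α (x n ω) (X n ω) j) :=
    meas_comp2 (g := fun y s => srrwKernel P μ α y s j) (fun s => kernel_meas s j)
      ((hW.xm n).mono (F.le _) le_rfl) ((hW.Xm n).mono (F.le _) le_rfl)
  have hgm : Measurable g := (Measurable.ite (hXm (measurableSet_singleton j))
    measurable_const measurable_const).sub hKm
  have hg1 : ∀ ω, |g ω| ≤ 1 := fun ω => by
    have h1 := kernel_nonneg hB (hW.simp n ω).1 (X n ω) j (α := α)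
    have h2 := kernel_le_one hB (hW.simp n ω).1 (X n ω) j (α := α)
    simp only [hg]; rw [abs_le]; split_ifs <;> constructor <;> linarith
  have hre : ∀ ω, |(Y ω).re| ≤ C := fun ω => (Complex.abs_re_le_norm _).trans (hC ω)
  have him : ∀ ω, |(Y ω).im| ≤ C := fun ω => (Complex.abs_im_le_norm _).trans (hC ω)
  have e1 : ∫ ω, (Y ω).re * g ω ∂Pr = 0 := hW.test_real hB n j (Complex.measurable_re.comp hY) hre
  have e2 : ∫ ω, (Y ω).im * g ω ∂Pr = 0 := hW.test_real hB n j (Complex.measurable_im.comp hY) him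
  have hIntEq : ∀ f : Ω → ℝ, Measurable f → (∀ ω, |f ω| ≤ C) →
      Integrable (fun ω => ((f ω * g ω : ℝ) : ℂ)) Pr := fun f hf hfC => by
    refine integrable_of_bdd (C := C * 1)
      (Complex.measurable_ofReal.comp (hf.mul hgm)).aestronglyMeasurable fun ω => ?_
    rw [Complex.norm_real, norm_mul]
    exact mul_le_mul (hfC ω) (hg1 ω) (norm_nonneg _) ((abs_nonneg _).trans (hfC ω))
  have i1 : Integrable (fun ω => (((Y ω).re * g ω : ℝ) : ℂ)) Pr := hIntEq _ (Complex.measurable_re.comp hYm) hre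
  have i2 : Integrable (fun ω => (((Y ω).im * g ω : ℝ) : ℂ)) Pr := hIntEq _ (Complex.measurable_im.comp hYm) him
  have hsplit : ∀ ω, Y ω * (g ω : ℂ) = (((Y ω).re * g ω : ℝ) : ℂ) +
      (((Y ω).im * g ω : ℝ) : ℂ) * Complex.I := fun ω => by
    conv_lhs => rw [← Complex.re_add_im (Y ω)]
    push_cast; ring
  rw [integral_congr_ae (ae_of_all _ hsplit), integral_add i1 (i2.mul_const _), integral_mul_const]
  have e1' : ∫ ω, (((Y ω).re * g ω : ℝ) : ℂ) ∂Pr = 0 := by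
    rw [integral_complex_ofReal]; rw [e1]; simp
  have e2' : ∫ ω, (((Y ω).im * g ω : ℝ) : ℂ) ∂Pr = 0 := by
    rw [integral_complex_ofReal]; rw [e2]; simp
  rw [e1', e2']; simp

/-- Test-function form of the conditional law of `X_{n+1}`. -/
lemma Walk.test (hB : BaseChain P μ) (hW : Walk P μ α γ Pr F X x) (n : ℕ)
    {φ : (Fin N → ℝ) → Fin N → Fin N → ℝ} (hφ : ∀ s l, Measurable (fun y => φ y s l))
    {B : ℝ} (hφB : ∀ y s l, |φ y s l| ≤ B)
    {Y : Ω → ℂ} (hY : Measurable[F n] Y) {C : ℝ} (hC : ∀ ω, ‖Y ω‖ ≤ C) :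
    ∫ ω, Y ω * ((φ (x n ω) (X n ω) (X (n + 1) ω) -
      ∑ l, srrwKernel P μ α (x n ω) (X n ω) l * φ (x n ω) (X n ω) l : ℝ) : ℂ) ∂Pr = 0 := by
  have hφm : ∀ l, Measurable[F n] (fun ω => φ (x n ω) (X n ω) l) := fun l =>
    meas_comp2 (g := fun y s => φ y s l) (fun s => hφ s l) (hW.xm n) (hW.Xm n)
  have hZm : ∀ l, Measurable[F n] (fun ω => Y ω * ((φ (x n ω) (X n ω) l : ℝ) : ℂ)) := fun l =>
    hY.mul (Complex.measurable_ofReal.comp (hφm l))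
  have hZb : ∀ l ω, ‖Y ω * ((φ (x n ω) (X n ω) l : ℝ) : ℂ)‖ ≤ C * B := fun l ω => by
    rw [norm_mul, Complex.norm_real]
    exact mul_le_mul (hC ω) (hφB _ _ _) (norm_nonneg _) ((norm_nonneg _).trans (hC ω))
  have hsum : ∀ ω, Y ω * ((φ (x n ω) (X n ω) (X (n + 1) ω) -
      ∑ l, srrwKernel P μ α (x n ω) (X n ω) l * φ (x n ω) (X n ω) l : ℝ) : ℂ) =
      ∑ l, (Y ω * ((φ (x n ω) (X n ω) l : ℝ) : ℂ)) *
        (((if X (n + 1) ω = l then (1 : ℝ) else 0) -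
          srrwKernel P μ α (x n ω) (X n ω) l : ℝ) : ℂ) := fun ω => by
    have : φ (x n ω) (X n ω) (X (n + 1) ω) -
      ∑ l, srrwKernel P μ α (x n ω) (X n ω) l * φ (x n ω) (X n ω) l =
      ∑ l, φ (x n ω) (X n ω) l * ((if X (n + 1) ω = l then (1 : ℝ) else 0) -
          srrwKernel P μ α (x n ω) (X n ω) l) := by
      simp only [mul_sub, Finset.sum_sub_distrib]
      congr 1
      · simp
      · exact Finset.sum_congr rfl fun l _ => mul_comm _ _
    rw [this, Complex.ofReal_sum, Finset.mul_sum]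
    refine Finset.sum_congr rfl fun l _ => ?_
    rw [Complex.ofReal_mul, mul_assoc]
  rw [integral_congr_ae (ae_of_all _ hsum), integral_finsetSum]
  · exact Finset.sum_eq_zero fun l _ => hW.test_complex hB n l (hZm l) (hZb l)
  · intro l _
    have hXm : Measurable (X (n + 1)) := (hW.Xm (n + 1)).mono (F.le _) le_rfl
    have hKm : Measurable (fun ω => srrwKernel P μ α (x n ω) (X n ω) l) :=
      meas_comp2 (g := fun y s => srrwKernel P μ α y s l) (fun s => kernel_meas s l)
        ((hW.xm n).mono (F.le _) le_rfl) ((hW.Xm n).mono (F.le _) le_rfl)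
    have hgm : Measurable (fun ω => (if X (n + 1) ω = l then (1 : ℝ) else 0) -
        srrwKernel P μ α (x n ω) (X n ω) l) :=
      (Measurable.ite (hXm (measurableSet_singleton l)) measurable_const measurable_const).sub hKm
    refine integrable_of_bdd (C := C * B * 1) (((hZm l).mono (F.le n) le_rfl).mul
      (Complex.measurable_ofReal.comp hgm)).aestronglyMeasurable fun ω => ?_
    rw [norm_mul, Complex.norm_real]
    refine mul_le_mul (hZb l ω) ?_ (norm_nonneg _) ((norm_nonneg _).trans (hZb l ω))
    have h1 := kernel_nonneg hB (hW.simp n ω).1 (X n ω) l (α := α)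
    have h2 := kernel_le_one hB (hW.simp n ω).1 (X n ω) l (α := α)
    rw [Real.norm_eq_abs, abs_le]; split_ifs <;> constructor <;> linarith

end walk

set_option linter.unusedSectionVars false
/-- Bounded conditionally centered increments. -/
structure Incr {N : ℕ} (P : Matrix (Fin N) (Fin N) ℝ) (μ : Fin N → ℝ) (α : ℝ)
    (φ : (Fin N → ℝ) → Fin N → Fin N → ℝ) (B : ℝ) : Prop where
  meas : ∀ s l, Measurable (fun y => φ y s l)
  nonneg : 0 ≤ B
  bdd : ∀ y s l, |φ y s l| ≤ B
  mean : ∀ y ∈ posO N, ∀ s, ∑ l, srrwKernel P μ α y s l * φ y s l = 0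

section incr
variable {N : ℕ} {P : Matrix (Fin N) (Fin N) ℝ} {μ : Fin N → ℝ} {α : ℝ} {γ : ℕ → ℝ} {τ : ℝ}
    {Ω : Type*} [mΩ : MeasurableSpace Ω] {Pr : Measure Ω} [IsProbabilityMeasure Pr]
    {F : Filtration ℕ mΩ} {X : ℕ → Ω → Fin N} {x : ℕ → Ω → (Fin N → ℝ)}
    {φ : (Fin N → ℝ) → Fin N → Fin N → ℝ} {B : ℝ}

lemma Walk.incr_meas (hW : Walk P μ α γ Pr F X x)
    (hφ : ∀ s l, Measurable (fun y => φ y s l)) (n : ℕ) :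
    Measurable[F (n + 1)] (fun ω => φ (x n ω) (X n ω) (X (n + 1) ω)) := by
  have h1 : ∀ l, Measurable[F (n + 1)] (fun ω => φ (x n ω) (X n ω) l) := fun l =>
    meas_comp2 (g := fun y s => φ y s l) (fun s => hφ s l)
      ((hW.xm n).mono (F.mono n.le_succ) le_rfl) ((hW.Xm n).mono (F.mono n.le_succ) le_rfl)
  have : (fun ω => φ (x n ω) (X n ω) (X (n + 1) ω)) =
      fun ω => ∑ l, if X (n + 1) ω = l then φ (x n ω) (X n ω) l else 0 := by
    funext ω; simp
  rw [this]
  exact Finset.measurable_sum _ fun s _ => Measurable.ite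
    (hW.Xm (n + 1) (measurableSet_singleton s)) (h1 s) measurable_const

lemma Walk.incr_mean (hB : BaseChain P μ) (hW : Walk P μ α γ Pr F X x) (hφ : Incr P μ α φ B)
    (n : ℕ) {Y : Ω → ℂ} (hY : Measurable[F n] Y) {C : ℝ} (hC : ∀ ω, ‖Y ω‖ ≤ C) :
    ∫ ω, Y ω * (φ (x n ω) (X n ω) (X (n + 1) ω) : ℂ) ∂Pr = 0 := by
  rw [← hW.test hB n hφ.meas hφ.bdd hY hC]
  refine integral_congr_ae (ae_of_all _ fun ω => ?_)
  simp only []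
  rw [hφ.mean _ (hW.simp n ω).1, sub_zero]

lemma Walk.incr_mean_real (hB : BaseChain P μ) (hW : Walk P μ α γ Pr F X x)
    (hφ : Incr P μ α φ B)
    (n : ℕ) {Y : Ω → ℝ} (hY : Measurable[F n] Y) {C : ℝ} (hC : ∀ ω, |Y ω| ≤ C) :
    ∫ ω, Y ω * φ (x n ω) (X n ω) (X (n + 1) ω) ∂Pr = 0 := by
  have h := hW.incr_mean hB hφ n (Complex.measurable_ofReal.comp hY) (C := C)
    (fun ω => by simpa using hC ω)
  have h2 : ∫ ω, ((Y ω * φ (x n ω) (X n ω) (X (n + 1) ω) : ℝ) : ℂ) ∂Pr = 0 := by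
    rw [← h]
    exact integral_congr_ae (ae_of_all _ fun ω => by simp)
  rw [integral_complex_ofReal] at h2
  exact_mod_cast h2

lemma Walk.mart_conv (hB : BaseChain P μ) (hγ : GammaSeq γ τ) (hW : Walk P μ α γ Pr F X x)
    (hφ : Incr P μ α φ B) :
    ∀ᵐ ω ∂Pr, ∃ c, Tendsto (fun n => ∑ k ∈ range n, γ (k + 1) *
      φ (x k ω) (X k ω) (X (k + 1) ω)) atTop (𝓝 c) := by
  set M : ℕ → Ω → ℝ := fun k ω => φ (x k ω) (X k ω) (X (k + 1) ω) with hM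
  set S : ℕ → Ω → ℝ := fun n ω => ∑ k ∈ range n, γ (k + 1) * M k ω with hS
  have hMm : ∀ k, Measurable[F (k + 1)] (M k) := fun k => hW.incr_meas hφ.meas k
  have hMb : ∀ k ω, |M k ω| ≤ B := fun k ω => hφ.bdd _ _ _
  have hSm : ∀ n, Measurable[F n] (S n) := fun n => Finset.measurable_sum _ fun k hk =>
    ((hMm k).mono (F.mono (Finset.mem_range.1 hk)) le_rfl).const_mul _
  have hSb : ∀ n ω, |S n ω| ≤ ∑ k ∈ range n, γ (k + 1) * B := fun n ω =>
    (Finset.abs_sum_le_sum_abs _ _).trans (Finset.sum_le_sum fun k _ => by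
      rw [abs_mul, abs_of_pos (hγ.pos _)]
      exact mul_le_mul_of_nonneg_left (hMb k ω) (hγ.pos _).le)
  have hSm' : ∀ n, Measurable (S n) := fun n => (hSm n).mono (F.le _) le_rfl
  have hMm' : ∀ n, Measurable (M n) := fun n => (hMm n).mono (F.le _) le_rfl
  have hSi : ∀ n, Integrable (S n) Pr := fun n =>
    integrable_of_bdd (hSm' n).aestronglyMeasurable (hSb n)
  have hMi : ∀ n, Integrable (M n) Pr := fun n =>
    integrable_of_bdd (hMm' n).aestronglyMeasurable (hMb n)
  have hsucc : ∀ n ω, S (n + 1) ω = S n ω + γ (n + 1) * M n ω := fun n ω =>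
    Finset.sum_range_succ _ _
  have hmart : Martingale S F Pr := by
    refine martingale_of_setIntegral_eq_succ (fun n => (hSm n).stronglyMeasurable) hSi ?_
    intro n s hs
    have h0 : ∫ ω in s, M n ω ∂Pr = 0 := by
      have h := hW.incr_mean_real hB hφ n (Y := s.indicator fun _ => (1 : ℝ))
        (measurable_const.indicator hs) (C := 1) (fun ω => by
          by_cases h : ω ∈ s <;> simp [h])
      rw [← integral_indicator (F.le n s hs), ← h]
      refine integral_congr_ae (ae_of_all _ fun ω => ?_)
      by_cases h : ω ∈ s <;> simp [h, hM]
    simp_rw [hsucc]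
    rw [integral_add (hSi n).integrableOn ((hMi n).const_mul _).integrableOn,
      integral_const_mul, h0, mul_zero, add_zero]
  have hsqi : ∀ n, Integrable (fun ω => S n ω ^ 2) Pr := fun n =>
    integrable_of_bdd (C := (∑ k ∈ range n, γ (k + 1) * B) ^ 2)
      ((hSm' n).pow_const 2).aestronglyMeasurable fun ω => by
        rw [norm_pow]; exact pow_le_pow_left₀ (norm_nonneg _) (hSb n ω) 2
  have hsq : ∀ n, ∫ ω, S n ω ^ 2 ∂Pr ≤ ∑ k ∈ range n, γ (k + 1) ^ 2 * B ^ 2 := by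
    intro n
    induction n with
    | zero => simp [hS]
    | succ n ih =>
      have h0 := hW.incr_mean_real hB hφ n (hSm n) (hSb n)
      have iSM : Integrable (fun ω => S n ω * M n ω) Pr :=
        integrable_of_bdd (C := (∑ k ∈ range n, γ (k + 1) * B) * B)
          ((hSm' n).mul (hMm' n)).aestronglyMeasurable fun ω => by
          rw [norm_mul]
          exact mul_le_mul (hSb n ω) (hMb n ω) (norm_nonneg _) ((abs_nonneg _).trans (hSb n ω))
      have iM2 : Integrable (fun ω => M n ω ^ 2) Pr :=
        integrable_of_bdd (C := B ^ 2) ((hMm' n).pow_const 2).aestronglyMeasurable fun ω => by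
          rw [norm_pow]; exact pow_le_pow_left₀ (norm_nonneg _) (hMb n ω) 2
      have hM2 : ∫ ω, M n ω ^ 2 ∂Pr ≤ B ^ 2 := by
        have := integral_mono iM2 (integrable_const (B ^ 2)) fun ω => by
          simp only []
          rw [← sq_abs]; exact pow_le_pow_left₀ (abs_nonneg _) (hMb n ω) 2
        simpa using this
      have he : ∀ ω, S (n + 1) ω ^ 2 = (S n ω ^ 2 + (2 * γ (n + 1)) * (S n ω * M n ω)) +
          γ (n + 1) ^ 2 * M n ω ^ 2 := fun ω => by rw [hsucc]; ring
      have iA : Integrable (fun ω => S n ω ^ 2 + (2 * γ (n + 1)) * (S n ω * M n ω)) Pr :=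
        (hsqi n).add (iSM.const_mul _)
      rw [integral_congr_ae (ae_of_all _ he), integral_add iA (iM2.const_mul _), integral_add (hsqi n) (iSM.const_mul _), integral_const_mul,
        integral_const_mul, Finset.sum_range_succ]
      have h0' : ∫ ω, S n ω * M n ω ∂Pr = 0 := h0
      rw [h0', mul_zero, add_zero]
      exact add_le_add ih (mul_le_mul_of_nonneg_left hM2 (sq_nonneg _))
  set D : ℝ := (∑' k, γ (k + 1) ^ 2) * B ^ 2 with hD
  have hsum1 : Summable fun k => γ (k + 1) ^ 2 := (summable_nat_add_iff 1).2 hγ.sq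
  have hSD : ∀ n, ∫ ω, S n ω ^ 2 ∂Pr ≤ D := fun n => (hsq n).trans (by
    rw [← Finset.sum_mul]
    exact mul_le_mul_of_nonneg_right (hsum1.sum_le_tsum _ fun k _ => sq_nonneg _) (sq_nonneg _))
  have hL1 : ∀ n, ∫ ω, ‖S n ω‖ ∂Pr ≤ 1 + D := fun n => by
    have h1 : ∫ ω, ‖S n ω‖ ∂Pr ≤ ∫ ω, (1 + S n ω ^ 2) ∂Pr :=
      integral_mono (hSi n).norm ((integrable_const _).add (hsqi n)) fun ω => by
        simp only [Real.norm_eq_abs]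
        rw [← sq_abs]; nlinarith [sq_nonneg (|S n ω| - 1), abs_nonneg (S n ω)]
    rw [integral_add (integrable_const _) (hsqi n)] at h1
    have h2 := hSD n
    simp at h1
    simp only [Real.norm_eq_abs]
    linarith
  refine hmart.submartingale.exists_ae_tendsto_of_bdd (R := (1 + D).toNNReal) fun n => ?_
  rw [eLpNorm_one_eq_lintegral_enorm, ← ofReal_integral_norm_eq_lintegral_enorm (hSi n)]
  exact ENNReal.ofReal_le_ofReal (hL1 n)

/-- The martingale increments attached to a Poisson equation, localized on a compact set. -/
def mInc (P : Matrix (Fin N) (Fin N) ℝ) (μ : Fin N → ℝ) (α m : ℝ) (f : Fin N → ℝ)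
    (y : Fin N → ℝ) (s l : Fin N) : ℝ :=
  (boxC N m).indicator (fun y => poisG P μ α f y l - poisU P μ α f y s) y

lemma mInc_of_mem {m : ℝ} {f : Fin N → ℝ} {y : Fin N → ℝ} (hy : y ∈ boxC N m) (s l : Fin N) :
    mInc P μ α m f y s l = poisG P μ α f y l - poisU P μ α f y s :=
  Set.indicator_of_mem hy _

lemma bdd_fin {f : (Fin N → ℝ) → Fin N → ℝ} {m : ℝ} (hm : 0 < m)
    (hf : ∀ i, ContDiffOn ℝ 1 (fun y => f y i) (posO N)) :
    ∃ L, 0 ≤ L ∧ ∀ y ∈ boxC N m, ∀ i, |f y i| ≤ L := by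
  choose L hL0 hL using fun i => bounded_of_contDiffOn (hf i) (boxC_compact hm) (boxC_posO hm)
  refine ⟨∑ i, L i, Finset.sum_nonneg fun i _ => hL0 i, fun y hy i => (hL i y hy).trans ?_⟩
  exact Finset.single_le_sum (fun j _ => hL0 j) (mem_univ i)

lemma lip_fin {f : (Fin N → ℝ) → Fin N → ℝ} {m : ℝ} (hm : 0 < m)
    (hf : ∀ i, ContDiffOn ℝ 1 (fun y => f y i) (posO N)) :
    ∃ L, 0 ≤ L ∧ ∀ y ∈ boxC N m, ∀ z ∈ boxC N m, ∀ i, |f y i - f z i| ≤ L * dist y z := by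
  choose L hL0 hL using fun i => lipschitz_of_contDiffOn (hf i) (boxC_compact hm) (boxC_posO hm)
  refine ⟨∑ i, L i, Finset.sum_nonneg fun i _ => hL0 i, fun y hy z hz i =>
    (hL i y hy z hz).trans (mul_le_mul_of_nonneg_right ?_ dist_nonneg)⟩
  exact Finset.single_le_sum (fun j _ => hL0 j) (mem_univ i)

lemma mInc_incr (hB : BaseChain P μ) {m : ℝ} (hm : 0 < m) (f : Fin N → ℝ) :
    ∃ B, Incr P μ α (mInc P μ α m f) B := by
  obtain ⟨L1, h1, hL1⟩ := bdd_fin (f := fun y i => poisG P μ α f y i) hm (poisG_contDiff hB f)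
  obtain ⟨L2, h2, hL2⟩ := bdd_fin (f := fun y i => poisU P μ α f y i) hm (poisU_contDiff hB f)
  refine ⟨L1 + L2, ⟨fun s l => ?_, by positivity, fun y s l => ?_, fun y hy s => ?_⟩⟩
  · exact ((poisG_meas f l).sub (poisU_meas f s)).indicator (boxC_closed N m).measurableSet
  · by_cases hy : y ∈ boxC N m
    · rw [mInc_of_mem hy]
      exact (abs_sub _ _).trans (add_le_add (hL1 y hy l) (hL2 y hy s))
    · rw [mInc, Set.indicator_of_notMem hy, abs_zero]; positivity
  · by_cases hym : y ∈ boxC N m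
    · simp_rw [mInc_of_mem hym, mul_sub, Finset.sum_sub_distrib, ← Finset.sum_mul]
      rw [kernel_sum hB hy, one_mul, poisU, sub_self]
    · simp [mInc, Set.indicator_of_notMem hym]

lemma Walk.dist_step (hγ : GammaSeq γ τ) (hW : Walk P μ α γ Pr F X x) (n : ℕ) (ω : Ω) :
    dist (x (n + 1) ω) (x n ω) ≤ γ (n + 1) := by
  have hx0 := (hW.simp n ω).1
  have hx1 : ∀ i, x n ω i ≤ 1 := fun i => by
    rw [← (hW.simp n ω).2]
    exact Finset.single_le_sum (f := x n ω) (fun j _ => (hx0 j).le) (mem_univ i)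
  rw [dist_pi_le_iff (hγ.pos _).le]
  intro i
  rw [hW.step, Real.dist_eq, Pi.add_apply, add_sub_cancel_left, Pi.smul_apply, smul_eq_mul,
    abs_mul, abs_of_pos (hγ.pos _)]
  refine mul_le_of_le_one_right (hγ.pos _).le ?_
  rw [Pi.sub_apply, abs_le]
  have := hx0 i; have := hx1 i
  by_cases h : i = X (n + 1) ω
  · subst h; simp; constructor <;> linarith
  · rw [Pi.single_eq_of_ne h]; constructor <;> linarith

/-- Deterministic part: decomposition of the noise by the Poisson equation. -/
lemma Walk.path_noise (hB : BaseChain P μ) (hγ : GammaSeq γ τ) (hW : Walk P μ α γ Pr F X x)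
    (f : Fin N → ℝ) {m : ℝ} (hm : 0 < m) {ω : Ω} (hω : ∀ n, x n ω ∈ boxC N m)
    (hc : ∃ c, Tendsto (fun n => ∑ k ∈ range n, γ (k + 1) *
      mInc P μ α m f (x k ω) (X k ω) (X (k + 1) ω)) atTop (𝓝 c)) :
    ∃ T, Tendsto (fun n => ∑ k ∈ range n, γ (k + 1) *
      (f (X (k + 1) ω) - ∑ j, piS P μ α (x k ω) j * f j)) atTop (𝓝 T) := by
  obtain ⟨c, hc⟩ := hc
  obtain ⟨L2, h2, hL2⟩ := bdd_fin (f := fun y i => poisU P μ α f y i) hm (poisU_contDiff hB f)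
  obtain ⟨L, hL0, hL⟩ := lip_fin (f := fun y i => poisU P μ α f y i) hm (poisU_contDiff hB f)
  obtain ⟨T, hT⟩ := hγ.telescope (u := fun n => poisU P μ α f (x n ω) (X n ω)) (B := L2)
    fun n => hL2 _ (hω n) _
  have hsum : Summable fun k => γ (k + 1) * (poisU P μ α f (x (k + 1) ω) (X (k + 1) ω) -
      poisU P μ α f (x k ω) (X (k + 1) ω)) := by
    refine Summable.of_norm_bounded (g := fun k => L * γ (k + 1) ^ 2)
      (((summable_nat_add_iff 1).2 hγ.sq).mul_left L) fun k => ?_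
    rw [norm_mul, Real.norm_eq_abs, abs_of_pos (hγ.pos _), Real.norm_eq_abs]
    have a1 := hL _ (hω (k + 1)) _ (hω k) (X (k + 1) ω)
    have a2 := mul_le_mul_of_nonneg_left (hW.dist_step hγ k ω) hL0
    calc _ ≤ γ (k + 1) * (L * γ (k + 1)) := mul_le_mul_of_nonneg_left (a1.trans a2) (hγ.pos _).le
      _ = _ := by ring
  have h3 := (hc.add hT).add hsum.hasSum.tendsto_sum_nat
  refine ⟨_, h3.congr fun n => ?_⟩
  rw [← Finset.sum_add_distrib, ← Finset.sum_add_distrib]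
  refine Finset.sum_congr rfl fun k _ => ?_
  rw [mInc_of_mem (hω k)]
  have := poisson_eq (α := α) hB (boxC_posO hm (hω k)) f (X (k + 1) ω)
  rw [← this]; ring

lemma Walk.ae_box (hW : Walk P μ α γ Pr F X x) :
    ∀ᵐ ω ∂Pr, ∃ q : ℕ, ∀ n, x n ω ∈ boxC N (1 / ((q : ℝ) + 1)) := by
  filter_upwards [hW.stable] with ω hω
  obtain ⟨C, hC, hCs, hxC⟩ := hω
  have h1 : ∀ i, ∃ δ : ℝ, 0 < δ ∧ ∀ y ∈ C, δ ≤ y i := fun i => by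
    obtain ⟨y, hy, hmin⟩ := hC.exists_isMinOn ⟨_, hxC 0⟩ (continuous_apply i).continuousOn
    exact ⟨y i, (hCs hy).1 i, fun z hz => hmin hz⟩
  choose δ hδ0 hδ using h1
  have h2 : ∃ q : ℕ, ∀ i, 1 / ((q : ℝ) + 1) ≤ δ i := by
    have := tendsto_one_div_add_atTop_nhds_zero_nat (𝕜 := ℝ)
    have h3 : ∀ᶠ q : ℕ in atTop, ∀ i, 1 / ((q : ℝ) + 1) ≤ δ i := by
      rw [eventually_all]
      intro i
      filter_upwards [this.eventually (gt_mem_nhds (hδ0 i))] with q hq using hq.le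
    exact h3.exists
  obtain ⟨q, hq⟩ := h2
  exact ⟨q, fun n => ⟨fun i => (hq i).trans (hδ i _ (hxC n)), (hW.simp n ω).2⟩⟩

lemma Walk.noise_conv (hB : BaseChain P μ) (hγ : GammaSeq γ τ) (hW : Walk P μ α γ Pr F X x)
    (f : Fin N → ℝ) :
    ∀ᵐ ω ∂Pr, ∃ T, Tendsto (fun n => ∑ k ∈ range n, γ (k + 1) *
      (f (X (k + 1) ω) - ∑ j, piS P μ α (x k ω) j * f j)) atTop (𝓝 T) := by
  have h1 : ∀ᵐ ω ∂Pr, ∀ q : ℕ, ∃ c, Tendsto (fun n => ∑ k ∈ range n, γ (k + 1) *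
      mInc P μ α (1 / ((q : ℝ) + 1)) f (x k ω) (X k ω) (X (k + 1) ω)) atTop (𝓝 c) := by
    rw [ae_all_iff]
    intro q
    obtain ⟨B, hBi⟩ := mInc_incr (α := α) hB (m := 1 / ((q : ℝ) + 1)) (by positivity) f
    exact hW.mart_conv hB hγ hBi
  filter_upwards [h1, hW.ae_box] with ω h1 h2
  obtain ⟨q, hq⟩ := h2
  exact hW.path_noise hB hγ f (by positivity) hq (h1 q)

lemma Walk.noise_conv' (hB : BaseChain P μ) (hγ : GammaSeq γ τ) (hW : Walk P μ α γ Pr F X x)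
    (f : Fin N → ℝ) :
    ∀ᵐ ω ∂Pr, ∃ T, Tendsto (fun n => ∑ k ∈ range n, γ (k + 1) *
      (f (X k ω) - ∑ j, piS P μ α (x k ω) j * f j)) atTop (𝓝 T) := by
  filter_upwards [hW.noise_conv hB hγ f] with ω h1
  obtain ⟨T, hT⟩ := h1
  obtain ⟨T2, hT2⟩ := hγ.telescope (u := fun n => f (X n ω)) (B := ∑ j, |f j|) fun n =>
    Finset.single_le_sum (f := fun j => |f j|) (fun j _ => abs_nonneg _) (mem_univ _)
  refine ⟨_, (hT.add hT2).congr fun n => ?_⟩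
  rw [← Finset.sum_add_distrib]
  exact Finset.sum_congr rfl fun k _ => by ring

/-- Almost sure convergence `x_n → μ`. -/
lemma Walk.ae_tendsto (hB : BaseChain P μ) (hα : 0 ≤ α) (hγ : GammaSeq γ τ)
    (hW : Walk P μ α γ Pr F X x) :
    ∀ᵐ ω ∂Pr, Tendsto (fun n => x n ω) atTop (𝓝 μ) := by
  have h1 : ∀ᵐ ω ∂Pr, ∀ i : Fin N, ∃ T, Tendsto (fun n => ∑ k ∈ range n, γ (k + 1) *
      ((Pi.single i (1 : ℝ) : Fin N → ℝ) (X (k + 1) ω) -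
        ∑ j, piS P μ α (x k ω) j * (Pi.single i (1 : ℝ) : Fin N → ℝ) j)) atTop (𝓝 T) := by
    rw [ae_all_iff]
    intro i
    exact hW.noise_conv hB hγ _
  filter_upwards [h1, hW.ae_box] with ω h1 h2
  obtain ⟨q, hq⟩ := h2
  refine path_conv hB hα hγ (fun n => x n ω) (fun n => X n ω) (fun n => hW.simp n ω)
    (fun n => hW.step n ω) (m0 := 1 / ((q : ℝ) + 1)) (by positivity) (fun n i => (hq n).1 i) ?_
  intro i
  obtain ⟨T, hT⟩ := h1 i
  refine ⟨T, hT.congr fun n => Finset.sum_congr rfl fun k _ => ?_⟩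
  congr 2
  · simp only [Pi.single_apply, eq_comm]
  · simp [Pi.single_apply]

end incr

/-! ### Normalized weights of the linear recursion -/

/-- `γ_n^{-1/2} γ_{k+1} ∏_{k<j<n} (1 - β γ_{j+1})`. -/
def cf (γ : ℕ → ℝ) (β : ℝ) (n k : ℕ) : ℝ :=
  (√(γ n))⁻¹ * (γ (k + 1) * ∏ j ∈ Ico (k + 1) n, (1 - β * γ (j + 1)))

/-- `(γ_n/γ_{n+1} - 1)/γ_{n+1}` -/
def rhoR (γ : ℕ → ℝ) (n : ℕ) : ℝ := (γ n / γ (n + 1) - 1) / γ (n + 1)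

/-- The contraction rate in the recursion for products of weights. -/
def cnR (γ : ℕ → ℝ) (β β' : ℝ) (n : ℕ) : ℝ :=
  (β + β') - rhoR γ n - β * β' * γ (n + 1) + rhoR γ n * (β + β') * γ (n + 1)
    - rhoR γ n * (β * β') * γ (n + 1) ^ 2

section weights
variable {γ : ℕ → ℝ} {τ : ℝ}

lemma cf_succ (hγ : GammaSeq γ τ) (β : ℝ) {n k : ℕ} (hk : k < n) :
    cf γ β (n + 1) k = (√(γ n) / √(γ (n + 1))) * (1 - β * γ (n + 1)) * cf γ β n k := by
  have h1 : √(γ n) ≠ 0 := (Real.sqrt_pos.2 (hγ.pos n)).ne'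
  have h2 : √(γ (n + 1)) ≠ 0 := (Real.sqrt_pos.2 (hγ.pos _)).ne'
  rw [cf, cf, Finset.prod_Ico_succ_top (by omega)]
  field_simp

lemma cf_diag (hγ : GammaSeq γ τ) (β : ℝ) (n : ℕ) : cf γ β (n + 1) n = √(γ (n + 1)) := by
  have h2 : √(γ (n + 1)) ≠ 0 := (Real.sqrt_pos.2 (hγ.pos _)).ne'
  rw [cf, Finset.Ico_self, Finset.prod_empty, mul_one]
  have := Real.mul_self_sqrt (hγ.pos (n + 1)).le
  field_simp
  rw [sq, this]

lemma sqrt_ratio (hγ : GammaSeq γ τ) (n : ℕ) :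
    (√(γ n) / √(γ (n + 1))) ^ 2 = γ n / γ (n + 1) := by
  rw [div_pow, Real.sq_sqrt (hγ.pos _).le, Real.sq_sqrt (hγ.pos _).le]

lemma fac_eq (hγ : GammaSeq γ τ) (β β' : ℝ) (n : ℕ) :
    γ n / γ (n + 1) * (1 - β * γ (n + 1)) * (1 - β' * γ (n + 1)) =
      1 - cnR γ β β' n * γ (n + 1) := by
  rw [hγ.ratio_eq n, cnR, rhoR]; ring

lemma cnR_lim (hγ : GammaSeq γ τ) (β β' : ℝ) :
    Tendsto (cnR γ β β') atTop (𝓝 (β + β' - τ)) := by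
  have h1 : Tendsto (rhoR γ) atTop (𝓝 τ) := hγ.ratio
  have h2 : Tendsto (fun n => γ (n + 1)) atTop (𝓝 0) := hγ.step.lim
  have := (((tendsto_const_nhds (x := β + β')).sub h1).sub (h2.const_mul (β * β'))).add
    ((h1.mul_const (β + β')).mul h2) |>.sub ((h1.mul_const (β * β')).mul (h2.pow 2))
  refine this.congr' (Eventually.of_forall fun n => by rw [cnR]) |>.trans_eq ?_
  simp

lemma wsum_succ (hγ : GammaSeq γ τ) (β β' : ℝ) (q : ℕ → ℝ) (n : ℕ) :
    ∑ k ∈ range (n + 1), cf γ β (n + 1) k * cf γ β' (n + 1) k * q k =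
      (1 - cnR γ β β' n * γ (n + 1)) * ∑ k ∈ range n, cf γ β n k * cf γ β' n k * q k +
        γ (n + 1) * q n := by
  rw [Finset.sum_range_succ, cf_diag hγ, cf_diag hγ, Real.mul_self_sqrt (hγ.pos _).le,
    Finset.mul_sum]
  congr 1
  refine Finset.sum_congr rfl fun k hk => ?_
  rw [cf_succ hγ β (Finset.mem_range.1 hk), cf_succ hγ β' (Finset.mem_range.1 hk), ← fac_eq hγ,
    ← sqrt_ratio hγ]
  ring

lemma wsum_lim (hγ : GammaSeq γ τ) {β β' : ℝ} (hβ : 1 ≤ β) (hβ' : 1 ≤ β') {q ε e : ℕ → ℝ}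
    {qb T : ℝ} (hq : ∀ n, q n = qb + ε n + e n) (hε : Tendsto ε atTop (𝓝 0))
    (hT : Tendsto (fun n => ∑ k ∈ range n, γ (k + 1) * e k) atTop (𝓝 T)) :
    Tendsto (fun n => ∑ k ∈ range n, cf γ β n k * cf γ β' n k * q k) atTop
      (𝓝 (qb / (β + β' - τ))) := by
  have hc : 0 < β + β' - τ := by have := hγ.tau_le; linarith
  set c := β + β' - τ with hcdef
  set W : ℕ → ℝ := fun n => ∑ k ∈ range n, cf γ β n k * cf γ β' n k * q k with hW
  have hcn : Tendsto (cnR γ β β') atTop (𝓝 c) := cnR_lim hγ β β'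
  have h := recursion_noise hγ.step (r := fun n => W n - qb / c)
    (ε := fun n => (qb - cnR γ β β' n * (qb / c)) + ε n) (e := e) hc hcn ?_ hT ?_
  · have := h.add_const (qb / c)
    simpa using this
  · have h1 := (hcn.mul_const (qb / c)).const_sub qb
    have h2 := h1.add hε
    have h3 : qb - c * (qb / c) + 0 = 0 := by field_simp; ring
    rwa [h3] at h2
  · intro n
    have := wsum_succ hγ β β' q n
    simp only [hW]
    rw [this, hq n]; ring

lemma wsum4_lim (hγ : GammaSeq γ τ) {β : ℝ} (hβ : 1 ≤ β) :
    Tendsto (fun n => ∑ k ∈ range n, cf γ β n k ^ 4) atTop (𝓝 0) := by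
  have hc : 0 < β + β - τ := by have := hγ.tau_le; linarith
  set c := β + β - τ with hcdef
  have hcn : Tendsto (cnR γ β β) atTop (𝓝 c) := cnR_lim hγ β β
  have h2 : Tendsto (fun n => γ (n + 1)) atTop (𝓝 0) := hγ.step.lim
  refine recursion_noise hγ.step (c := 2 * c) (cn := fun n => 2 * cnR γ β β n -
    γ (n + 1) * cnR γ β β n ^ 2) (ε := fun n => γ (n + 1)) (e := fun _ => 0) (T := 0)
    (by linarith) ?_ h2 (by simp) ?_
  · have := (hcn.const_mul 2).sub (h2.mul (hcn.pow 2))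
    simpa using this
  · intro n
    rw [Finset.sum_range_succ, cf_diag hγ, Finset.mul_sum]
    congr 1
    · refine Finset.sum_congr rfl fun k hk => ?_
      rw [cf_succ hγ β (Finset.mem_range.1 hk)]
      have h1 := fac_eq hγ β β n
      rw [← sqrt_ratio hγ] at h1
      calc _ = ((√(γ n) / √(γ (n + 1))) ^ 2 * (1 - β * γ (n + 1)) * (1 - β * γ (n + 1))) ^ 2
            * cf γ β n k ^ 4 := by ring
        _ = _ := by rw [h1]; ring
    · have := Real.sq_sqrt (hγ.pos (n + 1)).le
      calc _ = (√(γ (n + 1)) ^ 2) ^ 2 := by ring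
        _ = _ := by rw [this]; ring

end weights

/-! ### Eigenstructure -/

/-- Right eigenvectors of `P`, orthonormal and complete in `ℓ²(μ)` modulo constants. -/
structure Eig {N : ℕ} {ι : Type*} [Fintype ι] [DecidableEq ι] (P : Matrix (Fin N) (Fin N) ℝ)
    (μ : Fin N → ℝ) (lam : ι → ℝ) (v : ι → Fin N → ℝ) : Prop where
  lt : ∀ i, -1 < lam i ∧ lam i < 1
  eig : ∀ i k, ∑ j, P k j * v i j = lam i * v i k
  mean : ∀ i, ∑ k, μ k * v i k = 0
  orth : ∀ i j, ∑ k, μ k * (v i k * v j k) = if i = j then 1 else 0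
  complete : ∀ θ : Fin N → ℝ, ∑ k, θ k = 0 → ∀ a, θ a = ∑ i, (μ a * v i a) * ∑ b, v i b * θ b

lemma eig_of {N : ℕ} (hN : 2 ≤ N) {P : Matrix (Fin N) (Fin N) ℝ} {μ : Fin N → ℝ}
    (hB : BaseChain P μ) (lam : Fin (N - 1) → ℝ) (u : Fin (N - 1) → (Fin N → ℝ))
    (hlam : ∀ i, -1 < lam i ∧ lam i < 1)
    (hu_eig : ∀ i, Pᵀ *ᵥ u i = lam i • u i)
    (hu_sum : ∀ i, ∑ j, u i j = 0)
    (hu_norm : ∀ i, ∑ j, (u i j) ^ 2 / μ j = 1)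
    (hu_orth : ∀ i i', i ≠ i' → ∑ j, u i j * u i' j / μ j = 0) :
    Eig P μ lam (fun i j => u i j / μ j) := by
  have hμ : ∀ j, μ j ≠ 0 := fun j => (hB.mu_pos j).ne'
  have horth : ∀ i j, ∑ k, μ k * (u i k / μ k * (u j k / μ k)) = if i = j then 1 else 0 := by
    intro i j
    have h1 : ∀ k, μ k * (u i k / μ k * (u j k / μ k)) = u i k * u j k / μ k := fun k => by
      have := hμ k; field_simp
    simp_rw [h1]
    split_ifs with h
    · subst h; rw [← hu_norm i]; exact Finset.sum_congr rfl fun k _ => by rw [sq]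
    · exact hu_orth i j h
  have hmean : ∀ i, ∑ k, μ k * (u i k / μ k) = 0 := fun i => by
    rw [← hu_sum i]; exact Finset.sum_congr rfl fun k _ => by have := hμ k; field_simp
  refine ⟨hlam, fun i k => ?_, hmean, horth, fun θ hθ a => ?_⟩
  · have h1 := congrFun (hu_eig i) k
    simp only [Matrix.mulVec, dotProduct, Matrix.transpose_apply, Pi.smul_apply, smul_eq_mul] at h1
    have h2 : ∀ j, P k j * (u i j / μ j) = (P j k * u i j) / μ k := fun j => by
      have := hμ k; have := hμ j; have := hB.rev k j
      field_simp; linear_combination u i j * this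
    simp_rw [h2]
    rw [← Finset.sum_div, h1]; ring
  · set A : Matrix (Option (Fin (N - 1))) (Fin N) ℝ :=
      Matrix.of fun o b => o.elim 1 fun i => u i b / μ b with hA
    set Bm : Matrix (Fin N) (Option (Fin (N - 1))) ℝ :=
      Matrix.of fun b o => o.elim (μ b) fun i => u i b with hBm
    have hAB : A * Bm = 1 := by
      ext o o'
      rw [Matrix.mul_apply]
      rcases o with _ | i <;> rcases o' with _ | j
      · simp [hA, hBm, hB.mu_sum]
      · simp [hA, hBm, hu_sum]
      · simp only [hA, hBm, Matrix.of_apply, Option.elim]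
        rw [Matrix.one_apply_ne (by simp), ← hmean i]
        exact Finset.sum_congr rfl fun k _ => mul_comm _ _
      · simp only [hA, hBm, Matrix.of_apply, Option.elim]
        rw [Matrix.one_apply]
        simp only [Option.some.injEq]
        rw [← horth i j]
        exact Finset.sum_congr rfl fun k _ => by have := hμ k; field_simp
    have hBA : Bm * A = 1 := by
      refine (Matrix.mul_eq_one_comm_of_card_eq _ _ _ ?_).1 hAB
      simp; omega
    have h3 : (Bm * A) *ᵥ θ = θ := by rw [hBA, Matrix.one_mulVec]
    rw [← Matrix.mulVec_mulVec] at h3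
    have h4 := congrFun h3 a
    rw [Matrix.mulVec, dotProduct, Fintype.sum_option] at h4
    simp only [hA, hBm, Matrix.mulVec, dotProduct, Matrix.of_apply, Option.elim, one_mul, hθ,
      mul_zero, zero_add] at h4
    rw [← h4]
    refine Finset.sum_congr rfl fun i _ => ?_
    have := hμ a
    rw [mul_div_cancel₀ _ this]

/-! ### The martingale CLT for the linear recursion -/

/-- Conditional covariances of the martingale increments. -/
def covQ {N : ℕ} (P : Matrix (Fin N) (Fin N) ℝ) (μ : Fin N → ℝ) (α m : ℝ) (f g : Fin N → ℝ)
    (y : Fin N → ℝ) (s : Fin N) : ℝ :=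
  ∑ l, srrwKernel P μ α y s l * (mInc P μ α m f y s l * mInc P μ α m g y s l)

/-- The normalized linear recursion `γ_n^{-1/2} r_n`. -/
def linR {N : ℕ} (P : Matrix (Fin N) (Fin N) ℝ) (μ : Fin N → ℝ) (α : ℝ) (γ : ℕ → ℝ) (m : ℝ)
    (β : ℝ) (f : Fin N → ℝ) {Ω : Type*} (X : ℕ → Ω → Fin N) (x : ℕ → Ω → (Fin N → ℝ))
    (n : ℕ) (ω : Ω) : ℝ :=
  ∑ k ∈ range n, cf γ β n k * mInc P μ α m f (x k ω) (X k ω) (X (k + 1) ω)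

section clt
variable {N : ℕ} {P : Matrix (Fin N) (Fin N) ℝ} {μ : Fin N → ℝ} {α : ℝ} {γ : ℕ → ℝ} {τ : ℝ}
    {Ω : Type*} [mΩ : MeasurableSpace Ω] {Pr : Measure Ω} [IsProbabilityMeasure Pr]
    {F : Filtration ℕ mΩ} {X : ℕ → Ω → Fin N} {x : ℕ → Ω → (Fin N → ℝ)}
    {ι : Type*} [Fintype ι] [DecidableEq ι] {lam : ι → ℝ} {v : ι → Fin N → ℝ} {m : ℝ}

lemma mu_mem_box (hB : BaseChain P μ) (hmμ : ∀ i, m < μ i) : μ ∈ boxC N m :=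
  ⟨fun i => (hmμ i).le, hB.mu_sum⟩

lemma ev_box (hmμ : ∀ i, m < μ i) {y : ℕ → Fin N → ℝ} (hy : Tendsto y atTop (𝓝 μ))
    (hys : ∀ n, y n ∈ intSimplex N) : ∀ᶠ n in atTop, y n ∈ boxC N m := by
  have h1 : ∀ᶠ n in atTop, ∀ i, m ≤ y n i := by
    rw [eventually_all]
    intro i
    have := (tendsto_pi_nhds.1 hy i).eventually (lt_mem_nhds (hmμ i))
    filter_upwards [this] with n hn using hn.le
  filter_upwards [h1] with n hn using ⟨hn, (hys n).2⟩

lemma contDiffOn_tendsto (hB : BaseChain P μ) {f : (Fin N → ℝ) → ℝ}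
    (hf : ContDiffOn ℝ 1 f (posO N))
    {y : ℕ → Fin N → ℝ} (hy : Tendsto y atTop (𝓝 μ)) :
    Tendsto (fun n => f (y n)) atTop (𝓝 (f μ)) :=
  ((hf.continuousOn.continuousAt ((posO_open N).mem_nhds (mu_mem_posO hB))).tendsto).comp hy

lemma mInc_tendsto (hB : BaseChain P μ) (hmμ : ∀ i, m < μ i) (f : Fin N → ℝ)
    {y : ℕ → Fin N → ℝ} (hy : Tendsto y atTop (𝓝 μ))
    (hys : ∀ n, y n ∈ intSimplex N) (s l : Fin N) :
    Tendsto (fun n => mInc P μ α m f (y n) s l) atTop (𝓝 (mInc P μ α m f μ s l)) := by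
  rw [mInc_of_mem (mu_mem_box hB hmμ)]
  have h := (contDiffOn_tendsto hB (poisG_contDiff (α := α) hB f l) hy).sub
    (contDiffOn_tendsto hB (poisU_contDiff (α := α) hB f s) hy)
  refine h.congr' ?_
  filter_upwards [ev_box hmμ hy hys] with n hn
  rw [mInc_of_mem hn]

lemma covQ_tendsto (hB : BaseChain P μ) (hmμ : ∀ i, m < μ i) (f g : Fin N → ℝ)
    {y : ℕ → Fin N → ℝ} (hy : Tendsto y atTop (𝓝 μ))
    (hys : ∀ n, y n ∈ intSimplex N) (s : Fin N) :
    Tendsto (fun n => covQ P μ α m f g (y n) s) atTop (𝓝 (covQ P μ α m f g μ s)) :=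
  tendsto_finsetSum _ fun l _ => (contDiffOn_tendsto hB (kernel_contDiff hB s l) hy).mul
    ((mInc_tendsto hB hmμ f hy hys s l).mul (mInc_tendsto hB hmμ g hy hys s l))

lemma mInc_mu (hB : BaseChain P μ) (hE : Eig P μ lam v) (hmμ : ∀ i, m < μ i) (i : ι)
    (s l : Fin N) :
    mInc P μ α m (v i) μ s l = (v i l - lam i * v i s) / (1 - lam i) := by
  have hl : 1 - lam i ≠ 0 := by have := (hE.lt i).2; linarith
  have hG : poisG P μ α (v i) μ = fun k => v i k / (1 - lam i) := by
    refine poisG_unique hB (mu_mem_posO hB) (funext fun k => ?_)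
    rw [poisA_mulVec hB]
    simp_rw [kernel_mu hB, piS_mu hB, ← mul_div_assoc]
    rw [← Finset.sum_div, ← Finset.sum_div, hE.eig, hE.mean]
    field_simp; ring
  rw [mInc_of_mem (mu_mem_box hB hmμ), poisU, hG]
  simp_rw [kernel_mu hB, ← mul_div_assoc]
  rw [← Finset.sum_div, hE.eig]
  field_simp

lemma covQ_mean (hB : BaseChain P μ) (hE : Eig P μ lam v) (hmμ : ∀ i, m < μ i) (i j : ι) :
    ∑ s, μ s * covQ P μ α m (v i) (v j) μ s =
      if i = j then (1 + lam i) / (1 - lam i) else 0 := by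
  have hli : 1 - lam i ≠ 0 := by have := (hE.lt i).2; linarith
  have hlj : 1 - lam j ≠ 0 := by have := (hE.lt j).2; linarith
  have h1 : ∀ s, covQ P μ α m (v i) (v j) μ s =
      ((∑ l, P s l * (v i l * v j l)) - lam i * lam j * (v i s * v j s)) /
        ((1 - lam i) * (1 - lam j)) := fun s => by
    rw [covQ]
    simp_rw [mInc_mu hB hE hmμ, kernel_mu hB]
    have e1 : ∀ l, P s l * ((v i l - lam i * v i s) / (1 - lam i) *
        ((v j l - lam j * v j s) / (1 - lam j))) =
        (P s l * (v i l * v j l) - (lam i * v i s) * (P s l * v j l) -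
          (lam j * v j s) * (P s l * v i l) + (lam i * v i s * (lam j * v j s)) * P s l) /
          ((1 - lam i) * (1 - lam j)) := fun l => by field_simp; ring
    simp_rw [e1]
    rw [← Finset.sum_div, Finset.sum_add_distrib, Finset.sum_sub_distrib, Finset.sum_sub_distrib,
      ← Finset.mul_sum, ← Finset.mul_sum, ← Finset.mul_sum, hE.eig, hE.eig, hB.rowsum]
    congr 1; ring
  have h2 : ∑ s, μ s * ∑ l, P s l * (v i l * v j l) = ∑ l, μ l * (v i l * v j l) := by
    simp_rw [Finset.mul_sum]
    rw [Finset.sum_comm]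
    refine Finset.sum_congr rfl fun l _ => ?_
    have : ∀ s, μ s * (P s l * (v i l * v j l)) = P l s * (μ l * (v i l * v j l)) := fun s => by
      rw [← mul_assoc, hB.rev s l]; ring
    simp_rw [this]
    rw [← Finset.sum_mul, hB.rowsum, one_mul]
  simp_rw [h1, ← mul_div_assoc, mul_sub]
  rw [← Finset.sum_div, Finset.sum_sub_distrib, h2]
  have h3 : ∀ s, μ s * (lam i * lam j * (v i s * v j s)) =
      lam i * lam j * (μ s * (v i s * v j s)) := fun s => by ring
  simp_rw [h3]
  rw [← Finset.mul_sum, hE.orth]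
  split_ifs with h
  · subst h; field_simp; ring
  · simp

lemma Walk.cov_conv (hB : BaseChain P μ) (hα : 0 ≤ α) (hγ : GammaSeq γ τ)
    (hW : Walk P μ α γ Pr F X x) (hE : Eig P μ lam v) (hmμ : ∀ i, m < μ i) (i j : ι)
    {βi βj : ℝ} (hβi : 1 ≤ βi) (hβj : 1 ≤ βj) :
    ∀ᵐ ω ∂Pr, Tendsto (fun n => ∑ k ∈ range n, cf γ βi n k * cf γ βj n k *
      covQ P μ α m (v i) (v j) (x k ω) (X k ω)) atTop
      (𝓝 ((if i = j then (1 + lam i) / (1 - lam i) else 0) / (βi + βj - τ))) := by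
  set f := covQ P μ α m (v i) (v j) μ with hf
  filter_upwards [hW.ae_tendsto hB hα hγ, hW.noise_conv' hB hγ f] with ω hx hT
  obtain ⟨T, hT⟩ := hT
  rw [← covQ_mean (α := α) hB hE hmμ i j]
  refine wsum_lim hγ hβi hβj (ε := fun n =>
    (covQ P μ α m (v i) (v j) (x n ω) (X n ω) - f (X n ω)) +
      (∑ s, piS P μ α (x n ω) s * f s - ∑ s, μ s * f s))
    (e := fun n => f (X n ω) - ∑ s, piS P μ α (x n ω) s * f s) (T := T) (fun n => ?_) ?_ hT
  · simp only [hf]; ring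
  · have h1 : Tendsto (fun n => covQ P μ α m (v i) (v j) (x n ω) (X n ω) - f (X n ω))
        atTop (𝓝 0) := by
      have h2 : Tendsto (fun n => ∑ s, |covQ P μ α m (v i) (v j) (x n ω) s - f s|)
          atTop (𝓝 0) := by
        have : Tendsto (fun n => ∑ s, |covQ P μ α m (v i) (v j) (x n ω) s - f s|)
          atTop (𝓝 (∑ s, |f s - f s|)) := tendsto_finsetSum _ fun s _ =>
            ((covQ_tendsto hB hmμ (v i) (v j) hx (fun n => hW.simp n ω) s).sub_const _).abs
        simpa using this
      refine squeeze_zero_norm (fun n => ?_) h2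
      exact Finset.single_le_sum (f := fun s => |covQ P μ α m (v i) (v j) (x n ω) s - f s|)
        (fun s _ => abs_nonneg _) (mem_univ (X n ω))
    have h3 : Tendsto (fun n => ∑ s, piS P μ α (x n ω) s * f s - ∑ s, μ s * f s)
        atTop (𝓝 0) := by
      have : Tendsto (fun n => ∑ s, piS P μ α (x n ω) s * f s) atTop
          (𝓝 (∑ s, piS P μ α μ s * f s)) := tendsto_finsetSum _ fun s _ =>
        (contDiffOn_tendsto hB (piS_contDiff hB s) hx).mul_const _
      simp_rw [piS_mu hB] at this
      have := this.sub_const (∑ s, μ s * f s)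
      simpa using this
    simpa using h1.add h3

/-- A common bound for all increments. -/
lemma mInc_common (hB : BaseChain P μ) (hm : 0 < m) (v : ι → Fin N → ℝ) :
    ∃ B, 0 ≤ B ∧ ∀ i, Incr P μ α (mInc P μ α m (v i)) B := by
  choose b hb using fun i => mInc_incr (α := α) hB hm (v i)
  refine ⟨∑ i, b i, Finset.sum_nonneg fun i _ => (hb i).nonneg, fun i =>
    ⟨(hb i).meas, Finset.sum_nonneg fun i _ => (hb i).nonneg, fun y s l =>
      ((hb i).bdd y s l).trans ?_, (hb i).mean⟩⟩
  exact Finset.single_le_sum (f := b) (fun j _ => (hb j).nonneg) (mem_univ i)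

lemma Walk.lin_clt (hB : BaseChain P μ) (hα : 0 ≤ α) (hγ : GammaSeq γ τ)
    (hW : Walk P μ α γ Pr F X x) (hE : Eig P μ lam v) (hm : 0 < m) (hmμ : ∀ i, m < μ i)
    {β : ι → ℝ} (hβ : ∀ i, 1 ≤ β i) (s : ι → ℝ) :
    Tendsto (fun n => ∫ ω, Complex.exp (Complex.I *
      ((∑ i, s i * linR P μ α γ m (β i) (v i) X x n ω : ℝ) : ℂ)) ∂Pr) atTop
      (𝓝 (Complex.exp ((-(∑ i, s i ^ 2 * ((1 + lam i) / (1 - lam i) / (β i + β i - τ))) / 2 : ℝ) :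
        ℂ))) := by
  obtain ⟨B, hB0, hInc⟩ := mInc_common (α := α) hB hm v
  set ψ : ℕ → ℕ → (Fin N → ℝ) → Fin N → Fin N → ℝ := fun n k y t l =>
    ∑ i, s i * cf γ (β i) n k * mInc P μ α m (v i) y t l with hψ
  set p : ℕ → ℕ → ℝ := fun n k => ∑ i, |s i| * |cf γ (β i) n k| * B with hp
  have hp0 : ∀ n k, 0 ≤ p n k := fun n k => Finset.sum_nonneg fun i _ => by positivity
  have hψb : ∀ n k y t l, |ψ n k y t l| ≤ p n k := fun n k y t l =>
    (Finset.abs_sum_le_sum_abs _ _).trans (Finset.sum_le_sum fun i _ => by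
      rw [abs_mul, abs_mul]
      exact mul_le_mul_of_nonneg_left ((hInc i).bdd y t l) (by positivity))
  have hψm : ∀ n k t l, Measurable (fun y => ψ n k y t l) := fun n k t l =>
    Finset.measurable_sum _ fun i _ => ((hInc i).meas t l).const_mul _
  have hψI : ∀ n k, Incr P μ α (ψ n k) (p n k) := fun n k =>
    ⟨hψm n k, hp0 n k, hψb n k, fun y hy t => by
      simp only [hψ, Finset.mul_sum]
      rw [Finset.sum_comm]
      refine Finset.sum_eq_zero fun i _ => ?_
      have := (hInc i).mean y hy t
      calc _ = s i * cf γ (β i) n k *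
            ∑ l, srrwKernel P μ α y t l * mInc P μ α m (v i) y t l := by
            rw [Finset.mul_sum]; exact Finset.sum_congr rfl fun l _ => by ring
        _ = 0 := by rw [this, mul_zero]⟩
  set ξ : ℕ → ℕ → Ω → ℝ := fun n k ω => ψ n k (x k ω) (X k ω) (X (k + 1) ω) with hξ
  set w : ℕ → ℕ → Ω → ℝ := fun n k ω =>
    ∑ l, srrwKernel P μ α (x k ω) (X k ω) l * ψ n k (x k ω) (X k ω) l ^ 2 with hw
  have hwm : ∀ n k, Measurable[F k] (w n k) := fun n k =>
    meas_comp2 (g := fun y t => ∑ l, srrwKernel P μ α y t l * ψ n k y t l ^ 2)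
      (fun t => Finset.measurable_sum _ fun l _ => (kernel_meas t l).mul ((hψm n k t l).pow_const 2))
      (hW.xm k) (hW.Xm k)
  have hψ2 : ∀ n k y t l, ψ n k y t l ^ 2 ≤ p n k ^ 2 := fun n k y t l => by
    rw [← sq_abs]; exact pow_le_pow_left₀ (abs_nonneg _) (hψb n k y t l) 2
  -- bounds on the weights
  have hp2 : ∀ n k, p n k ^ 2 ≤ (Fintype.card ι * B ^ 2) * ∑ i, s i ^ 2 * cf γ (β i) n k ^ 2 :=
    fun n k => by
    refine (sq_sum_le_card_mul_sum_sq (s := univ)).trans (le_of_eq ?_)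
    rw [Finset.card_univ, mul_assoc]
    congr 1
    rw [Finset.mul_sum]
    refine Finset.sum_congr rfl fun i _ => ?_
    rw [mul_pow, mul_pow, sq_abs, sq_abs]; ring
  have hp4 : ∀ n k, p n k ^ 4 ≤ (Fintype.card ι * B ^ 2) ^ 2 * Fintype.card ι *
      ∑ i, s i ^ 4 * cf γ (β i) n k ^ 4 := fun n k => by
    have h1 := pow_le_pow_left₀ (sq_nonneg _) (hp2 n k) 2
    have h2 : (∑ i, s i ^ 2 * cf γ (β i) n k ^ 2) ^ 2 ≤
        Fintype.card ι * ∑ i, s i ^ 4 * cf γ (β i) n k ^ 4 := by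
      refine (sq_sum_le_card_mul_sum_sq (s := univ)).trans (le_of_eq ?_)
      rw [Finset.card_univ]
      congr 1
      exact Finset.sum_congr rfl fun i _ => by ring
    calc p n k ^ 4 = (p n k ^ 2) ^ 2 := by ring
      _ ≤ _ := h1
      _ = (Fintype.card ι * B ^ 2) ^ 2 * (∑ i, s i ^ 2 * cf γ (β i) n k ^ 2) ^ 2 := by ring
      _ ≤ (Fintype.card ι * B ^ 2) ^ 2 * (Fintype.card ι * ∑ i, s i ^ 4 * cf γ (β i) n k ^ 4) :=
        mul_le_mul_of_nonneg_left h2 (sq_nonneg _)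
      _ = _ := by ring
  have hlim2 : ∀ i, Tendsto (fun n => ∑ k ∈ range n, cf γ (β i) n k ^ 2) atTop
      (𝓝 (1 / (β i + β i - τ))) := fun i => by
    have := wsum_lim hγ (hβ i) (hβ i) (q := fun _ => 1) (ε := fun _ => 0) (e := fun _ => 0)
      (qb := 1) (T := 0) (by simp) tendsto_const_nhds (by simp)
    refine this.congr fun n => Finset.sum_congr rfl fun k _ => by ring
  have hsum2 : Tendsto (fun n => (Fintype.card ι * B ^ 2) *
      ∑ i, s i ^ 2 * ∑ k ∈ range n, cf γ (β i) n k ^ 2) atTop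
      (𝓝 ((Fintype.card ι * B ^ 2) * ∑ i, s i ^ 2 * (1 / (β i + β i - τ)))) :=
    (tendsto_finsetSum _ fun i _ => (hlim2 i).const_mul _).const_mul _
  have hsum4 : Tendsto (fun n => (Fintype.card ι * B ^ 2) ^ 2 * Fintype.card ι *
      ∑ i, s i ^ 4 * ∑ k ∈ range n, cf γ (β i) n k ^ 4) atTop (𝓝 0) := by
    have := (tendsto_finsetSum univ fun i _ => (wsum4_lim hγ (hβ i)).const_mul (s i ^ 4)).const_mul
      ((Fintype.card ι * B ^ 2) ^ 2 * Fintype.card ι)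
    simpa using this
  have hle2 : ∀ n, ∑ k ∈ range n, p n k ^ 2 ≤ (Fintype.card ι * B ^ 2) *
      ∑ i, s i ^ 2 * ∑ k ∈ range n, cf γ (β i) n k ^ 2 := fun n => by
    refine (Finset.sum_le_sum fun k _ => hp2 n k).trans (le_of_eq ?_)
    rw [← Finset.mul_sum, Finset.sum_comm]
    simp_rw [Finset.mul_sum]
  have hle4 : ∀ n, ∑ k ∈ range n, p n k ^ 4 ≤ (Fintype.card ι * B ^ 2) ^ 2 * Fintype.card ι *
      ∑ i, s i ^ 4 * ∑ k ∈ range n, cf γ (β i) n k ^ 4 := fun n => by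
    refine (Finset.sum_le_sum fun k _ => hp4 n k).trans (le_of_eq ?_)
    rw [← Finset.mul_sum, Finset.sum_comm]
    simp_rw [Finset.mul_sum]
  obtain ⟨D, hD⟩ := hsum2.bddAbove_range
  have hD2 : ∀ n, ∑ k ∈ range n, p n k ^ 2 ≤ D := fun n => (hle2 n).trans (hD ⟨n, rfl⟩)
  have hp3 : Tendsto (fun n => ∑ k ∈ range n, p n k ^ 3) atTop (𝓝 0) := by
    have h4 : Tendsto (fun n => ∑ k ∈ range n, p n k ^ 4) atTop (𝓝 0) :=
      squeeze_zero (fun n => Finset.sum_nonneg fun k _ => pow_nonneg (hp0 n k) 4) hle4 hsum4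
    have h5 : Tendsto (fun n => √(D * ∑ k ∈ range n, p n k ^ 4)) atTop (𝓝 0) := by
      have : Tendsto (fun n => √(D * ∑ k ∈ range n, p n k ^ 4)) atTop (𝓝 (√(D * 0))) :=
        (Real.continuous_sqrt.tendsto _).comp (h4.const_mul D)
      simpa using this
    refine squeeze_zero (fun n => Finset.sum_nonneg fun k _ => pow_nonneg (hp0 n k) 3)
      (fun n => Real.le_sqrt_of_sq_le ?_) h5
    have h6 := Finset.sum_mul_sq_le_sq_mul_sq (range n) (fun k => p n k) (fun k => p n k ^ 2)
    calc _ = (∑ k ∈ range n, p n k * p n k ^ 2) ^ 2 := by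
          congr 1; exact Finset.sum_congr rfl fun k _ => by ring
      _ ≤ _ := h6
      _ = (∑ k ∈ range n, p n k ^ 2) * ∑ k ∈ range n, p n k ^ 4 := by
          congr 1; exact Finset.sum_congr rfl fun k _ => by ring
      _ ≤ _ := mul_le_mul_of_nonneg_right (hD2 n)
          (Finset.sum_nonneg fun k _ => pow_nonneg (hp0 n k) 4)
  have key := mds_clt Pr F ξ w p (V := ∑ i, s i ^ 2 * ((1 + lam i) / (1 - lam i) / (β i + β i - τ)))
    (D := D) (fun n k => hW.incr_meas (hψm n k) k) hwm (fun n k ω => hψb _ _ _ _ _)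
    (fun n k ω => Finset.sum_nonneg fun l _ =>
      mul_nonneg (kernel_nonneg hB (hW.simp k ω).1 _ _) (sq_nonneg _))
    (fun n k ω => ?_) (fun n k Y C hY hC => hW.incr_mean hB (hψI n k) k hY hC)
    (fun n k Y C hY hC => ?_) hD2 hp3 ?_
  · refine key.congr fun n => ?_
    congr 1
    funext ω
    congr 3
    simp only [hξ, hψ, linR]
    rw [Finset.sum_comm]
    refine Finset.sum_congr rfl fun i _ => ?_
    rw [Finset.mul_sum]
    exact Finset.sum_congr rfl fun k _ => by ring
  · calc w n k ω ≤ ∑ l, srrwKernel P μ α (x k ω) (X k ω) l * p n k ^ 2 :=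
        Finset.sum_le_sum fun l _ => mul_le_mul_of_nonneg_left (hψ2 _ _ _ _ _)
          (kernel_nonneg hB (hW.simp k ω).1 _ _)
      _ = p n k ^ 2 := by rw [← Finset.sum_mul, kernel_sum hB (hW.simp k ω).1, one_mul]
  · have h := hW.test hB k (φ := fun y t l => ψ n k y t l ^ 2) (B := p n k ^ 2)
      (fun t l => (hψm n k t l).pow_const 2) (fun y t l => by
        rw [abs_of_nonneg (sq_nonneg _)]; exact hψ2 _ _ _ _ _) hY hC
    rw [← h]
    refine integral_congr_ae (ae_of_all _ fun ω => ?_)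
    simp only [hξ, hw]
    rw [Complex.ofReal_sub, Complex.ofReal_pow]
  · have hall : ∀ᵐ ω ∂Pr, ∀ i j, Tendsto (fun n => ∑ k ∈ range n, cf γ (β i) n k * cf γ (β j) n k *
        covQ P μ α m (v i) (v j) (x k ω) (X k ω)) atTop
        (𝓝 ((if i = j then (1 + lam i) / (1 - lam i) else 0) / (β i + β j - τ))) := by
      rw [ae_all_iff]; intro i
      rw [ae_all_iff]; intro j
      exact hW.cov_conv hB hα hγ hE hmμ i j (hβ i) (hβ j)
    filter_upwards [hall] with ω hω
    have hlim := tendsto_finsetSum univ fun i _ => tendsto_finsetSum univ fun j _ =>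
      (hω i j).const_mul (s i * s j)
    have hval : ∑ i, ∑ j, s i * s j * ((if i = j then (1 + lam i) / (1 - lam i) else 0) /
        (β i + β j - τ)) = ∑ i, s i ^ 2 * ((1 + lam i) / (1 - lam i) / (β i + β i - τ)) := by
      refine Finset.sum_congr rfl fun i _ => ?_
      rw [Finset.sum_eq_single i]
      · rw [if_pos rfl]; ring
      · intro j _ hj; rw [if_neg hj.symm]; simp
      · intro h; exact absurd (mem_univ i) h
    rw [hval] at hlim
    refine hlim.congr fun n => ?_
    have hexp : ∀ k, w n k ω = ∑ i, ∑ j, s i * s j * (cf γ (β i) n k * cf γ (β j) n k *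
        covQ P μ α m (v i) (v j) (x k ω) (X k ω)) := fun k => by
      have e1 : ∀ (K : ℝ) (f : ι → ℝ), K * (∑ i, f i) ^ 2 = ∑ i, ∑ j, K * (f i * f j) :=
        fun K f => by
        rw [sq, Finset.sum_mul_sum, Finset.mul_sum]
        exact Finset.sum_congr rfl fun i _ => by rw [Finset.mul_sum]
      simp only [hw, hψ, covQ]
      rw [Finset.sum_congr rfl fun l _ => e1 _ _, Finset.sum_comm]
      refine Finset.sum_congr rfl fun i _ => ?_
      rw [Finset.sum_comm]
      refine Finset.sum_congr rfl fun j _ => ?_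
      rw [Finset.mul_sum, Finset.mul_sum]
      exact Finset.sum_congr rfl fun l _ => by ring
    simp_rw [hexp]
    symm
    rw [Finset.sum_comm]
    refine Finset.sum_congr rfl fun i _ => ?_
    rw [Finset.sum_comm]
    exact Finset.sum_congr rfl fun j _ => by rw [Finset.mul_sum]

end clt

/-! ### Second moments of the linear recursion -/

section rem
variable {N : ℕ} {P : Matrix (Fin N) (Fin N) ℝ} {μ : Fin N → ℝ} {α : ℝ} {γ : ℕ → ℝ} {τ : ℝ}
    {Ω : Type*} [mΩ : MeasurableSpace Ω] {Pr : Measure Ω} [IsProbabilityMeasure Pr]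
    {F : Filtration ℕ mΩ} {X : ℕ → Ω → Fin N} {x : ℕ → Ω → (Fin N → ℝ)}
    {m : ℝ} {β : ℝ} {f : Fin N → ℝ}

lemma linR_succ (hγ : GammaSeq γ τ) (n : ℕ) (ω : Ω) :
    linR P μ α γ m β f X x (n + 1) ω =
      (√(γ n) / √(γ (n + 1))) * (1 - β * γ (n + 1)) * linR P μ α γ m β f X x n ω +
      √(γ (n + 1)) * mInc P μ α m f (x n ω) (X n ω) (X (n + 1) ω) := by
  rw [linR, Finset.sum_range_succ, cf_diag hγ, linR, Finset.mul_sum]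
  congr 1
  refine Finset.sum_congr rfl fun k hk => ?_
  rw [cf_succ hγ β (Finset.mem_range.1 hk)]
  ring

lemma linR_meas (hB : BaseChain P μ) (hm : 0 < m) (hW : Walk P μ α γ Pr F X x) (n : ℕ) :
    Measurable[F n] (linR P μ α γ m β f X x n) := by
  obtain ⟨B, hI⟩ := mInc_incr (α := α) hB hm f
  unfold linR
  refine Finset.measurable_sum _ fun k hk => ?_
  have := (hW.incr_meas hI.meas k).mono (F.mono (Nat.succ_le_of_lt (Finset.mem_range.1 hk))) le_rfl
  exact this.const_mul _

lemma linR_bdd (hB : BaseChain P μ) (hm : 0 < m) (n : ℕ) :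
    ∃ C, ∀ ω, |linR P μ α γ m β f X x n ω| ≤ C := by
  obtain ⟨B, hI⟩ := mInc_incr (α := α) hB hm f
  refine ⟨∑ k ∈ range n, |cf γ β n k| * B, fun ω => ?_⟩
  refine (Finset.abs_sum_le_sum_abs _ _).trans (Finset.sum_le_sum fun k _ => ?_)
  rw [abs_mul]
  exact mul_le_mul_of_nonneg_left (hI.bdd _ _ _) (abs_nonneg _)

lemma linR_L2 (hB : BaseChain P μ) (hm : 0 < m) (hγ : GammaSeq γ τ)
    (hW : Walk P μ α γ Pr F X x) (hβ : 1 ≤ β) :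
    ∃ D, 0 < D ∧ ∀ n, ∫ ω, linR P μ α γ m β f X x n ω ^ 2 ∂Pr ≤ D := by
  obtain ⟨B, hI⟩ := mInc_incr (α := α) hB hm f
  have hc : ∀ᶠ n in atTop, 1 / 2 ≤ cnR γ β β n := by
    have h1 : (1 / 2 : ℝ) < β + β - τ := by linarith [hγ.tau_le]
    filter_upwards [(cnR_lim hγ β β).eventually (lt_mem_nhds h1)] with n hn using hn.le
  refine recursion_bounded hγ.step (b := 1 / 2) (by norm_num) (B := B ^ 2) ?_
  filter_upwards [hc] with n hn
  set R := linR P μ α γ m β f X x n with hR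
  set M : Ω → ℝ := fun ω => mInc P μ α m f (x n ω) (X n ω) (X (n + 1) ω) with hM
  set q := (√(γ n) / √(γ (n + 1))) * (1 - β * γ (n + 1)) with hq
  obtain ⟨C, hC⟩ := linR_bdd (P := P) (μ := μ) (α := α) (γ := γ) (β := β) (f := f) (X := X)
    (x := x) hB hm n
  have hRm : Measurable R := (linR_meas hB hm hW n).mono (F.le _) le_rfl
  have hMm : Measurable M := (hW.incr_meas hI.meas n).mono (F.le _) le_rfl
  have hM2 : ∀ ω, M ω ^ 2 ≤ B ^ 2 := fun ω => by
    rw [← sq_abs]; exact pow_le_pow_left₀ (abs_nonneg _) (hI.bdd _ _ _) 2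
  have i1 : Integrable (fun ω => R ω ^ 2) Pr :=
    integrable_of_bdd (hRm.pow_const 2).aestronglyMeasurable (C := C ^ 2) fun ω => by
      rw [norm_pow]; exact pow_le_pow_left₀ (norm_nonneg _) (hC ω) 2
  have i2 : Integrable (fun ω => R ω * M ω) Pr :=
    integrable_of_bdd (hRm.mul hMm).aestronglyMeasurable (C := C * B) fun ω => by
      rw [norm_mul]
      exact mul_le_mul (hC ω) (hI.bdd _ _ _) (norm_nonneg _) ((abs_nonneg _).trans (hC ω))
  have i3 : Integrable (fun ω => M ω ^ 2) Pr :=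
    integrable_of_bdd (hMm.pow_const 2).aestronglyMeasurable (C := B ^ 2) fun ω => by
      rw [norm_pow]; exact pow_le_pow_left₀ (norm_nonneg _) (hI.bdd _ _ _) 2
  have h0 : ∫ ω, R ω * M ω ∂Pr = 0 := hW.incr_mean_real hB hI n (linR_meas hB hm hW n) hC
  have hg := hγ.pos (n + 1)
  have hexp : ∀ ω, linR P μ α γ m β f X x (n + 1) ω ^ 2 =
      q ^ 2 * R ω ^ 2 + (2 * q * √(γ (n + 1))) * (R ω * M ω) + γ (n + 1) * M ω ^ 2 := fun ω => by
    rw [linR_succ hγ]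
    have := Real.sq_sqrt hg.le
    simp only [← hR, ← hq]
    calc _ = q ^ 2 * R ω ^ 2 + (2 * q * √(γ (n + 1))) * (R ω * M ω) +
          √(γ (n + 1)) ^ 2 * M ω ^ 2 := by ring
      _ = _ := by rw [this]
  have hq2 : q ^ 2 = 1 - cnR γ β β n * γ (n + 1) := by
    rw [← fac_eq hγ, hq, mul_pow, sqrt_ratio hγ]; ring
  have hIntEq : ∫ ω, linR P μ α γ m β f X x (n + 1) ω ^ 2 ∂Pr =
      q ^ 2 * ∫ ω, R ω ^ 2 ∂Pr + γ (n + 1) * ∫ ω, M ω ^ 2 ∂Pr := by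
    rw [integral_congr_ae (ae_of_all _ hexp)]
    have j1 : Integrable (fun ω => q ^ 2 * R ω ^ 2) Pr := i1.const_mul _
    have j2 : Integrable (fun ω => (2 * q * √(γ (n + 1))) * (R ω * M ω)) Pr := i2.const_mul _
    have j3 : Integrable (fun ω => γ (n + 1) * M ω ^ 2) Pr := i3.const_mul _
    have j12 : Integrable (fun ω => q ^ 2 * R ω ^ 2 +
      (2 * q * √(γ (n + 1))) * (R ω * M ω)) Pr := j1.add j2
    rw [integral_add j12 j3, integral_add j1 j2, integral_const_mul, integral_const_mul,
      integral_const_mul, h0]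
    ring
  have hMi : ∫ ω, M ω ^ 2 ∂Pr ≤ B ^ 2 := by
    calc _ ≤ ∫ _, B ^ 2 ∂Pr := integral_mono i3 (integrable_const _) hM2
      _ = _ := by simp
  have hR0 : 0 ≤ ∫ ω, R ω ^ 2 ∂Pr := integral_nonneg fun ω => sq_nonneg _
  rw [hIntEq, hq2]
  have e1 := mul_le_mul_of_nonneg_left hMi hg.le
  have e2 : (1 - cnR γ β β n * γ (n + 1)) * ∫ ω, R ω ^ 2 ∂Pr ≤
      (1 - 1 / 2 * γ (n + 1)) * ∫ ω, R ω ^ 2 ∂Pr :=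
    mul_le_mul_of_nonneg_right (by nlinarith) hR0
  linarith

end rem

/-! ### Pathwise analysis of the remainder -/

/-- Coordinates of the error. -/
def zE {N : ℕ} (μ f y : Fin N → ℝ) : ℝ := ∑ b, f b * (y b - μ b)

/-- Nonlinear part of the drift. -/
def eE {N : ℕ} (P : Matrix (Fin N) (Fin N) ℝ) (μ : Fin N → ℝ) (α lam : ℝ) (f y : Fin N → ℝ) : ℝ :=
  ∑ j, piS P μ α y j * f j + α * (1 + lam) * zE μ f y

/-- Truncated relative size of the nonlinear part. -/
def epsH {N : ℕ} {ι : Type*} [Fintype ι] (P : Matrix (Fin N) (Fin N) ℝ) (μ : Fin N → ℝ) (α : ℝ)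
    (lam : ι → ℝ) (v : ι → Fin N → ℝ) (c : ℝ) (y : Fin N → ℝ) : ℝ :=
  min 1 (c * ((∑ i, |eE P μ α (lam i) (v i) y|) / ‖y - μ‖))

/-- The normalized remainder. -/
def pE {N : ℕ} (P : Matrix (Fin N) (Fin N) ℝ) (μ : Fin N → ℝ) (α : ℝ) (γ : ℕ → ℝ) (m : ℝ)
    (β : ℝ) (f : Fin N → ℝ) {Ω : Type*} (X : ℕ → Ω → Fin N) (x : ℕ → Ω → (Fin N → ℝ))
    (n : ℕ) (ω : Ω) : ℝ :=
  (zE μ f (x n ω) + γ n * poisU P μ α f (x n ω) (X n ω)) / √(γ n) - linR P μ α γ m β f X x n ω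

/-- Comparison sequence. -/
def pHat (γ e ℓ : ℕ → ℝ) : ℕ → ℝ
  | 0 => 0
  | n + 1 => (1 - γ (n + 1) / 4) * pHat γ e ℓ n + γ (n + 1) * (e n * ℓ n)

section path
variable {N : ℕ} {P : Matrix (Fin N) (Fin N) ℝ} {μ : Fin N → ℝ} {α : ℝ} {γ : ℕ → ℝ} {τ : ℝ}
    {Ω : Type*} [mΩ : MeasurableSpace Ω] {Pr : Measure Ω} [IsProbabilityMeasure Pr]
    {F : Filtration ℕ mΩ} {X : ℕ → Ω → Fin N} {x : ℕ → Ω → (Fin N → ℝ)}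
    {m : ℝ} {ι : Type*} [Fintype ι] [DecidableEq ι] {lam : ι → ℝ} {v : ι → Fin N → ℝ}

lemma sqrt_le_two (hγ : GammaSeq γ τ) (n : ℕ) : √(γ n) ≤ 2 * √(γ (n + 1)) := by
  have h1 := hγ.diff_le n
  have h2 := hγ.le_one n
  have h3 := hγ.pos (n + 1)
  have h4 : γ n * γ (n + 1) ≤ γ (n + 1) := by nlinarith
  rw [show (2 : ℝ) = √4 by rw [show (4 : ℝ) = 2 ^ 2 by norm_num]; simp,
    ← Real.sqrt_mul (by norm_num)]
  exact Real.sqrt_le_sqrt (by linarith)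

lemma contraction (hγ : GammaSeq γ τ) {β : ℝ} (hβ : 1 ≤ β) :
    ∀ᶠ n in atTop, |√(γ n) / √(γ (n + 1)) * (1 - β * γ (n + 1))| ≤ 1 - 3 / 8 * γ (n + 1) := by
  have h1 : (3 / 4 : ℝ) < β + β - τ := by linarith [hγ.tau_le]
  filter_upwards [(cnR_lim hγ β β).eventually (lt_mem_nhds h1)] with n hn
  have hg := hγ.pos (n + 1)
  have hg1 := hγ.le_one (n + 1)
  refine abs_le_of_sq_le_sq ?_ (by linarith)
  have h2 : (√(γ n) / √(γ (n + 1)) * (1 - β * γ (n + 1))) ^ 2 =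
      1 - cnR γ β β n * γ (n + 1) := by
    rw [← fac_eq hγ, mul_pow, sqrt_ratio hγ]; ring
  rw [h2]
  nlinarith

lemma rem_step (hB : BaseChain P μ) (hγ : GammaSeq γ τ) (hW : Walk P μ α γ Pr F X x)
    (hm : 0 < m) {f : Fin N → ℝ} (hf : ∑ k, μ k * f k = 0) (l : ℝ) {β : ℝ}
    (hβ : β = 1 + α * (1 + l)) :
    ∃ C, 0 ≤ C ∧ ∀ n ω, x n ω ∈ boxC N m → x (n + 1) ω ∈ boxC N m →
      |pE P μ α γ m β f X x (n + 1) ω| ≤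
        |√(γ n) / √(γ (n + 1)) * (1 - β * γ (n + 1))| * |pE P μ α γ m β f X x n ω| +
        √(γ (n + 1)) * (|eE P μ α l f (x n ω)| + C * γ n) := by
  obtain ⟨L, hL0, hL⟩ := bdd_fin (f := fun y i => poisU P μ α f y i) hm (poisU_contDiff hB f)
  obtain ⟨K, hK0, hK⟩ := lip_fin (f := fun y i => poisU P μ α f y i) hm (poisU_contDiff hB f)
  refine ⟨K + (1 + |β|) * L, by positivity, fun n ω h1 h2 => ?_⟩
  have hg := hγ.pos n
  have hg' := hγ.pos (n + 1)
  set g := γ n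
  set g' := γ (n + 1)
  set U0 := poisU P μ α f (x n ω) (X n ω) with hU0
  set U1 := poisU P μ α f (x (n + 1) ω) (X (n + 1) ω) with hU1
  set Um := poisU P μ α f (x n ω) (X (n + 1) ω) with hUm
  have hP := poisson_eq (α := α) hB (boxC_posO hm h1) f (X (n + 1) ω)
  set pv := ∑ j, piS P μ α (x n ω) j * f j with hpv
  have hz : zE μ f (x (n + 1) ω) = (1 - g') * zE μ f (x n ω) + g' * f (X (n + 1) ω) := by
    have e1 : ∑ b, f b * (Pi.single (X (n + 1) ω) (1 : ℝ) : Fin N → ℝ) b = f (X (n + 1) ω) := by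
      simp [Pi.single_apply]
    have e2 : ∀ y : Fin N → ℝ, zE μ f y = ∑ b, f b * y b := fun y => by
      have : ∑ b, f b * μ b = 0 := by rw [← hf]; exact Finset.sum_congr rfl fun b _ => mul_comm _ _
      simp only [zE, mul_sub, Finset.sum_sub_distrib, this, sub_zero]
    rw [e2, e2, hW.step, ← e1, Finset.mul_sum, Finset.mul_sum, ← Finset.sum_add_distrib]
    refine Finset.sum_congr rfl fun b _ => ?_
    simp only [Pi.add_apply, Pi.smul_apply, Pi.sub_apply, smul_eq_mul]
    ring
  set d := (U1 - Um) + ((g' - g) / g' + β * g) * U0 with hd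
  have hmain : pE P μ α γ m β f X x (n + 1) ω =
      √g / √g' * (1 - β * g') * pE P μ α γ m β f X x n ω +
        √g' * (eE P μ α l f (x n ω) + d) := by
    rw [pE, pE, linR_succ hγ, mInc_of_mem h1, hz]
    set R := linR P μ α γ m β f X x n ω
    change ((1 - g') * zE μ f (x n ω) + g' * f (X (n + 1) ω) + g' * U1) / √g' -
      (√g / √g' * (1 - β * g') * R + √g' * (poisG P μ α f (x n ω) (X (n + 1) ω) - U0)) =
      √g / √g' * (1 - β * g') * ((zE μ f (x n ω) + g * U0) / √g - R) +
        √g' * (eE P μ α l f (x n ω) + d)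
    have s1 : √g ≠ 0 := (Real.sqrt_pos.2 hg).ne'
    have s2 : √g' ≠ 0 := (Real.sqrt_pos.2 hg').ne'
    have q1 : √g' * √g' = g' := Real.mul_self_sqrt hg'.le
    have hG : poisG P μ α f (x n ω) (X (n + 1) ω) = Um + (f (X (n + 1) ω) - pv) := by
      rw [← hP]; ring
    rw [hG]
    have hgd : (g' - g) / g' * g' = g' - g := div_mul_cancel₀ _ hg'.ne'
    have he : eE P μ α l f (x n ω) = pv + (β - 1) * zE μ f (x n ω) := by
      rw [eE, hβ]; ring
    rw [he]
    have key : (1 - g') * zE μ f (x n ω) + g' * f (X (n + 1) ω) + g' * U1 =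
        (1 - β * g') * (zE μ f (x n ω) + g * U0) +
        g' * (Um + (f (X (n + 1) ω) - pv) - U0) +
        g' * (pv + (β - 1) * zE μ f (x n ω) + d) := by
      have : g' * d = g' * (U1 - Um) + ((g' - g) + β * g * g') * U0 := by
        rw [hd, ← hgd]; field_simp
      rw [mul_add g' _ d, this]; ring
    rw [key]
    have q3 : ∀ t, g' * t / √g' = √g' * t := fun t => by
      rw [div_eq_iff s2, mul_right_comm, q1]
    have q4 : √g / √g' * (1 - β * g') * ((zE μ f (x n ω) + g * U0) / √g - R) =
        (1 - β * g') * (zE μ f (x n ω) + g * U0) / √g' - √g / √g' * (1 - β * g') * R := by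
      field_simp
    rw [add_div, add_div, q3, q3, q4]
    ring
  have hd1 : |d| ≤ (K + (1 + |β|) * L) * g := by
    have a1 : |U1 - Um| ≤ K * g := by
      refine (hK _ h2 _ h1 _).trans (mul_le_mul_of_nonneg_left ?_ hK0)
      exact (hW.dist_step hγ n ω).trans (hγ.anti n)
    have a2 : |U0| ≤ L := hL _ h1 _
    have a3 : |(g' - g) / g'| ≤ g := by
      rw [abs_div, abs_of_pos hg', div_le_iff₀ hg', abs_sub_comm,
        abs_of_nonneg (sub_nonneg.2 (hγ.anti n))]
      exact hγ.diff_le n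
    have a4 : |(g' - g) / g' + β * g| ≤ (1 + |β|) * g := by
      refine (abs_add_le _ _).trans ?_
      rw [abs_mul, abs_of_pos hg]; linarith
    calc |d| ≤ |U1 - Um| + |((g' - g) / g' + β * g) * U0| := abs_add_le _ _
      _ ≤ K * g + (1 + |β|) * g * L := by
        rw [abs_mul]
        exact add_le_add a1 (mul_le_mul a4 a2 (abs_nonneg _) (by positivity))
      _ = _ := by ring
  rw [hmain]
  refine (abs_add_le _ _).trans ?_
  rw [abs_mul, abs_mul (√g'), abs_of_nonneg (Real.sqrt_nonneg g')]
  gcongr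
  exact (abs_add_le _ _).trans (by linarith)

set_option maxHeartbeats 800000 in
lemma path_rem (hB : BaseChain P μ) (hα : 0 ≤ α) (hγ : GammaSeq γ τ)
    (hW : Walk P μ α γ Pr F X x) (hE : Eig P μ lam v) (hm : 0 < m) (hmμ : ∀ i, m < μ i)
    {ω : Ω} (hω : Tendsto (fun n => x n ω) atTop (𝓝 μ)) :
    Tendsto (fun n => max (∑ i, |pE P μ α γ m (1 + α * (1 + lam i)) (v i) X x n ω| -
      pHat γ (fun n => epsH P μ α lam v (2 * ∑ a, ∑ i, |μ a * v i a|) (x n ω))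
        (fun n => ∑ i, |linR P μ α γ m (1 + α * (1 + lam i)) (v i) X x n ω|) n) 0)
      atTop (𝓝 0) := by
  set C0 := ∑ a, ∑ i, |μ a * v i a| with hC0
  have hC00 : 0 ≤ C0 := Finset.sum_nonneg fun a _ => Finset.sum_nonneg fun i _ => abs_nonneg _
  set β : ι → ℝ := fun i => 1 + α * (1 + lam i) with hβ
  have hβ1 : ∀ i, 1 ≤ β i := fun i => by
    have := mul_nonneg hα (by linarith [(hE.lt i).1] : 0 ≤ 1 + lam i)
    simp only [hβ]; linarith
  choose C hCn hC using fun i => rem_step (Pr := Pr) (F := F) hB hγ hW hm (hE.mean i) (lam i)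
    (β := β i) rfl
  choose L hL0 hL using fun i => bdd_fin (f := fun y j => poisU P μ α (v i) y j) hm
    (poisU_contDiff hB (v i))
  set e : ℕ → ℝ := fun n => epsH P μ α lam v (2 * C0) (x n ω) with he
  set R : ι → ℕ → ℝ := fun i n => linR P μ α γ m (β i) (v i) X x n ω with hR
  set p : ι → ℕ → ℝ := fun i n => pE P μ α γ m (β i) (v i) X x n ω with hp
  set S : ℕ → ℝ := fun n => ∑ i, |p i n| with hS
  set ℓ : ℕ → ℝ := fun n => ∑ i, |R i n| with hℓ
  set K := ∑ i, L i + 2 * ∑ i, C i with hK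
  have hSL : 0 ≤ ∑ i, L i := Finset.sum_nonneg fun i _ => hL0 i
  have hSC : 0 ≤ ∑ i, C i := Finset.sum_nonneg fun i _ => hCn i
  set ε' : ℝ := 1 / (16 * (C0 + 1) * ((Fintype.card ι : ℝ) + 1)) with hε'
  have hcard : (0 : ℝ) ≤ Fintype.card ι := Nat.cast_nonneg _
  have hε'0 : 0 < ε' := by positivity
  have hbox := ev_box hmμ hω (fun n => hW.simp n ω)
  have hexp : ∀ᶠ n in atTop, ∀ i, |eE P μ α (lam i) (v i) (x n ω)| ≤ ε' * ‖x n ω - μ‖ := by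
    rw [eventually_all]
    intro i
    filter_upwards [hω.eventually (pi_expansion (α := α) hB (hE.eig i) (hE.mean i) hε'0)] with n hn
    have := hn (hW.simp n ω).2
    simpa only [eE, zE, mul_comm (v i _)] using this
  have hcon : ∀ᶠ n in atTop, ∀ i, |√(γ n) / √(γ (n + 1)) * (1 - β i * γ (n + 1))| ≤
      1 - 3 / 8 * γ (n + 1) := by
    rw [eventually_all]; exact fun i => contraction hγ (hβ1 i)
  have hrec : ∀ᶠ n in atTop, S (n + 1) ≤ (1 - γ (n + 1) / 4) * S n +
      γ (n + 1) * (e n * ℓ n + K * √(γ n)) := by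
    filter_upwards [hbox, (tendsto_add_atTop_nat 1).eventually hbox, hexp, hcon] with n b1 b2 hx hc
    have hg := hγ.pos n
    have hg' := hγ.pos (n + 1)
    have hS0 : 0 ≤ S n := Finset.sum_nonneg fun i _ => abs_nonneg _
    have hℓ0 : 0 ≤ ℓ n := Finset.sum_nonneg fun i _ => abs_nonneg _
    set E := ∑ i, |eE P μ α (lam i) (v i) (x n ω)| with hEdef
    have hE0 : 0 ≤ E := Finset.sum_nonneg fun i _ => abs_nonneg _
    have hEle : E ≤ Fintype.card ι * ε' * ‖x n ω - μ‖ := by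
      calc E ≤ ∑ _i : ι, ε' * ‖x n ω - μ‖ := Finset.sum_le_sum fun i _ => hx i
        _ = _ := by rw [Finset.sum_const, Finset.card_univ, nsmul_eq_mul]; ring
    have hEeq : E / ‖x n ω - μ‖ * ‖x n ω - μ‖ = E := by
      by_cases h0 : ‖x n ω - μ‖ = 0
      · rw [h0, mul_zero]; rw [h0, mul_zero] at hEle; linarith
      · exact div_mul_cancel₀ _ h0
    have hEd0 : 0 ≤ E / ‖x n ω - μ‖ := by positivity
    have hEd : E / ‖x n ω - μ‖ ≤ Fintype.card ι * ε' :=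
      div_le_of_le_mul₀ (norm_nonneg _) (by positivity) hEle
    have hsmall : 2 * C0 * (Fintype.card ι * ε') ≤ 1 / 8 := by
      rw [hε']
      rw [mul_one_div, mul_div_assoc', div_le_iff₀ (by positivity)]
      nlinarith [mul_nonneg hC00 hcard]
    have heps : 2 * C0 * (E / ‖x n ω - μ‖) ≤ 1 / 8 :=
      (mul_le_mul_of_nonneg_left hEd (by positivity)).trans hsmall
    have hen : e n = 2 * C0 * (E / ‖x n ω - μ‖) := min_eq_right (by linarith)
    have he0 : 0 ≤ e n := by rw [hen]; positivity
    have he8 : e n ≤ 1 / 8 := by rw [hen]; exact heps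
    -- the size of the error
    have hθ : ‖x n ω - μ‖ ≤ C0 * ∑ i, |zE μ (v i) (x n ω)| := by
      have hZ0 : 0 ≤ ∑ i, |zE μ (v i) (x n ω)| := Finset.sum_nonneg fun i _ => abs_nonneg _
      rw [pi_norm_le_iff_of_nonneg (mul_nonneg hC00 hZ0)]
      intro a
      have h0 : ∑ k, (x n ω - μ) k = 0 := by
        simp only [Pi.sub_apply, Finset.sum_sub_distrib, (hW.simp n ω).2, hB.mu_sum, sub_self]
      rw [hE.complete _ h0 a, Real.norm_eq_abs]
      refine (Finset.abs_sum_le_sum_abs _ _).trans ?_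
      rw [Finset.mul_sum]
      refine Finset.sum_le_sum fun i _ => ?_
      rw [abs_mul]
      refine mul_le_mul_of_nonneg_right ?_ (abs_nonneg _)
      calc |μ a * v i a| ≤ ∑ i, |μ a * v i a| :=
            Finset.single_le_sum (f := fun i => |μ a * v i a|) (fun j _ => abs_nonneg _) (mem_univ i)
        _ ≤ C0 := Finset.single_le_sum (f := fun a => ∑ i, |μ a * v i a|)
            (fun j _ => Finset.sum_nonneg fun i _ => abs_nonneg _) (mem_univ a)
    have hz : ∀ i, |zE μ (v i) (x n ω)| ≤ √(γ n) * (|p i n| + |R i n| + √(γ n) * L i) := fun i => by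
      have s1 : √(γ n) ≠ 0 := (Real.sqrt_pos.2 hg).ne'
      have q1 : √(γ n) * √(γ n) = γ n := Real.mul_self_sqrt hg.le
      have : zE μ (v i) (x n ω) = √(γ n) * (p i n + R i n -
          √(γ n) * poisU P μ α (v i) (x n ω) (X n ω)) := by
        simp only [hp, hR, pE]
        rw [mul_sub, ← mul_assoc, q1]
        field_simp
        ring
      rw [this, abs_mul, abs_of_nonneg (Real.sqrt_nonneg _)]
      refine mul_le_mul_of_nonneg_left ?_ (Real.sqrt_nonneg _)
      refine (abs_sub _ _).trans ?_
      rw [abs_mul, abs_of_nonneg (Real.sqrt_nonneg _)]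
      exact add_le_add (abs_add_le _ _)
        (mul_le_mul_of_nonneg_left (hL i _ b1 _) (Real.sqrt_nonneg _))
    have hzs : ∑ i, |zE μ (v i) (x n ω)| ≤ √(γ n) * (S n + ℓ n + √(γ n) * ∑ i, L i) := by
      refine (Finset.sum_le_sum fun i _ => hz i).trans (le_of_eq ?_)
      rw [← Finset.mul_sum, Finset.sum_add_distrib, Finset.sum_add_distrib, ← Finset.mul_sum]
    have hE2 : 2 * E ≤ e n * (√(γ n) * (S n + ℓ n + √(γ n) * ∑ i, L i)) := by
      calc 2 * E = 2 * (E / ‖x n ω - μ‖) * ‖x n ω - μ‖ := by rw [mul_assoc, hEeq]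
        _ ≤ 2 * (E / ‖x n ω - μ‖) * (C0 * ∑ i, |zE μ (v i) (x n ω)|) :=
          mul_le_mul_of_nonneg_left hθ (by positivity)
        _ = e n * ∑ i, |zE μ (v i) (x n ω)| := by rw [hen]; ring
        _ ≤ _ := mul_le_mul_of_nonneg_left hzs he0
    have hsq := sqrt_le_two hγ n
    have q1' : √(γ (n + 1)) * √(γ (n + 1)) = γ (n + 1) := Real.mul_self_sqrt hg'.le
    have q1 : √(γ n) * √(γ n) = γ n := Real.mul_self_sqrt hg.le
    have hss : √(γ (n + 1)) * √(γ n) ≤ 2 * γ (n + 1) := by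
      calc _ ≤ √(γ (n + 1)) * (2 * √(γ (n + 1))) :=
            mul_le_mul_of_nonneg_left hsq (Real.sqrt_nonneg _)
        _ = 2 * (√(γ (n + 1)) * √(γ (n + 1))) := by ring
        _ = _ := by rw [q1']
    set r := √(γ n) with hr
    have hr0 : 0 ≤ r := Real.sqrt_nonneg _
    have hT1 : √(γ (n + 1)) * E ≤ γ (n + 1) * (1 / 8 * S n + e n * ℓ n + r * ∑ i, L i) := by
      have t1 : √(γ (n + 1)) * (2 * E) ≤ (√(γ (n + 1)) * r) *
          (e n * (S n + ℓ n + r * ∑ i, L i)) := by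
        calc _ ≤ √(γ (n + 1)) * (e n * (r * (S n + ℓ n + r * ∑ i, L i))) :=
              mul_le_mul_of_nonneg_left hE2 (Real.sqrt_nonneg _)
          _ = _ := by ring
      have t2 : (√(γ (n + 1)) * r) * (e n * (S n + ℓ n + r * ∑ i, L i)) ≤
          (2 * γ (n + 1)) * (e n * (S n + ℓ n + r * ∑ i, L i)) :=
        mul_le_mul_of_nonneg_right hss (by positivity)
      have t3 : e n * (S n + ℓ n + r * ∑ i, L i) ≤ 1 / 8 * S n + e n * ℓ n + r * ∑ i, L i := by
        have a1 := mul_le_mul_of_nonneg_right he8 hS0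
        have a2 : e n * (r * ∑ i, L i) ≤ 1 * (r * ∑ i, L i) :=
          mul_le_mul_of_nonneg_right (by linarith) (by positivity)
        nlinarith
      have t4 := mul_le_mul_of_nonneg_left t3 hg'.le
      linarith
    have hT2 : √(γ (n + 1)) * ((∑ i, C i) * γ n) ≤ γ (n + 1) * (2 * (∑ i, C i) * r) := by
      calc _ = (√(γ (n + 1)) * r) * ((∑ i, C i) * r) := by rw [← q1]; ring
        _ ≤ (2 * γ (n + 1)) * ((∑ i, C i) * r) := mul_le_mul_of_nonneg_right hss (by positivity)
        _ = _ := by ring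
    have hstep : S (n + 1) ≤ (1 - 3 / 8 * γ (n + 1)) * S n +
        √(γ (n + 1)) * (E + (∑ i, C i) * γ n) := by
      calc S (n + 1) ≤ ∑ i, ((1 - 3 / 8 * γ (n + 1)) * |p i n| + √(γ (n + 1)) *
            (|eE P μ α (lam i) (v i) (x n ω)| + C i * γ n)) := Finset.sum_le_sum fun i _ =>
              (hC i n ω b1 b2).trans (add_le_add
                (mul_le_mul_of_nonneg_right (hc i) (abs_nonneg _)) le_rfl)
        _ = _ := by
          rw [Finset.sum_add_distrib, ← Finset.mul_sum, ← Finset.mul_sum, Finset.sum_add_distrib,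
            ← Finset.sum_mul]
    rw [hK]
    linarith
  refine recursion_tendsto_zero hγ.step (b := 1 / 4) (by norm_num) (fun n => le_max_right _ _)
    (e := fun n => K * √(γ n)) ?_ ?_
  · have : Tendsto (fun n => K * √(γ n)) atTop (𝓝 (K * √0)) :=
      ((Real.continuous_sqrt.tendsto _).comp hγ.lim).const_mul K
    simpa using this
  · filter_upwards [hrec] with n hn
    have hg' := hγ.pos (n + 1)
    have hg1 := hγ.le_one (n + 1)
    have hKs : 0 ≤ K * √(γ n) := by positivity
    refine max_le ?_ ?_
    · have h1 : pHat γ e ℓ (n + 1) = (1 - γ (n + 1) / 4) * pHat γ e ℓ n +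
        γ (n + 1) * (e n * ℓ n) := rfl
      have h2 : (1 - 1 / 4 * γ (n + 1)) * (S n - pHat γ e ℓ n) ≤
          (1 - 1 / 4 * γ (n + 1)) * max (S n - pHat γ e ℓ n) 0 :=
        mul_le_mul_of_nonneg_left (le_max_left _ _) (by linarith)
      change S (n + 1) - pHat γ e ℓ (n + 1) ≤ (1 - 1 / 4 * γ (n + 1)) *
        max (S n - pHat γ e ℓ n) 0 + γ (n + 1) * (K * √(γ n))
      rw [h1]
      linarith
    · exact add_nonneg (mul_nonneg (by linarith) (le_max_right _ _)) (mul_nonneg hg'.le hKs)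

end path

/-! ### Negligibility of the remainder and conclusion -/

section neg
variable {N : ℕ} {P : Matrix (Fin N) (Fin N) ℝ} {μ : Fin N → ℝ} {α : ℝ} {γ : ℕ → ℝ} {τ : ℝ}
    {Ω : Type*} [mΩ : MeasurableSpace Ω] {Pr : Measure Ω} [IsProbabilityMeasure Pr]
    {F : Filtration ℕ mΩ} {X : ℕ → Ω → Fin N} {x : ℕ → Ω → (Fin N → ℝ)}
    {m : ℝ} {ι : Type*} [Fintype ι] [DecidableEq ι] {lam : ι → ℝ} {v : ι → Fin N → ℝ}

lemma zE_meas (f : Fin N → ℝ) : Measurable (fun y => zE μ f y) := by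
  unfold zE
  exact Finset.measurable_sum _ fun b _ => ((measurable_pi_apply b).sub_const _).const_mul _

lemma epsH_meas (c : ℝ) : Measurable (fun y => epsH P μ α lam v c y) := by
  unfold epsH
  refine measurable_const.min (Measurable.const_mul (Measurable.div ?_ ?_) _)
  · refine Finset.measurable_sum _ fun i _ => ?_
    unfold eE
    have h : Measurable (fun y => ∑ j, piS P μ α y j * v i j + α * (1 + lam i) * zE μ (v i) y) :=
      (Finset.measurable_sum _ fun j _ => (piS_meas j).mul_const _).add ((zE_meas _).const_mul _)
    exact continuous_abs.measurable.comp h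
  · exact (measurable_id.sub_const μ).norm

lemma epsH_nonneg {c : ℝ} (hc : 0 ≤ c) (y : Fin N → ℝ) : 0 ≤ epsH P μ α lam v c y :=
  le_min zero_le_one (mul_nonneg hc (div_nonneg
    (Finset.sum_nonneg fun i _ => abs_nonneg _) (norm_nonneg _)))

lemma epsH_le (c : ℝ) (y : Fin N → ℝ) : epsH P μ α lam v c y ≤ 1 := min_le_left _ _

lemma epsH_tendsto (hB : BaseChain P μ) (hE : Eig P μ lam v) {c : ℝ} (hc : 0 ≤ c)
    {y : ℕ → Fin N → ℝ} (hy : Tendsto y atTop (𝓝 μ)) (hys : ∀ n, ∑ i, y n i = 1) :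
    Tendsto (fun n => epsH P μ α lam v c (y n)) atTop (𝓝 0) := by
  refine tendsto_order.2 ⟨fun δ hδ => Eventually.of_forall fun n =>
    hδ.trans_le (epsH_nonneg hc _), fun δ hδ => ?_⟩
  have hcard : (0 : ℝ) ≤ Fintype.card ι := Nat.cast_nonneg _
  set ε : ℝ := δ / (2 * (c * Fintype.card ι + 1)) with hε
  have hε0 : 0 < ε := by positivity
  have hexp : ∀ᶠ n in atTop, ∀ i, |eE P μ α (lam i) (v i) (y n)| ≤ ε * ‖y n - μ‖ := by
    rw [eventually_all]
    intro i
    filter_upwards [hy.eventually (pi_expansion (α := α) hB (hE.eig i) (hE.mean i) hε0)] with n hn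
    have := hn (hys n)
    simpa only [eE, zE, mul_comm (v i _)] using this
  filter_upwards [hexp] with n hx
  have hEle : ∑ i, |eE P μ α (lam i) (v i) (y n)| ≤ Fintype.card ι * ε * ‖y n - μ‖ := by
    calc _ ≤ ∑ _i : ι, ε * ‖y n - μ‖ := Finset.sum_le_sum fun i _ => hx i
      _ = _ := by rw [Finset.sum_const, Finset.card_univ, nsmul_eq_mul]; ring
  have hEd : (∑ i, |eE P μ α (lam i) (v i) (y n)|) / ‖y n - μ‖ ≤ Fintype.card ι * ε :=
    div_le_of_le_mul₀ (norm_nonneg _) (by positivity) hEle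
  refine (min_le_right _ _).trans_lt ((mul_le_mul_of_nonneg_left hEd hc).trans_lt ?_)
  have hcc : 0 ≤ c * Fintype.card ι := mul_nonneg hc hcard
  have : c * (Fintype.card ι * ε) = (c * Fintype.card ι) * δ / (2 * (c * Fintype.card ι + 1)) := by
    rw [hε]; ring
  rw [this, div_lt_iff₀ (by positivity)]
  nlinarith

lemma pHat_nonneg (hγ : GammaSeq γ τ) {e ℓ : ℕ → ℝ} (he : ∀ n, 0 ≤ e n) (hℓ : ∀ n, 0 ≤ ℓ n)
    (n : ℕ) : 0 ≤ pHat γ e ℓ n := by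
  induction n with
  | zero => exact le_rfl
  | succ n ih =>
    have h1 := hγ.pos (n + 1)
    have h2 := hγ.le_one (n + 1)
    exact add_nonneg (mul_nonneg (by linarith) ih)
      (mul_nonneg h1.le (mul_nonneg (he n) (hℓ n)))

lemma pHat_int {e ℓ : ℕ → Ω → ℝ} (hi : ∀ n, Integrable (fun ω => e n ω * ℓ n ω) Pr) (n : ℕ) :
    Integrable (fun ω => pHat γ (fun k => e k ω) (fun k => ℓ k ω) n) Pr := by
  induction n with
  | zero => exact integrable_const (0 : ℝ)
  | succ n ih =>
    have h : Integrable (fun ω => (1 - γ (n + 1) / 4) *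
        pHat γ (fun k => e k ω) (fun k => ℓ k ω) n + γ (n + 1) * (e n ω * ℓ n ω)) Pr :=
      (ih.const_mul _).add ((hi n).const_mul _)
    exact h

lemma pHat_mean (hγ : GammaSeq γ τ) {e ℓ : ℕ → Ω → ℝ} (he : ∀ n ω, 0 ≤ e n ω)
    (he1 : ∀ n ω, e n ω ≤ 1) (hem : ∀ n, Measurable (e n)) (hℓ : ∀ n ω, 0 ≤ ℓ n ω)
    (hℓm : ∀ n, Measurable (ℓ n)) (hℓb : ∀ n, ∃ C, ∀ ω, ℓ n ω ≤ C) {D : ℝ}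
    (hD : ∀ n, ∫ ω, ℓ n ω ^ 2 ∂Pr ≤ D) (hlim : ∀ᵐ ω ∂Pr, Tendsto (fun n => e n ω) atTop (𝓝 0)) :
    (∀ n, Integrable (fun ω => pHat γ (fun k => e k ω) (fun k => ℓ k ω) n) Pr) ∧
    Tendsto (fun n => ∫ ω, pHat γ (fun k => e k ω) (fun k => ℓ k ω) n ∂Pr) atTop (𝓝 0) := by
  have i1 : ∀ n, Integrable (fun ω => e n ω * ℓ n ω) Pr := fun n => by
    obtain ⟨C, hC⟩ := hℓb n
    refine integrable_of_bdd ((hem n).mul (hℓm n)).aestronglyMeasurable (C := 1 * C) fun ω => ?_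
    rw [norm_mul, Real.norm_eq_abs, Real.norm_eq_abs, abs_of_nonneg (he n ω),
      abs_of_nonneg (hℓ n ω)]
    exact mul_le_mul (he1 n ω) (hC ω) (hℓ n ω) zero_le_one
  have i2 : ∀ n, Integrable (fun ω => e n ω ^ 2) Pr := fun n =>
    integrable_of_bdd ((hem n).pow_const 2).aestronglyMeasurable (C := 1) fun ω => by
      rw [Real.norm_eq_abs, abs_of_nonneg (sq_nonneg _)]
      exact pow_le_one₀ (he n ω) (he1 n ω)
  have i3 : ∀ n, Integrable (fun ω => ℓ n ω ^ 2) Pr := fun n => by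
    obtain ⟨C, hC⟩ := hℓb n
    refine integrable_of_bdd ((hℓm n).pow_const 2).aestronglyMeasurable (C := C ^ 2) fun ω => ?_
    rw [Real.norm_eq_abs, abs_of_nonneg (sq_nonneg _)]
    exact pow_le_pow_left₀ (hℓ n ω) (hC ω) 2
  have hb : Tendsto (fun n => ∫ ω, e n ω ^ 2 ∂Pr) atTop (𝓝 0) := by
    have := tendsto_integral_of_dominated_convergence (μ := Pr) (F := fun n ω => e n ω ^ 2)
      (f := fun _ => (0 : ℝ)) (fun _ => 1) (fun n => (i2 n).aestronglyMeasurable)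
      (integrable_const _) (fun n => ae_of_all _ fun ω => by
        rw [Real.norm_eq_abs, abs_of_nonneg (sq_nonneg _)]
        exact pow_le_one₀ (he n ω) (he1 n ω)) (by
        filter_upwards [hlim] with ω hω
        simpa using hω.pow 2)
    simpa using this
  refine ⟨pHat_int i1, ?_⟩
  set b : ℕ → ℝ := fun n => ∫ ω, e n ω ^ 2 ∂Pr with hbdef
  have hb0 : ∀ n, 0 ≤ b n := fun n => integral_nonneg fun ω => sq_nonneg _
  have hκ : Tendsto (fun n => √(b n + γ n)) atTop (𝓝 0) := by
    have : Tendsto (fun n => √(b n + γ n)) atTop (𝓝 (√(0 + 0))) :=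
      (Real.continuous_sqrt.tendsto _).comp (hb.add hγ.lim)
    simpa using this
  have hCS : ∀ n, ∫ ω, e n ω * ℓ n ω ∂Pr ≤ √(b n + γ n) * ((1 + D) / 2) := fun n => by
    have hpos : 0 < b n + γ n := add_pos_of_nonneg_of_pos (hb0 n) (hγ.pos n)
    set κ := √(b n + γ n) with hκd
    have hκ0 : 0 < κ := Real.sqrt_pos.2 hpos
    have hκ2 : κ * κ = b n + γ n := Real.mul_self_sqrt hpos.le
    have j1 : Integrable (fun ω => 1 / (2 * κ) * e n ω ^ 2) Pr := (i2 n).const_mul _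
    have j2 : Integrable (fun ω => κ / 2 * ℓ n ω ^ 2) Pr := (i3 n).const_mul _
    calc ∫ ω, e n ω * ℓ n ω ∂Pr ≤ ∫ ω, (1 / (2 * κ) * e n ω ^ 2 + κ / 2 * ℓ n ω ^ 2) ∂Pr := by
          refine integral_mono (i1 n) (j1.add j2) fun ω => ?_
          have h := sq_nonneg (e n ω - κ * ℓ n ω)
          have h2 : 1 / (2 * κ) * e n ω ^ 2 + κ / 2 * ℓ n ω ^ 2 - e n ω * ℓ n ω =
              1 / (2 * κ) * (e n ω - κ * ℓ n ω) ^ 2 := by field_simp; ring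
          have h3 : 0 ≤ 1 / (2 * κ) * (e n ω - κ * ℓ n ω) ^ 2 := by positivity
          simp only []
          linarith
      _ = 1 / (2 * κ) * b n + κ / 2 * ∫ ω, ℓ n ω ^ 2 ∂Pr := by
          rw [integral_add j1 j2, integral_const_mul, integral_const_mul]
      _ ≤ 1 / (2 * κ) * (κ * κ) + κ / 2 * D := by
          refine add_le_add (mul_le_mul_of_nonneg_left ?_ (by positivity))
            (mul_le_mul_of_nonneg_left (hD n) (by positivity))
          rw [hκ2]; linarith [hγ.pos n]
      _ = _ := by field_simp
  refine recursion_tendsto_zero hγ.step (b := 1 / 4) (by norm_num)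
    (fun n => integral_nonneg fun ω => pHat_nonneg hγ (fun k => he k ω) (fun k => hℓ k ω) n)
    (e := fun n => √(b n + γ n) * ((1 + D) / 2)) (by simpa using hκ.mul_const ((1 + D) / 2)) ?_
  refine Eventually.of_forall fun n => ?_
  have hstep : ∫ ω, pHat γ (fun k => e k ω) (fun k => ℓ k ω) (n + 1) ∂Pr =
      (1 - γ (n + 1) / 4) * ∫ ω, pHat γ (fun k => e k ω) (fun k => ℓ k ω) n ∂Pr +
      γ (n + 1) * ∫ ω, e n ω * ℓ n ω ∂Pr := by
    have j1 : Integrable (fun ω => (1 - γ (n + 1) / 4) *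
      pHat γ (fun k => e k ω) (fun k => ℓ k ω) n) Pr := (pHat_int i1 n).const_mul _
    have j2 : Integrable (fun ω => γ (n + 1) * (e n ω * ℓ n ω)) Pr := (i1 n).const_mul _
    rw [← integral_const_mul, ← integral_const_mul, ← integral_add j1 j2]
    rfl
  rw [hstep]
  have := mul_le_mul_of_nonneg_left (hCS n) (hγ.pos (n + 1)).le
  linarith

end neg

section final
variable {N : ℕ} {P : Matrix (Fin N) (Fin N) ℝ} {μ : Fin N → ℝ} {α : ℝ} {γ : ℕ → ℝ} {τ : ℝ}
    {Ω : Type*} [mΩ : MeasurableSpace Ω] {Pr : Measure Ω} [IsProbabilityMeasure Pr]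
    {F : Filtration ℕ mΩ} {X : ℕ → Ω → Fin N} {x : ℕ → Ω → (Fin N → ℝ)}
    {m : ℝ} {ι : Type*} [Fintype ι] [DecidableEq ι] {lam : ι → ℝ} {v : ι → Fin N → ℝ}

lemma exp_diff_le (A B : ℝ) :
    ‖Complex.exp (Complex.I * (A : ℂ)) - Complex.exp (Complex.I * (B : ℂ))‖ ≤ |A - B| := by
  have h : Complex.exp (Complex.I * (A : ℂ)) - Complex.exp (Complex.I * (B : ℂ)) =
      Complex.exp (Complex.I * (B : ℂ)) * (Complex.exp (Complex.I * ((A - B : ℝ) : ℂ)) - 1) := by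
    rw [mul_sub, ← Complex.exp_add, mul_one]
    congr 2
    push_cast; ring
  rw [h, norm_mul, mul_comm Complex.I (B : ℂ), Complex.norm_exp_ofReal_mul_I, one_mul]
  exact Real.norm_exp_I_mul_ofReal_sub_one_le

lemma exp_diff_le_two (A B : ℝ) :
    ‖Complex.exp (Complex.I * (A : ℂ)) - Complex.exp (Complex.I * (B : ℂ))‖ ≤ 2 := by
  refine (norm_sub_le _ _).trans ?_
  rw [mul_comm Complex.I (B : ℂ), mul_comm Complex.I (A : ℂ), Complex.norm_exp_ofReal_mul_I,
    Complex.norm_exp_ofReal_mul_I]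
  norm_num

lemma exp_int {A : Ω → ℝ} (hA : Measurable A) :
    Integrable (fun ω => Complex.exp (Complex.I * ((A ω : ℝ) : ℂ))) Pr := by
  refine integrable_of_bdd (C := 1) ?_ fun ω => ?_
  · exact (Complex.measurable_exp.comp ((Complex.measurable_ofReal.comp hA).const_mul _)).aestronglyMeasurable
  · rw [mul_comm, Complex.norm_exp_ofReal_mul_I]

/-- If `|A - B| ≤ p + o` with `p → 0` in mean and `o → 0` almost surely then the characteristic
functions are asymptotically equal. -/
lemma char_close {A B p : ℕ → Ω → ℝ} (hA : ∀ n, Measurable (A n)) (hBm : ∀ n, Measurable (B n))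
    (hp0 : ∀ n ω, 0 ≤ p n ω) (hpi : ∀ n, Integrable (p n) Pr)
    (hp : Tendsto (fun n => ∫ ω, p n ω ∂Pr) atTop (𝓝 0))
    (ho : ∀ᵐ ω ∂Pr, Tendsto (fun n => max (|A n ω - B n ω| - p n ω) 0) atTop (𝓝 0)) {z : ℂ}
    (hz : Tendsto (fun n => ∫ ω, Complex.exp (Complex.I * ((B n ω : ℝ) : ℂ)) ∂Pr) atTop (𝓝 z)) :
    Tendsto (fun n => ∫ ω, Complex.exp (Complex.I * ((A n ω : ℝ) : ℂ)) ∂Pr) atTop (𝓝 z) := by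
  set o : ℕ → Ω → ℝ := fun n ω => min 2 (max (|A n ω - B n ω| - p n ω) 0) with hodef
  have ho0 : ∀ n ω, 0 ≤ o n ω := fun n ω => le_min (by norm_num) (le_max_right _ _)
  have hom : ∀ n, AEStronglyMeasurable (o n) Pr := fun n => by
    have h1 : AEMeasurable (fun ω => |A n ω - B n ω|) Pr :=
      (continuous_abs.measurable.comp ((hA n).sub (hBm n))).aemeasurable
    exact (aemeasurable_const.min ((h1.sub (hpi n).aemeasurable).max
      aemeasurable_const)).aestronglyMeasurable
  have hob : ∀ n ω, ‖o n ω‖ ≤ 2 := fun n ω => by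
    rw [Real.norm_eq_abs, abs_of_nonneg (ho0 n ω)]; exact min_le_left _ _
  have hoi : ∀ n, Integrable (o n) Pr := fun n => integrable_of_bdd (hom n) (hob n)
  have hol : Tendsto (fun n => ∫ ω, o n ω ∂Pr) atTop (𝓝 0) := by
    have := tendsto_integral_of_dominated_convergence (μ := Pr) (F := o)
      (f := fun _ => (0 : ℝ)) (fun _ => 2) hom (integrable_const _)
      (fun n => ae_of_all _ (hob n)) (by
        filter_upwards [ho] with ω hω
        have h2 : Tendsto (fun _ : ℕ => (2 : ℝ)) atTop (𝓝 2) := tendsto_const_nhds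
        simpa using h2.min hω)
    simpa using this
  have hdiff : Tendsto (fun n => ∫ ω, Complex.exp (Complex.I * ((A n ω : ℝ) : ℂ)) ∂Pr -
      ∫ ω, Complex.exp (Complex.I * ((B n ω : ℝ) : ℂ)) ∂Pr) atTop (𝓝 0) := by
    refine squeeze_zero_norm (fun n => ?_) (by simpa using hp.add hol)
    rw [← integral_sub (exp_int (hA n)) (exp_int (hBm n)), ← integral_add (hpi n) (hoi n)]
    refine norm_integral_le_of_norm_le ((hpi n).add (hoi n)) (ae_of_all _ fun ω => ?_)
    have h1 := exp_diff_le (A n ω) (B n ω)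
    have h2 := exp_diff_le_two (A n ω) (B n ω)
    have h3 := le_max_left (|A n ω - B n ω| - p n ω) 0
    have h4 := hp0 n ω
    change _ ≤ p n ω + min 2 (max (|A n ω - B n ω| - p n ω) 0)
    rcases le_total 2 (max (|A n ω - B n ω| - p n ω) 0) with h | h
    · rw [min_eq_left h]; linarith
    · rw [min_eq_right h]; linarith
  have := hdiff.add hz
  simpa using this

lemma Walk.full_clt (hB : BaseChain P μ) (hα : 0 ≤ α) (hγ : GammaSeq γ τ)
    (hW : Walk P μ α γ Pr F X x) (hE : Eig P μ lam v) (hm : 0 < m) (hmμ : ∀ i, m < μ i)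
    (s : ι → ℝ) :
    Tendsto (fun n => ∫ ω, Complex.exp (Complex.I *
      ((∑ i, s i * (zE μ (v i) (x n ω) / √(γ n)) : ℝ) : ℂ)) ∂Pr) atTop
      (𝓝 (Complex.exp ((-(∑ i, s i ^ 2 * ((1 + lam i) / (1 - lam i) /
        ((1 + α * (1 + lam i)) + (1 + α * (1 + lam i)) - τ))) / 2 : ℝ) : ℂ))) := by
  set β : ι → ℝ := fun i => 1 + α * (1 + lam i) with hβ
  have hβ1 : ∀ i, 1 ≤ β i := fun i => by
    have := mul_nonneg hα (by linarith [(hE.lt i).1] : 0 ≤ 1 + lam i)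
    simp only [hβ]; linarith
  set c : ℝ := 2 * ∑ a, ∑ i, |μ a * v i a| with hc
  have hc0 : 0 ≤ c := mul_nonneg (by norm_num)
    (Finset.sum_nonneg fun a _ => Finset.sum_nonneg fun i _ => abs_nonneg _)
  set R : ι → ℕ → Ω → ℝ := fun i n ω => linR P μ α γ m (β i) (v i) X x n ω with hR
  set e : ℕ → Ω → ℝ := fun n ω => epsH P μ α lam v c (x n ω) with he
  set ℓ : ℕ → Ω → ℝ := fun n ω => ∑ i, |R i n ω| with hℓ
  have hxm : ∀ n, Measurable (x n) := fun n => (hW.xm n).mono (F.le _) le_rfl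
  have hRm : ∀ i n, Measurable (R i n) := fun i n => (linR_meas hB hm hW n).mono (F.le _) le_rfl
  have hRb : ∀ i n, ∃ C, ∀ ω, |R i n ω| ≤ C := fun i n => linR_bdd hB hm n
  choose D hD0 hD using fun i => linR_L2 (f := v i) hB hm hγ hW (hβ1 i)
  have hR2i : ∀ i n, Integrable (fun ω => R i n ω ^ 2) Pr := fun i n => by
    obtain ⟨C, hC⟩ := hRb i n
    refine integrable_of_bdd ((hRm i n).pow_const 2).aestronglyMeasurable (C := C ^ 2) fun ω => ?_
    rw [norm_pow]; exact pow_le_pow_left₀ (norm_nonneg _) (hC ω) 2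
  have hℓm : ∀ n, Measurable (ℓ n) := fun n => Finset.measurable_sum _ fun i _ =>
    continuous_abs.measurable.comp (hRm i n)
  have hℓ0 : ∀ n ω, 0 ≤ ℓ n ω := fun n ω => Finset.sum_nonneg fun i _ => abs_nonneg _
  have hℓb : ∀ n, ∃ C, ∀ ω, ℓ n ω ≤ C := fun n => by
    choose C hC using fun i => hRb i n
    exact ⟨∑ i, C i, fun ω => Finset.sum_le_sum fun i _ => hC i ω⟩
  have hℓ2 : ∀ n, ∫ ω, ℓ n ω ^ 2 ∂Pr ≤ Fintype.card ι * ∑ i, D i := fun n => by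
    have hle : ∀ ω, ℓ n ω ^ 2 ≤ Fintype.card ι * ∑ i, R i n ω ^ 2 := fun ω => by
      refine (sq_sum_le_card_mul_sum_sq (s := univ)).trans (le_of_eq ?_)
      rw [Finset.card_univ]
      congr 1
      exact Finset.sum_congr rfl fun i _ => sq_abs _
    have j1 : Integrable (fun ω => (Fintype.card ι : ℝ) * ∑ i, R i n ω ^ 2) Pr :=
      (integrable_finsetSum _ fun i _ => hR2i i n).const_mul _
    calc ∫ ω, ℓ n ω ^ 2 ∂Pr ≤ ∫ ω, (Fintype.card ι : ℝ) * ∑ i, R i n ω ^ 2 ∂Pr :=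
          integral_mono_of_nonneg (ae_of_all _ fun ω => sq_nonneg _) j1 (ae_of_all _ hle)
      _ = Fintype.card ι * ∑ i, ∫ ω, R i n ω ^ 2 ∂Pr := by
          rw [integral_const_mul, integral_finsetSum _ fun i _ => hR2i i n]
      _ ≤ _ := mul_le_mul_of_nonneg_left (Finset.sum_le_sum fun i _ => hD i n) (Nat.cast_nonneg _)
  have hconv := hW.ae_tendsto hB hα hγ
  obtain ⟨hpi, hpl⟩ := pHat_mean (Pr := Pr) hγ (e := e) (ℓ := ℓ)
    (fun n ω => epsH_nonneg hc0 _) (fun n ω => epsH_le _ _)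
    (fun n => (epsH_meas c).comp (hxm n)) hℓ0 hℓm hℓb hℓ2 (by
      filter_upwards [hconv] with ω hω
      exact epsH_tendsto hB hE hc0 hω fun n => (hW.simp n ω).2)
  set ph : ℕ → Ω → ℝ := fun n ω => pHat γ (fun k => e k ω) (fun k => ℓ k ω) n with hph
  set T := ∑ i, |s i| with hT
  have hT0 : 0 ≤ T := Finset.sum_nonneg fun i _ => abs_nonneg _
  have hph0 : ∀ n ω, 0 ≤ ph n ω := fun n ω => pHat_nonneg hγ
    (fun k => epsH_nonneg hc0 _) (fun k => hℓ0 k ω) n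
  refine char_close (B := fun n ω => ∑ i, s i * R i n ω) (p := fun n ω => T * ph n ω)
    (fun n => Finset.measurable_sum _ fun i _ =>
      (((zE_meas (v i)).comp (hxm n)).div_const _).const_mul _)
    (fun n => Finset.measurable_sum _ fun i _ => (hRm i n).const_mul _)
    (fun n ω => mul_nonneg hT0 (hph0 n ω)) (fun n => (hpi n).const_mul _) ?_ ?_
    (hW.lin_clt hB hα hγ hE hm hmμ hβ1 s)
  · have := hpl.const_mul T
    simp only [mul_zero] at this
    refine this.congr fun n => ?_
    rw [integral_const_mul]
  · choose L hL0 hL using fun i => bdd_fin (f := fun y j => poisU P μ α (v i) y j) hm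
      (poisU_contDiff hB (v i))
    filter_upwards [hconv] with ω hω
    have hrem := path_rem hB hα hγ hW hE hm hmμ hω
    set y : ℕ → ℝ := fun n => max (∑ i, |pE P μ α γ m (β i) (v i) X x n ω| - ph n ω) 0 with hy
    have hy' : Tendsto y atTop (𝓝 0) := hrem
    have hsq : Tendsto (fun n => √(γ n)) atTop (𝓝 0) := by
      have : Tendsto (fun n => √(γ n)) atTop (𝓝 (√0)) :=
        (Real.continuous_sqrt.tendsto _).comp hγ.lim
      simpa using this
    have hlim : Tendsto (fun n => T * (y n + √(γ n) * ∑ i, L i)) atTop (𝓝 0) := by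
      simpa using (hy'.add (hsq.mul_const (∑ i, L i))).const_mul T
    refine squeeze_zero' (Eventually.of_forall fun n => le_max_right _ _) ?_ hlim
    filter_upwards [ev_box hmμ hω (fun n => hW.simp n ω)] with n b1
    have hg := hγ.pos n
    have s1 : √(γ n) ≠ 0 := (Real.sqrt_pos.2 hg).ne'
    have q1 : √(γ n) * √(γ n) = γ n := Real.mul_self_sqrt hg.le
    have hy0 : 0 ≤ y n := le_max_right _ _
    have hSL : 0 ≤ ∑ i, L i := Finset.sum_nonneg fun i _ => hL0 i
    refine max_le ?_ (by positivity)
    have hterm : ∀ i, |zE μ (v i) (x n ω) / √(γ n) - R i n ω| ≤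
        |pE P μ α γ m (β i) (v i) X x n ω| + √(γ n) * L i := fun i => by
      have : zE μ (v i) (x n ω) / √(γ n) - R i n ω = pE P μ α γ m (β i) (v i) X x n ω -
          √(γ n) * poisU P μ α (v i) (x n ω) (X n ω) := by
        have h1 : γ n / √(γ n) = √(γ n) := by rw [div_eq_iff s1, q1]
        simp only [hR, pE]
        rw [add_div, mul_div_right_comm, h1]
        ring
      rw [this]
      refine (abs_sub _ _).trans (add_le_add le_rfl ?_)
      rw [abs_mul, abs_of_nonneg (Real.sqrt_nonneg _)]
      exact mul_le_mul_of_nonneg_left (hL i _ b1 _) (Real.sqrt_nonneg _)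
    have hAB : |∑ i, s i * (zE μ (v i) (x n ω) / √(γ n)) - ∑ i, s i * R i n ω| ≤
        T * (∑ i, |pE P μ α γ m (β i) (v i) X x n ω| + √(γ n) * ∑ i, L i) := by
      rw [← Finset.sum_sub_distrib, Finset.mul_sum, ← Finset.sum_add_distrib, Finset.mul_sum]
      refine (Finset.abs_sum_le_sum_abs _ _).trans (Finset.sum_le_sum fun i _ => ?_)
      rw [← mul_sub, abs_mul]
      exact mul_le_mul (Finset.single_le_sum (f := fun i => |s i|) (fun j _ => abs_nonneg _)
        (mem_univ i)) (hterm i) (abs_nonneg _) hT0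
    have h2 : ∑ i, |pE P μ α γ m (β i) (v i) X x n ω| - ph n ω ≤ y n := le_max_left _ _
    have h3 := mul_le_mul_of_nonneg_left h2 hT0
    change |∑ i, s i * (zE μ (v i) (x n ω) / √(γ n)) - ∑ i, s i * R i n ω| - T * ph n ω ≤
      T * (y n + √(γ n) * ∑ i, L i)
    linarith

end final

/-- **CLT for the generalized weighted empirical measure of the SRRW:**
`γ_n^{−1/2}(x_n − μ)` converges in distribution to `N(0, V_x(α))`, where
`V_x(α) = ∑_{i=1}^{N−1} [1/(2α(1+λ_i)+2−𝟙_{a=1})]·[(1+λ_i)/(1−λ_i)]·u_i u_iᵀ`. -/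
theorem srrw_empirical_measure_clt
    {N : ℕ} (hN : 2 ≤ N)
    (P : Matrix (Fin N) (Fin N) ℝ) (μv : Fin N → ℝ)
    (hP_nonneg : ∀ i j, 0 ≤ P i j)
    (hP_rowsum : ∀ i, ∑ j, P i j = 1)
    (hP_irred_aperiodic : ∃ k : ℕ, ∀ i j, 0 < (P ^ k) i j)
    (hμ_pos : ∀ i, 0 < μv i) (hμ_sum : ∑ i, μv i = 1)
    (hrev : ∀ i j, μv i * P i j = μv j * P j i)
    -- the eigenvalues `λ_1 ≤ ⋯ ≤ λ_{N−1}` and left eigenvectors `u_i` of `P`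
    -- (normalized as `u_i = D_μ v_i`, `u_iᵀ v_i = 1`), the remaining eigenpair being `(1, μ)`
    (lam : Fin (N - 1) → ℝ) (u : Fin (N - 1) → (Fin N → ℝ))
    (hlam_mono : Monotone lam)
    (hlam : ∀ i, -1 < lam i ∧ lam i < 1)
    (hu_eig : ∀ i, Pᵀ *ᵥ u i = lam i • u i)
    (hu_sum : ∀ i, ∑ j, u i j = 0)
    (hu_norm : ∀ i, ∑ j, (u i j) ^ 2 / μv j = 1)
    (hu_orth : ∀ i i', i ≠ i' → ∑ j, u i j * u i' j / μv j = 0)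
    (α : ℝ) (hα : 0 ≤ α)
    (a : ℝ) (ha : 1 / 2 < a) (ha1 : a ≤ 1)
    (γ : ℕ → ℝ) (hγ : ∀ n, γ n = ((n : ℝ) + 1) ^ (-a))
    {Ω : Type*} [mΩ : MeasurableSpace Ω]
    (Pr : Measure Ω) [IsProbabilityMeasure Pr]
    (F : Filtration ℕ mΩ)
    (X : ℕ → Ω → Fin N) (x : ℕ → Ω → (Fin N → ℝ))
    (hX_adapted : ∀ n, Measurable[F n] (X n))
    (hx_adapted : ∀ n, Measurable[F n] (x n))
    (hx_simplex : ∀ n ω, x n ω ∈ intSimplex N)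
    (hcond : ∀ (n : ℕ) (j : Fin N),
      (Pr[(fun ω => if X (n + 1) ω = j then (1 : ℝ) else 0)|F n]) =ᵐ[Pr]
        fun ω => srrwKernel P μv α (x n ω) (X n ω) j)
    (hrec : ∀ (n : ℕ) (ω : Ω),
      x (n + 1) ω = x n ω + γ (n + 1) • (Pi.single (X (n + 1) ω) (1 : ℝ) - x n ω))
    (hstable : ∀ᵐ ω ∂Pr, ∃ C : Set (Fin N → ℝ),
      IsCompact C ∧ C ⊆ intSimplex N ∧ ∀ n, x n ω ∈ C) :
    TendstoGaussian Pr
      (fun n ω => (γ n) ^ (-(1 : ℝ) / 2) • (x n ω - μv))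
      (∑ i, ((1 / (2 * α * (1 + lam i) + 2 - (if a = 1 then (1 : ℝ) else 0))) *
        ((1 + lam i) / (1 - lam i))) • vecMulVec (u i) (u i)) := by
  have hB : BaseChain P μv := ⟨hP_nonneg, hP_rowsum, hP_irred_aperiodic, hμ_pos, hμ_sum, hrev⟩
  have hG := gammaSeq_of ha ha1 hγ
  have hW : Walk P μv α γ Pr F X x :=
    ⟨hX_adapted, hx_adapted, hx_simplex, hcond, hrec, hstable⟩
  have hE := eig_of hN hB lam u hlam hu_eig hu_sum hu_norm hu_orth
  haveI : Nonempty (Fin N) := ⟨⟨0, by omega⟩⟩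
  obtain ⟨i0, hi0⟩ := Finite.exists_min μv
  have hm : 0 < μv i0 / 2 := by linarith [hμ_pos i0]
  have hmμ : ∀ i, μv i0 / 2 < μv i := fun i => by linarith [hi0 i, hμ_pos i0]
  intro t
  have key := hW.full_clt hB hα hG hE hm hmμ (fun i => ∑ a, t a * u i a)
  have hval : ∑ i, (∑ a, t a * u i a) ^ 2 * ((1 + lam i) / (1 - lam i) /
      ((1 + α * (1 + lam i)) + (1 + α * (1 + lam i)) - (if a = 1 then (1 : ℝ) else 0))) =
      t ⬝ᵥ ((∑ i, ((1 / (2 * α * (1 + lam i) + 2 - (if a = 1 then (1 : ℝ) else 0))) *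
        ((1 + lam i) / (1 - lam i))) • vecMulVec (u i) (u i)) *ᵥ t) := by
    rw [Matrix.sum_mulVec, dotProduct_sum]
    refine Finset.sum_congr rfl fun i _ => ?_
    rw [smul_mulVec, dotProduct_smul, vecMulVec_mulVec]
    have h1 : t ⬝ᵥ u i = ∑ a, t a * u i a := rfl
    have h2 : u i ⬝ᵥ t = ∑ a, t a * u i a := by rw [dotProduct_comm]; rfl
    have h3 : (1 + α * (1 + lam i)) + (1 + α * (1 + lam i)) - (if a = 1 then (1 : ℝ) else 0) =
      2 * α * (1 + lam i) + 2 - (if a = 1 then (1 : ℝ) else 0) := by ring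
    rw [h3, h2, op_smul_eq_smul, dotProduct_smul, h1, smul_eq_mul, smul_eq_mul]
    ring
  rw [hval] at key
  refine key.congr fun n => ?_
  refine integral_congr_ae (ae_of_all _ fun ω => ?_)
  simp only []
  congr 3
  have hpow : (γ n) ^ (-(1 : ℝ) / 2) = (√(γ n))⁻¹ := by
    rw [neg_div, Real.rpow_neg (hG.pos n).le, Real.sqrt_eq_rpow]
  have h0 : ∑ k, (x n ω - μv) k = 0 := by
    simp only [Pi.sub_apply, Finset.sum_sub_distrib, (hx_simplex n ω).2, hμ_sum, sub_self]
  have hcomp : ∀ j, (x n ω - μv) j = ∑ i, u i j * zE μv (fun b => u i b / μv b) (x n ω) :=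
    fun j => by
    rw [hE.complete _ h0 j]
    refine Finset.sum_congr rfl fun i _ => ?_
    rw [mul_div_cancel₀ _ (hμ_pos j).ne']
    rfl
  simp only [Pi.smul_apply, smul_eq_mul, hpow]
  have hR : ∀ j, t j * ((√(γ n))⁻¹ * (x n ω - μv) j) =
      ∑ i, (t j * u i j) * (zE μv (fun b => u i b / μv b) (x n ω) / √(γ n)) := fun j => by
    rw [hcomp, Finset.mul_sum, Finset.mul_sum]
    exact Finset.sum_congr rfl fun i _ => by ring
  rw [Finset.sum_congr rfl fun j _ => hR j, Finset.sum_comm]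
  exact Finset.sum_congr rfl fun i _ => by rw [Finset.sum_mul]
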